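/- Weighted Superhedging Theorem (Theorem 5.1(b)): Let φ ≥ 1 be a random variable with |g^i| ≤ φ for i = 1,…,e, assume NA(𝒫) holds, and let f : Ω → ℝ be upper semianalytic with |f| ≤ φ. Then π(f) := inf{x ∈ ℝ : ∃(H,h) ∈ ℋ × ℝ^e with x + (H·S)_T + hg ≥ f 𝒫-q.s.} satisfies π(f) = sup_{Q∈𝒬_φ} E_Q[f] ∈ (−∞, ∞], and there exist (H,h) ∈ ℋ × ℝ^e such that π(f) + (H·S)_T + hg ≥ f 𝒫-q.s., where 𝒬_φ := {Q ∈ 𝒬 : E_Q[φ] < ∞}. -/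

import Mathlib

open MeasureTheory Set Filter Topology
open scoped ENNReal NNReal

noncomputable section

namespace BN

/-- The universal completion of the ambient measurable structure on `α`:
a set is measurable iff it is null-measurable for every probability measure. -/
def univComp (α : Type*) [MeasurableSpace α] : MeasurableSpace α where
  MeasurableSet' s := ∀ μ : Measure α, IsProbabilityMeasure μ → NullMeasurableSet s μ
  measurableSet_empty := fun _ _ => MeasurableSet.empty.nullMeasurableSet
  measurableSet_compl := fun _ hs μ hμ => (hs μ hμ).compl
  measurableSet_iUnion := fun _ hf μ hμ => NullMeasurableSet.iUnion fun i => hf i μ hμ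

/-- `N` is `PP`-polar: it is contained in an `m`-measurable set which is null under
every `P ∈ PP`. -/
def IsPolar {α : Type*} [MeasurableSpace α] (PP : Set (Measure α)) (m : MeasurableSpace α)
    (N : Set α) : Prop :=
  ∃ A : Set α, MeasurableSet[m] A ∧ N ⊆ A ∧ ∀ P ∈ PP, P A = 0

/-- A property holds `PP`-quasi surely if its complement is `PP`-polar. -/
def QuasiSure {α : Type*} [mα : MeasurableSpace α] (PP : Set (Measure α))
    (m : MeasurableSpace α) (p : α → Prop) : Prop :=
  @IsPolar α mα PP m {ω | ¬ p ω}

/-- Expectation of a real random variable, with the convention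
`E[f] = E[f⁺] - E[f⁻]` and `∞ - ∞ = -∞` (which holds in `EReal`). -/
def expec {α : Type*} [MeasurableSpace α] (Q : Measure α) (f : α → ℝ) : EReal :=
  ((∫⁻ x, ENNReal.ofReal (f x) ∂Q : ℝ≥0∞) : EReal)
    - ((∫⁻ x, ENNReal.ofReal (-f x) ∂Q : ℝ≥0∞) : EReal)

/-- Positive part of an extended real, valued in `ℝ≥0∞`. -/
def posE (x : EReal) : ℝ≥0∞ := if x = ⊤ then ⊤ else ENNReal.ofReal x.toReal

/-- Expectation of an extended-real random variable, with the convention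
`E[f] = E[f⁺] - E[f⁻]` and `∞ - ∞ = -∞`. -/
def eexpec {α : Type*} [MeasurableSpace α] (Q : Measure α) (f : α → EReal) : EReal :=
  ((∫⁻ x, posE (f x) ∂Q : ℝ≥0∞) : EReal) - ((∫⁻ x, posE (-(f x)) ∂Q : ℝ≥0∞) : EReal)

/-- A real-valued function is upper semianalytic if all its strict superlevel sets
are analytic. -/
def UpperSemianalytic {α : Type*} [TopologicalSpace α] (f : α → ℝ) : Prop :=
  ∀ c : ℝ, AnalyticSet {x | c < f x}

/-- An extended-real-valued function is upper semianalytic if all its strict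
superlevel sets `{f > c}`, `c ∈ ℝ`, are analytic. -/
def UpperSemianalyticE {α : Type*} [TopologicalSpace α] (f : α → EReal) : Prop :=
  ∀ c : ℝ, AnalyticSet {x | (c : EReal) < f x}

/-- Convexity of a set of probability measures. -/
def ConvexPM {α : Type*} [MeasurableSpace α] (C : Set (ProbabilityMeasure α)) : Prop :=
  ∀ μ ∈ C, ∀ ν ∈ C, ∀ a b : ℝ≥0∞, a + b = 1 →
    ∀ ξ : ProbabilityMeasure α, (ξ : Measure α) = a • (μ : Measure α) + b • (ν : Measure α) →
      ξ ∈ C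

/-! ### The general (non-Polish) setting of Section 2 -/

section General

variable {Ω : Type*} [MeasurableSpace Ω]

/-- Predictability of a trading strategy `H` with respect to a filtration `F`:
the holding `H (u+1)` over the period `(u, u+1]` is `F u`-measurable. -/
def PredictableF (F : ℕ → MeasurableSpace Ω) (T d : ℕ) (H : ℕ → Ω → Fin d → ℝ) : Prop :=
  ∀ u : ℕ, u < T → Measurable[F u] (H (u + 1))

/-- The final gain `(H · S)_T` from trading `H` in the stocks `S`. -/
def gainF {d : ℕ} (S : ℕ → Ω → Fin d → ℝ) (H : ℕ → Ω → Fin d → ℝ) (T : ℕ) (ω : Ω) : ℝ :=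
  ∑ u : Fin T, ∑ i : Fin d, H (u + 1) ω i * (S (u + 1) ω i - S u ω i)

/-- The no-arbitrage condition `NA(PP)` (no options). -/
def NAF (F : ℕ → MeasurableSpace Ω) (T d : ℕ) (S : ℕ → Ω → Fin d → ℝ)
    (PP : Set (Measure Ω)) : Prop :=
  ∀ H : ℕ → Ω → Fin d → ℝ, PredictableF F T d H →
    QuasiSure PP ‹MeasurableSpace Ω› (fun ω => 0 ≤ gainF S H T ω) →
      QuasiSure PP ‹MeasurableSpace Ω› (fun ω => gainF S H T ω = 0)

/-- The cone `𝒞` of claims superreplicable from zero initial capital. -/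
def Cset (F : ℕ → MeasurableSpace Ω) (T d : ℕ) (S : ℕ → Ω → Fin d → ℝ) : Set (Ω → ℝ) :=
  {W | ∃ H : ℕ → Ω → Fin d → ℝ, PredictableF F T d H ∧
    ∃ K : Ω → ℝ, Measurable K ∧ (∀ ω, 0 ≤ K ω) ∧ ∀ ω, W ω = gainF S H T ω - K ω}

/-- The superhedging price (no options), with values in `EReal` (`inf ∅ = +∞`). -/
def superPriceF (F : ℕ → MeasurableSpace Ω) (T d : ℕ) (S : ℕ → Ω → Fin d → ℝ)
    (PP : Set (Measure Ω)) (f : Ω → ℝ) : EReal :=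
  sInf ((fun x : ℝ => (x : EReal)) ''
    {x : ℝ | ∃ H : ℕ → Ω → Fin d → ℝ, PredictableF F T d H ∧
      QuasiSure PP ‹MeasurableSpace Ω› (fun ω => f ω ≤ x + gainF S H T ω)})

end General

/-! ### The one-period setting of Section 3 -/

section OnePeriod

variable {Ω : Type*} [MeasurableSpace Ω] {d : ℕ}

/-- One-period no-arbitrage condition `NA(PP)` for the increment `ΔS`. -/
def NA1 (PP : Set (Measure Ω)) (ΔS : Ω → Fin d → ℝ) : Prop :=
  ∀ y : Fin d → ℝ,
    QuasiSure PP ‹MeasurableSpace Ω› (fun ω => 0 ≤ ∑ i, y i * ΔS ω i) →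
      QuasiSure PP ‹MeasurableSpace Ω› (fun ω => ∑ i, y i * ΔS ω i = 0)

/-- The martingale measures dominated by `PP` in the one-period market:
`𝒬 = {Q : Q ⋘ 𝒫, E_Q[ΔS] = 0}`. -/
def Q1set (PP : Set (Measure Ω)) (ΔS : Ω → Fin d → ℝ) : Set (Measure Ω) :=
  {Q | IsProbabilityMeasure Q ∧ (∃ P ∈ PP, Q ≪ P) ∧
    ∀ i, expec Q (fun ω => ΔS ω i) = 0}

/-- One-period superhedging price, with values in `EReal` (`inf ∅ = +∞`). -/
def superPrice1 (PP : Set (Measure Ω)) (ΔS : Ω → Fin d → ℝ) (f : Ω → ℝ) : EReal :=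
  sInf ((fun x : ℝ => (x : EReal)) ''
    {x : ℝ | ∃ H : Fin d → ℝ,
      QuasiSure PP ‹MeasurableSpace Ω› (fun ω => f ω ≤ x + ∑ i, H i * ΔS ω i)})

end OnePeriod

/-! ### The Polish multi-period setting -/

section Polish

variable (Ω₁ : Type) [MeasurableSpace Ω₁]

/-- Restriction of a path up to time `t`. -/
def restr {T : ℕ} (t : ℕ) (h : t ≤ T) (ω : Fin T → Ω₁) : Fin t → Ω₁ :=
  fun i => ω (Fin.castLE h i)

/-- Universally measurable predictability: `H u` (the holding over `(u, u+1]`)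
is a universally measurable function of the first `u` coordinates. -/
def Pred (d : ℕ) (H : (u : ℕ) → (Fin u → Ω₁) → Fin d → ℝ) : Prop :=
  ∀ u : ℕ, @Measurable _ _ (univComp (Fin u → Ω₁)) _ (H u)

/-- The gain `(H · S)_t = ∑_{u=1}^t H_u (S_u - S_{u-1})` up to time `t ≤ T`. -/
def gain {T d : ℕ} (S : (t : ℕ) → (Fin t → Ω₁) → Fin d → ℝ)
    (H : (u : ℕ) → (Fin u → Ω₁) → Fin d → ℝ) (t : ℕ) (h : t ≤ T) (ω : Fin T → Ω₁) : ℝ :=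
  ∑ u : Fin t, ∑ i : Fin d,
    H u (restr Ω₁ u (u.2.le.trans h) ω) i *
      (S (u + 1) (restr Ω₁ (u + 1) (Nat.succ_le_of_lt (u.2.trans_le h)) ω) i
        - S u (restr Ω₁ u (u.2.le.trans h) ω) i)

variable [TopologicalSpace Ω₁] [OpensMeasurableSpace Ω₁]

/-- The set `PP = {P₀ ⊗ ⋯ ⊗ P_{t-1}}` of measures built from universally
measurable selectors of the one-step collections `𝒫_s(·)`. -/
def MeasFam (Pt : (t : ℕ) → (Fin t → Ω₁) → Set (ProbabilityMeasure Ω₁)) :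
    (t : ℕ) → Set (Measure (Fin t → Ω₁))
  | 0 => {μ | μ = Measure.dirac Fin.elim0}
  | (t + 1) => {μ | ∃ ν ∈ MeasFam Pt t, ∃ κ : (Fin t → Ω₁) → ProbabilityMeasure Ω₁,
      @Measurable _ _ (univComp (Fin t → Ω₁)) (borel (ProbabilityMeasure Ω₁)) κ ∧
      (∀ ω, κ ω ∈ Pt t ω) ∧
      μ = ν.bind (fun ω => Measure.map (Fin.snoc ω) (κ ω : Measure Ω₁))}

/-- The σ-field `ℱ_t` on `Ω = Ω₁^T`: the comap under the restriction map of the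
universal completion of the Borel σ-field of `Ω₁^t`. -/
def filtr (T : ℕ) (t : ℕ) (h : t ≤ T) : MeasurableSpace (Fin T → Ω₁) :=
  MeasurableSpace.comap (restr Ω₁ t h) (univComp (Fin t → Ω₁))

/-- `S` is a `Q`-martingale with respect to the filtration `(ℱ_t)`. -/
def IsMartMeas {T d : ℕ} (S : (t : ℕ) → (Fin t → Ω₁) → Fin d → ℝ)
    (Q : Measure (Fin T → Ω₁)) : Prop :=
  (∀ (t : ℕ) (h : t ≤ T) (i : Fin d), Integrable (fun ω => S t (restr Ω₁ t h ω) i) Q) ∧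
  (∀ (t : ℕ) (h : t + 1 ≤ T) (i : Fin d) (A : Set (Fin T → Ω₁)),
    MeasurableSet[filtr Ω₁ T t ((Nat.le_succ t).trans h)] A →
      ∫ ω in A, S (t + 1) (restr Ω₁ (t + 1) h ω) i ∂Q
        = ∫ ω in A, S t (restr Ω₁ t ((Nat.le_succ t).trans h) ω) i ∂Q)

/-- The martingale measures `Q ⋘ PP` consistent with the option prices:
`𝒬 = {Q ⋘ PP : S is a Q-martingale, E_Q[gⁱ] = 0}`. -/
def QSet {T d e : ℕ} (PP : Set (Measure (Fin T → Ω₁)))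
    (S : (t : ℕ) → (Fin t → Ω₁) → Fin d → ℝ) (g : Fin e → (Fin T → Ω₁) → ℝ) :
    Set (Measure (Fin T → Ω₁)) :=
  {Q | IsProbabilityMeasure Q ∧ (∃ P ∈ PP, Q ≪ P) ∧ IsMartMeas Ω₁ S Q ∧
    ∀ i : Fin e, expec Q (g i) = 0}

/-- The no-arbitrage condition `NA(PP)` with semistatic trading in the stocks `S`
and the options `g`. -/
def NA {T d e : ℕ} (PP : Set (Measure (Fin T → Ω₁)))
    (S : (t : ℕ) → (Fin t → Ω₁) → Fin d → ℝ) (g : Fin e → (Fin T → Ω₁) → ℝ) : Prop :=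
  ∀ H : (u : ℕ) → (Fin u → Ω₁) → Fin d → ℝ, Pred Ω₁ d H → ∀ h : Fin e → ℝ,
    QuasiSure PP (univComp (Fin T → Ω₁))
      (fun ω => 0 ≤ gain Ω₁ S H T le_rfl ω + ∑ i, h i * g i ω) →
    QuasiSure PP (univComp (Fin T → Ω₁))
      (fun ω => gain Ω₁ S H T le_rfl ω + ∑ i, h i * g i ω = 0)

/-- The minimal semistatic superhedging price, valued in `EReal` (`inf ∅ = +∞`). -/
def superPrice {T d e : ℕ} (PP : Set (Measure (Fin T → Ω₁)))
    (S : (t : ℕ) → (Fin t → Ω₁) → Fin d → ℝ) (g : Fin e → (Fin T → Ω₁) → ℝ)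
    (f : (Fin T → Ω₁) → ℝ) : EReal :=
  sInf ((fun x : ℝ => (x : EReal)) ''
    {x : ℝ | ∃ H : (u : ℕ) → (Fin u → Ω₁) → Fin d → ℝ, ∃ h : Fin e → ℝ, Pred Ω₁ d H ∧
      QuasiSure PP (univComp (Fin T → Ω₁))
        (fun ω => f ω ≤ x + gain Ω₁ S H T le_rfl ω + ∑ i, h i * g i ω)})

/-- `f` is replicable by semistatic trading. -/
def Replicable {T d e : ℕ} (PP : Set (Measure (Fin T → Ω₁)))
    (S : (t : ℕ) → (Fin t → Ω₁) → Fin d → ℝ) (g : Fin e → (Fin T → Ω₁) → ℝ)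
    (f : (Fin T → Ω₁) → ℝ) : Prop :=
  ∃ x : ℝ, ∃ H : (u : ℕ) → (Fin u → Ω₁) → Fin d → ℝ, ∃ h : Fin e → ℝ, Pred Ω₁ d H ∧
    QuasiSure PP (univComp (Fin T → Ω₁))
      (fun ω => x + gain Ω₁ S H T le_rfl ω + ∑ i, h i * g i ω = f ω)

/-- The one-period increment `ΔS_{t+1}(ω, ·)` of the stock, given history `ω ∈ Ω_t`. -/
def incr {d : ℕ} (S : (t : ℕ) → (Fin t → Ω₁) → Fin d → ℝ) (t : ℕ) (ω : Fin t → Ω₁)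
    (x : Ω₁) : Fin d → ℝ :=
  fun i => S (t + 1) (Fin.snoc ω x) i - S t ω i

/-- The one-step martingale measures `𝒬_t(ω)` dominated by `𝒫_t(ω)`. -/
def Q1fam {d : ℕ} (Pt : (t : ℕ) → (Fin t → Ω₁) → Set (ProbabilityMeasure Ω₁))
    (S : (t : ℕ) → (Fin t → Ω₁) → Fin d → ℝ) (t : ℕ) (ω : Fin t → Ω₁) :
    Set (ProbabilityMeasure Ω₁) :=
  {Q | (∃ P' ∈ Pt t ω, (Q : Measure Ω₁) ≪ (P' : Measure Ω₁)) ∧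
    ∀ i, expec (Q : Measure Ω₁) (fun x => incr Ω₁ S t ω x i) = 0}

/-- `V` is a `Q`-supermartingale with respect to the filtration `(ℱ_t)`:
each `V_t` is `Q`-integrable and `E_Q[V_{t+1} | ℱ_t] ≤ V_t`. -/
def IsSupermart {T : ℕ} (V : ℕ → (Fin T → Ω₁) → ℝ) (Q : Measure (Fin T → Ω₁)) : Prop :=
  (∀ t : ℕ, t ≤ T → Integrable (V t) Q) ∧
  ∀ (t : ℕ) (h : t + 1 ≤ T) (A : Set (Fin T → Ω₁)),
    MeasurableSet[filtr Ω₁ T t ((Nat.le_succ t).trans h)] A →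
      ∫ ω in A, V (t + 1) ω ∂Q ≤ ∫ ω in A, V t ω ∂Q

end Polish

/-! ### Quasi-sure supports -/

/-- The quasi-sure support of a family of measures on `ℝ^d`. -/
def qsSupp {d : ℕ} (Rs : Set (Measure (Fin d → ℝ))) : Set (Fin d → ℝ) :=
  ⋂₀ {A : Set (Fin d → ℝ) | IsClosed A ∧ ∀ R ∈ Rs, R A = 1}

end BN

namespace BN

open ProbabilityTheory

/-- The pointed cone generated by a nonempty convex set. -/
def convCone {E : Type*} [AddCommGroup E] [Module ℝ E] (C : Set E) (hC : Convex ℝ C)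
    (hne : C.Nonempty) : PointedCone ℝ E where
  carrier := {x | ∃ r : ℝ, 0 ≤ r ∧ ∃ c ∈ C, x = r • c}
  zero_mem' := by
    obtain ⟨c, hc⟩ := hne
    exact ⟨0, le_rfl, c, hc, by simp⟩
  add_mem' := by
    rintro _ _ ⟨r, hr, c, hc, rfl⟩ ⟨s, hs, c', hc', rfl⟩
    rcases eq_or_lt_of_le (add_nonneg hr hs) with h | h
    · have h1 : r = 0 := by linarith
      have h2 : s = 0 := by linarith
      exact ⟨0, le_rfl, c, hc, by simp [h1, h2]⟩
    · refine ⟨r + s, h.le, (r / (r + s)) • c + (s / (r + s)) • c',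
        hC hc hc' (by positivity) (by positivity) (by field_simp), ?_⟩
      rw [smul_add, smul_smul, smul_smul]
      congr 2 <;> field_simp
  smul_mem' := by
    rintro ⟨a, ha⟩ _ ⟨r, hr, c, hc, rfl⟩
    exact ⟨a * r, mul_nonneg ha hr, c, hc, by
      change a • r • c = _
      rw [smul_smul]⟩

lemma neg_notMem_convCone {E : Type*} [AddCommGroup E] [Module ℝ E] {C : Set E}
    (hC : Convex ℝ C) (hne : C.Nonempty) (h0 : (0 : E) ∉ C) {c : E} (hc : c ∈ C) :
    -c ∉ convCone C hC hne := by
  rintro ⟨r, hr, c', hc', h⟩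
  apply h0
  have := hC hc hc' (a := 1 / (1 + r)) (b := r / (1 + r)) (by positivity) (by positivity)
    (by field_simp)
  convert this using 1
  have h2 : (r / (1 + r)) • c' = (1 / (1 + r)) • (r • c') := by
    rw [smul_smul]; congr 1; field_simp
  rw [h2, ← h]; simp

lemma proper_sep_of_span {E : Type*} [AddCommGroup E] [Module ℝ E] [FiniteDimensional ℝ E]
    {C : Set E} (hC : Convex ℝ C) (hne : C.Nonempty) (h0 : (0 : E) ∉ C)
    (hspan : Submodule.span ℝ C = ⊤) :
    ∃ l : E →ₗ[ℝ] ℝ, (∀ c ∈ C, 0 ≤ l c) ∧ ∃ c ∈ C, 0 < l c := by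
  set K := convCone C hC hne with hK
  have hCK : ∀ c ∈ C, c ∈ K := fun c hc => ⟨1, zero_le_one, c, hc, by simp⟩
  obtain ⟨b, hbC, hb, hli⟩ := exists_linearIndependent ℝ C
  have hfin : b.Finite := hli.setFinite
  set s := hfin.toFinset with hs
  have hsb : (s : Set E) = b := by simp [hs]
  set e : E := ∑ x ∈ s, x with he
  have hsmul : ∀ (r : ℝ) (x : E), 0 ≤ r → x ∈ K → r • x ∈ K := by
    intro r x hr hx
    exact Submodule.smul_mem K (⟨r, hr⟩ : {c : ℝ // 0 ≤ c}) hx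
  have hsC : ∀ x ∈ s, x ∈ C := fun x hx => hbC (by rw [← hsb]; exact hx)
  have heK : e ∈ K := Submodule.sum_mem _ fun x hx => hCK _ (hsC x hx)
  have habs : ∀ y : E, ∃ a : ℝ, a • e + y ∈ K := by
    intro y
    have hy : y ∈ Submodule.span ℝ (s : Set E) := by rw [hsb, hb, hspan]; trivial
    obtain ⟨f, -, rfl⟩ := Submodule.mem_span_finset.1 hy
    refine ⟨∑ x ∈ s, |f x|, ?_⟩
    rw [he, Finset.smul_sum, ← Finset.sum_add_distrib]
    refine Submodule.sum_mem _ fun x hx => ?_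
    rw [← add_smul]
    refine hsmul _ _ ?_ (hCK _ (hsC x hx))
    have h1 := Finset.single_le_sum (f := fun x => |f x|) (fun i _ => abs_nonneg (f i)) hx
    have h2 := neg_abs_le (f x)
    linarith
  obtain ⟨c₀, hc₀⟩ := hne
  have hneg : -e ∉ K := by
    intro hn
    have : -c₀ ∈ K := by
      obtain ⟨a, ha⟩ := habs (-c₀)
      have hae : (-a) • e ∈ K := by
        rcases le_total 0 a with h | h
        · rw [neg_smul, ← smul_neg]; exact hsmul _ _ h hn
        · exact hsmul _ _ (by linarith) heK
      have := K.add_mem hae ha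
      simpa using this
    exact neg_notMem_convCone hC ⟨c₀, hc₀⟩ h0 hc₀ this
  have he0 : e ≠ 0 := by
    rintro h
    rw [h] at hneg
    apply hneg; simp
  obtain ⟨g, hg1, hg2⟩ := riesz_extension K (LinearPMap.mkSpanSingleton e (1 : ℝ) he0) (by
    rintro ⟨x, hx⟩ hxK
    obtain ⟨a, rfl⟩ := Submodule.mem_span_singleton.1 hx
    have hval := LinearPMap.mkSpanSingleton'_apply e (1 : ℝ) (fun c hc => by
      rcases smul_eq_zero.1 hc with h | h
      · simp [h]
      · exact absurd h he0) a hx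
    change 0 ≤ (LinearPMap.mkSpanSingleton' e (1 : ℝ) _) _
    rw [hval]
    simp only at hxK
    by_contra hlt
    have ha : a < 0 := by simpa using hlt
    apply hneg
    have := hsmul (-a)⁻¹ _ (by rw [inv_nonneg]; linarith) hxK
    rw [smul_smul] at this
    have h2 : (-a)⁻¹ * a = -1 := by
      have := ha.ne
      field_simp
    rw [h2] at this
    simpa using this) (by
    intro y
    obtain ⟨a, ha⟩ := habs y
    exact ⟨⟨a • e, Submodule.smul_mem _ _ (Submodule.mem_span_singleton_self e)⟩, ha⟩)
  refine ⟨g, fun c hc => hg2 c (hCK c hc), ?_⟩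
  by_contra hcon
  push Not at hcon
  have hz : ∀ c ∈ C, g c = 0 := fun c hc => le_antisymm (hcon c hc) (hg2 c (hCK c hc))
  have h1 : g e = 0 := by
    rw [he, map_sum]
    exact Finset.sum_eq_zero fun x hx => hz x (hsC x hx)
  have h2 := hg1 ⟨e, Submodule.mem_span_singleton_self e⟩
  rw [LinearPMap.mkSpanSingleton_apply] at h2
  simp only at h2
  linarith

/-- Proper separation of the origin from a convex set. -/
lemma proper_sep {E : Type*} [AddCommGroup E] [Module ℝ E] [FiniteDimensional ℝ E]
    {C : Set E} (hC : Convex ℝ C) (hne : C.Nonempty) (h0 : (0 : E) ∉ C) :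
    ∃ l : E →ₗ[ℝ] ℝ, (∀ c ∈ C, 0 ≤ l c) ∧ ∃ c ∈ C, 0 < l c := by
  set V := Submodule.span ℝ C
  obtain ⟨l, hl, c, hc, hlc⟩ := proper_sep_of_span (E := V) (C := V.subtype ⁻¹' C)
    (hC.linear_preimage _) (by
      obtain ⟨c, hc⟩ := hne
      exact ⟨⟨c, Submodule.subset_span hc⟩, hc⟩) (by simpa using h0)
    (Submodule.span_span_coe_preimage)
  obtain ⟨g, hg⟩ := LinearMap.exists_extend l
  have hg' : ∀ x : V, g x = l x := fun x => by rw [← hg]; rfl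
  exact ⟨g, fun c hc => by
    have := hl ⟨c, Submodule.subset_span hc⟩ hc
    rwa [← hg'] at this, c, hc, by rwa [hg']⟩

/-- Abstract finite-dimensional superhedging duality. -/
lemma fd_duality {d : ℕ} {K : Set ((Fin d → ℝ) × ℝ)} (hK : Convex ℝ K) (hne : K.Nonempty)
    (hNA : ∀ y : Fin d → ℝ, (∀ p ∈ K, 0 ≤ ∑ i, y i * p.1 i) → ∀ p ∈ K, ∑ i, y i * p.1 i = 0)
    (c : ℝ) (hc : ∀ p ∈ K, p.1 = 0 → p.2 ≤ c) :
    ∃ y : Fin d → ℝ, ∀ p ∈ K, p.2 ≤ c + ∑ i, y i * p.1 i := by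
  set C : Set ((Fin d → ℝ) × ℝ) := {q | ∃ p ∈ K, q.1 = p.1 ∧ q.2 < p.2 - c} with hCdef
  have hCne : C.Nonempty := by
    obtain ⟨p, hp⟩ := hne
    exact ⟨(p.1, p.2 - c - 1), p, hp, rfl, by simp⟩
  have hCconv : Convex ℝ C := by
    rintro q ⟨p, hp, h1, h2⟩ q' ⟨p', hp', h1', h2'⟩ a b ha hb hab
    refine ⟨a • p + b • p', hK hp hp' ha hb hab, by simp [h1, h1'], ?_⟩
    simp only [Prod.snd_add, Prod.smul_snd, smul_eq_mul]
    have hc' : c = a * c + b * c := by rw [← add_mul, hab, one_mul]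
    rcases eq_or_lt_of_le ha with h | h
    · have : b = 1 := by linarith
      subst this; subst h; simp; linarith
    · have := mul_lt_mul_of_pos_left h2 h
      have := mul_le_mul_of_nonneg_left h2'.le hb
      nlinarith
  have hC0 : (0 : (Fin d → ℝ) × ℝ) ∉ C := by
    rintro ⟨p, hp, h1, h2⟩
    have := hc p hp h1.symm
    simp at h2; linarith
  obtain ⟨l, hl, q, ⟨p₀, hp₀, hq1, hq2⟩, hlq⟩ := proper_sep hCconv hCne hC0
  obtain ⟨y, θ, hlyθ⟩ : ∃ (y : Fin d → ℝ) (θ : ℝ), ∀ q, l q = ∑ i, y i * q.1 i + θ * q.2 := by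
    refine ⟨fun i => l (Pi.single i 1, 0), l (0, 1), fun q => ?_⟩
    have hq : q = ∑ i, q.1 i • ((Pi.single i (1 : ℝ) : Fin d → ℝ), (0 : ℝ)) + q.2 • (0, 1) := by
      ext j
      · simp [Prod.fst_sum, Finset.sum_apply, Pi.single_apply]
      · simp [Prod.snd_sum]
    conv_lhs => rw [hq]
    simp only [map_add, map_sum, map_smul, smul_eq_mul]
    simp [mul_comm]
  have hmem : ∀ p ∈ K, ∀ s : ℝ, s < p.2 - c → 0 ≤ ∑ i, y i * p.1 i + θ * s := by
    intro p hp s hs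
    rw [← hlyθ (p.1, s)]
    exact hl _ ⟨p, hp, rfl, hs⟩
  have hθ : θ ≤ 0 := by
    by_contra h
    push Not at h
    have := hmem p₀ hp₀ (min (p₀.2 - c - 1) (-(∑ i, y i * p₀.1 i + 1) / θ))
      (lt_of_le_of_lt (min_le_left _ _) (by linarith))
    have h3 : θ * min (p₀.2 - c - 1) (-(∑ i, y i * p₀.1 i + 1) / θ) ≤
        θ * (-(∑ i, y i * p₀.1 i + 1) / θ) := mul_le_mul_of_nonneg_left (min_le_right _ _) h.le
    have h4 : θ * (-(∑ i, y i * p₀.1 i + 1) / θ) = -(∑ i, y i * p₀.1 i + 1) := by field_simp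
    linarith
  have hle : ∀ p ∈ K, 0 ≤ ∑ i, y i * p.1 i + θ * (p.2 - c) := by
    intro p hp
    refine le_of_forall_pos_le_add fun ε hε => ?_
    have := hmem p hp (p.2 - c - ε / (1 - θ)) (by
      have : 0 < ε / (1 - θ) := div_pos hε (by linarith)
      linarith)
    have h5 : -θ * (ε / (1 - θ)) ≤ ε := by
      rw [← mul_div_assoc, div_le_iff₀ (by linarith)]; nlinarith
    nlinarith
  rcases eq_or_lt_of_le hθ with h | h
  · exfalso
    subst h
    have h6 := hNA y (fun p hp => by simpa using hle p hp) p₀ hp₀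
    rw [hlyθ, hq1] at hlq
    simp at hlq; linarith
  · refine ⟨fun i => y i / (-θ), fun p hp => ?_⟩
    have h7 : ∑ i, y i / (-θ) * p.1 i = (∑ i, y i * p.1 i) / (-θ) := by
      rw [Finset.sum_div]; exact Finset.sum_congr rfl fun i _ => by ring
    rw [h7]
    have h8 : p.2 - c ≤ (∑ i, y i * p.1 i) / (-θ) := by
      rw [le_div_iff₀ (by linarith)]; nlinarith [hle p hp]
    linarith

lemma fd_exists_zero {d : ℕ} {K : Set (Fin d → ℝ)} (hK : Convex ℝ K) (hne : K.Nonempty)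
    (hNA : ∀ y : Fin d → ℝ, (∀ p ∈ K, 0 ≤ ∑ i, y i * p i) → ∀ p ∈ K, ∑ i, y i * p i = 0) :
    (0 : Fin d → ℝ) ∈ K := by
  by_contra h0
  obtain ⟨y, hy⟩ := fd_duality (K := K ×ˢ (univ : Set ℝ)) (hK.prod convex_univ)
    (hne.prod univ_nonempty) (fun y h p hp => by
      refine hNA y (fun q hq => h (q, 0) ⟨hq, trivial⟩) _ hp.1) 0
    (fun p hp h => absurd (h ▸ hp.1) h0)
  obtain ⟨a, ha⟩ := hne
  have := hy (a, 0 + ∑ i, y i * a i + 1) ⟨ha, trivial⟩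
  simp at this
  linarith

/-! ### Capacitability -/

/-- Sequences whose first `k` entries are bounded by those of `m`. -/
def seqBelow (m : ℕ → ℕ) (k : ℕ) : Set (ℕ → ℕ) := {x | ∀ i < k, x i ≤ m i}

lemma seqBelow_congr {m m' : ℕ → ℕ} {k : ℕ} (h : ∀ i < k, m i = m' i) :
    seqBelow m k = seqBelow m' k := by
  ext x
  exact forall₂_congr fun i hi => by rw [h i hi]

lemma iInter_closure_seqBelow_subset_range {X : Type*} [TopologicalSpace X]
    [TopologicalSpace.MetrizableSpace X] {f : (ℕ → ℕ) → X} (hf : Continuous f) (m : ℕ → ℕ) :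
    ⋂ k, closure (f '' seqBelow m k) ⊆ range f := by
  let := TopologicalSpace.metrizableSpaceMetric X
  intro y hy
  have h1 : ∀ k : ℕ, ∃ z ∈ seqBelow m k, dist y (f z) < 1 / ((k : ℝ) + 1) := by
    intro k
    have := mem_iInter.1 hy k
    rw [Metric.mem_closure_iff] at this
    obtain ⟨_, ⟨z, hz, rfl⟩, hd⟩ := this (1 / ((k : ℝ) + 1)) (by positivity)
    exact ⟨z, hz, hd⟩
  choose z hz hd using h1
  have hK : IsCompact (Set.pi univ fun i => Iic (m i)) :=
    isCompact_univ_pi fun i => (finite_Iic (m i)).isCompact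
  obtain ⟨x, -, φ, hφ, hlim⟩ := hK.tendsto_subseq
    (x := fun k i => min (z k i) (m i)) (fun k i _ => mem_Iic.2 (min_le_right _ _))
  have hzx : Tendsto (fun j => z (φ j)) atTop (𝓝 x) := by
    rw [tendsto_pi_nhds] at hlim ⊢
    intro i
    refine (hlim i).congr' ?_
    filter_upwards [eventually_gt_atTop i] with j hj
    exact min_eq_left (hz _ i (hj.trans_le (hφ.id_le j)))
  refine ⟨x, tendsto_nhds_unique ((hf.tendsto x).comp hzx) ?_⟩
  have h2 : Tendsto (fun k => f (z k)) atTop (𝓝 y) := by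
    rw [tendsto_iff_dist_tendsto_zero]
    refine squeeze_zero (fun _ => dist_nonneg) (fun k => ?_) tendsto_one_div_add_atTop_nhds_zero_nat
    rw [dist_comm]; exact (hd k).le
  exact h2.comp hφ.tendsto_atTop

lemma exists_seqBelow_measure_gt {X : Type*} [MeasurableSpace X] (μ : Measure X)
    (f : (ℕ → ℕ) → X) {r : ℝ≥0∞} (hr : r < μ (range f)) :
    ∃ m : ℕ → ℕ, ∀ k, r < μ (f '' seqBelow m k) := by
  have step : ∀ (k : ℕ) (m : ℕ → ℕ), r < μ (f '' seqBelow m k) →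
      ∃ n, r < μ (f '' seqBelow (Function.update m k n) (k + 1)) := by
    intro k m hm
    have hU : f '' seqBelow m k = ⋃ n, f '' seqBelow (Function.update m k n) (k + 1) := by
      rw [← image_iUnion]
      congr 1
      ext x
      simp only [seqBelow, mem_ofPred_eq, mem_iUnion]
      constructor
      · intro h
        refine ⟨x k, fun i hi => ?_⟩
        rcases eq_or_ne i k with rfl | hik
        · simp
        · rw [Function.update_of_ne hik]; exact h i (by omega)
      · rintro ⟨n, h⟩ i hi
        have := h i (by omega)
        rwa [Function.update_of_ne hi.ne] at this
    have hmono : Monotone fun n => f '' seqBelow (Function.update m k n) (k + 1) := by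
      intro n n' hn
      refine image_mono fun x hx i hi => (hx i hi).trans ?_
      rcases eq_or_ne i k with rfl | hik
      · simpa using hn
      · simp [Function.update_of_ne hik]
    rw [hU, hmono.measure_iUnion] at hm
    exact lt_iSup_iff.1 hm
  choose! N hN using step
  let g : ℕ → (ℕ → ℕ) := fun k => Nat.rec 0 (fun k m => Function.update m k (N k m)) k
  have hg : ∀ k, g (k + 1) = Function.update (g k) k (N k (g k)) := fun k => rfl
  have hgr : ∀ k, r < μ (f '' seqBelow (g k) k) := by
    intro k
    induction k with
    | zero => simpa [seqBelow, image_univ] using hr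
    | succ k ih => rw [hg]; exact hN k _ ih
  have hst : ∀ i j, i < j → g j i = g (i + 1) i := by
    intro i j hij
    induction j with
    | zero => omega
    | succ j ih =>
      rcases eq_or_ne i j with rfl | hne
      · rfl
      · rw [hg j, Function.update_of_ne hne]; exact ih (by omega)
  refine ⟨fun k => g (k + 1) k, fun k => ?_⟩
  rw [seqBelow_congr (m' := g k) fun i hi => (hst i k hi).symm]
  exact hgr k

lemma le_measure_iInter_seqBelow {X : Type*} [TopologicalSpace X] [MeasurableSpace X]
    [BorelSpace X] {f : (ℕ → ℕ) → X} (μ : Measure X)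
    [IsFiniteMeasure μ] {r : ℝ≥0∞} {m : ℕ → ℕ}
    (h : ∀ k, r ≤ μ (closure (f '' seqBelow m k))) :
    r ≤ μ (⋂ k, closure (f '' seqBelow m k)) := by
  have hanti : Antitone fun k => closure (f '' seqBelow m k) := by
    intro k k' hk
    exact closure_mono (image_mono fun x hx i hi => hx i (hi.trans_le hk))
  rw [hanti.measure_iInter (fun k => isClosed_closure.measurableSet.nullMeasurableSet)
    ⟨0, measure_ne_top _ _⟩]
  exact le_iInf h

section Cap
variable {X : Type*} [TopologicalSpace X] [PolishSpace X] [MeasurableSpace X] [BorelSpace X]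

/-- Analytic sets are null-measurable for every finite Borel measure. -/
lemma nullMeasurableSet_of_analyticSet {A : Set X} (hA : AnalyticSet A) (μ : Measure X)
    [IsFiniteMeasure μ] : NullMeasurableSet A μ := by
  rw [AnalyticSet] at hA
  rcases hA with rfl | ⟨f, hf, rfl⟩
  · exact MeasurableSet.empty.nullMeasurableSet
  have key : ∀ r : ℝ≥0∞, r < μ (range f) → ∃ B, MeasurableSet B ∧ B ⊆ range f ∧ r ≤ μ B := by
    intro r hr
    obtain ⟨m, hm⟩ := exists_seqBelow_measure_gt μ f hr
    refine ⟨⋂ k, closure (f '' seqBelow m k), MeasurableSet.iInter fun k =>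
      isClosed_closure.measurableSet, iInter_closure_seqBelow_subset_range hf m, ?_⟩
    exact le_measure_iInter_seqBelow μ fun k =>
      (hm k).le.trans (measure_mono subset_closure)
  rcases eq_or_ne (μ (range f)) 0 with h0 | h0
  · exact NullMeasurableSet.of_null h0
  obtain ⟨u, -, hu, hlim⟩ := exists_seq_strictMono_tendsto' (pos_iff_ne_zero.2 h0)
  choose B hBm hBs hBr using fun n => key (u n) (hu n).2
  have hle : μ (range f) ≤ μ (⋃ n, B n) :=
    le_of_tendsto' hlim fun n => (hBr n).trans (measure_mono (subset_iUnion _ _))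
  have hsub : (⋃ n, B n) ⊆ range f := iUnion_subset hBs
  have hae : (⋃ n, B n) =ᵐ[μ] toMeasurable μ (range f) :=
    ae_eq_of_subset_of_measure_ge (hsub.trans (subset_toMeasurable _ _))
      (by rwa [measure_toMeasurable]) (MeasurableSet.iUnion hBm).nullMeasurableSet
      (measure_ne_top _ _)
  refine ⟨toMeasurable μ (range f), measurableSet_toMeasurable _ _, ?_⟩
  rw [Filter.eventuallyEq_set]
  rw [Filter.eventuallyEq_set] at hae
  filter_upwards [hae] with x hx
  exact ⟨fun h => subset_toMeasurable _ _ h, fun h => hsub (hx.2 h)⟩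

lemma analyticSet_setOf_lt_measure {Z : Type*} [TopologicalSpace Z] [PolishSpace Z]
    [MeasurableSpace Z] [BorelSpace Z] {κ : Z → Measure X} (hκ : Measurable κ)
    (hfin : ∀ z, IsFiniteMeasure (κ z)) {A : Set X} (hA : AnalyticSet A) (r : ℝ≥0∞) :
    AnalyticSet {z | r < κ z A} := by
  rw [AnalyticSet] at hA
  rcases hA with rfl | ⟨f, hf, rfl⟩
  · simpa using analyticSet_empty
  have hmeas : ∀ k, Measurable fun p : Z × (ℕ → ℕ) =>
      κ p.1 (closure (f '' seqBelow p.2 k)) := by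
    intro k
    have h1 : Measurable fun q : Z × (Fin k → ℕ) => κ q.1 (closure (f '' seqBelow
        (fun i => if h : i < k then q.2 ⟨i, h⟩ else 0) k)) := by
      refine measurable_from_prod_countable_left fun w => ?_
      have hcl : MeasurableSet (closure (f '' seqBelow
        (fun i => if h : i < k then w ⟨i, h⟩ else 0) k)) := isClosed_closure.measurableSet
      exact (Measure.measurable_coe hcl).comp hκ
    have h2 : Measurable fun p : Z × (ℕ → ℕ) => (p.1, fun i : Fin k => p.2 i) := by
      fun_prop
    convert h1.comp h2 using 1
    ext p
    simp only [Function.comp]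
    rw [seqBelow_congr]
    intro i hi
    simp [hi]
  have heq : {z | r < κ z (range f)} = Prod.fst '' {p : Z × (ℕ → ℕ) |
      ∃ r' : ℚ, r < (ENNReal.ofReal r' : ℝ≥0∞) ∧
        ∀ k, ENNReal.ofReal r' ≤ κ p.1 (closure (f '' seqBelow p.2 k))} := by
    ext z
    simp only [mem_ofPred_eq, mem_image, Prod.exists, exists_and_right, exists_eq_right]
    constructor
    · intro hz
      obtain ⟨q, hq0, hq1, hq2⟩ := ENNReal.lt_iff_exists_rat_btwn.1 hz
      obtain ⟨m, hm⟩ := exists_seqBelow_measure_gt (κ z) f hq2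
      refine ⟨m, q, hq1, fun k => (hm k).le.trans (measure_mono subset_closure)⟩
    · rintro ⟨m, q, hq, hk⟩
      have := hfin z
      exact hq.trans_le ((le_measure_iInter_seqBelow (κ z) hk).trans
        (measure_mono (iInter_closure_seqBelow_subset_range hf m)))
  rw [heq]
  refine AnalyticSet.image_of_continuous (MeasurableSet.analyticSet ?_) continuous_fst
  have : {p : Z × (ℕ → ℕ) | ∃ r' : ℚ, r < (ENNReal.ofReal r' : ℝ≥0∞) ∧
        ∀ k, ENNReal.ofReal r' ≤ κ p.1 (closure (f '' seqBelow p.2 k))} =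
      ⋃ r' : ℚ, ⋂ k, {p | r < (ENNReal.ofReal r' : ℝ≥0∞) ∧
        ENNReal.ofReal r' ≤ κ p.1 (closure (f '' seqBelow p.2 k))} := by
    ext p
    simp only [mem_ofPred_eq, mem_iUnion, mem_iInter]
    exact exists_congr fun q => ⟨fun h k => ⟨h.1, h.2 k⟩, fun h => ⟨(h 0).1, fun k => (h k).2⟩⟩
  rw [this]
  refine MeasurableSet.iUnion fun q => MeasurableSet.iInter fun k => ?_
  exact (MeasurableSet.const _).inter (measurableSet_le measurable_const (hmeas k))

lemma analyticSet_setOf_measure_eq_one {Z : Type*} [TopologicalSpace Z] [PolishSpace Z]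
    [MeasurableSpace Z] [BorelSpace Z] {κ : Z → Measure X} (hκ : Measurable κ)
    (hprob : ∀ z, IsProbabilityMeasure (κ z)) {A : Set X} (hA : AnalyticSet A) :
    AnalyticSet {z | κ z A = 1} := by
  have : {z | κ z A = 1} = ⋂ n : ℕ, {z | 1 - ((n : ℝ≥0∞) + 1)⁻¹ < κ z A} := by
    ext z
    simp only [mem_ofPred_eq, mem_iInter]
    have hpr := hprob z
    constructor
    · intro h n
      rw [h]
      exact ENNReal.sub_lt_self ENNReal.one_ne_top one_ne_zero (by simp)
    · intro h
      refine le_antisymm prob_le_one ?_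
      refine ENNReal.le_of_forall_pos_le_add fun ε hε _ => ?_
      obtain ⟨n, hn⟩ := ENNReal.exists_inv_nat_lt (a := (ε : ℝ≥0∞)) (by simpa using hε.ne')
      have h1 := (h n).le
      rw [tsub_le_iff_right] at h1
      refine h1.trans (add_le_add le_rfl (le_trans ?_ hn.le))
      exact ENNReal.inv_le_inv.2 (by simp)
  rw [this]
  exact AnalyticSet.iInter fun n =>
    analyticSet_setOf_lt_measure hκ (fun z => by have := hprob z; infer_instance) hA _

end Cap

/-! ### Universal measurability -/

/-- Universally measurable functions. -/
def UMeas {X Y : Type*} [MeasurableSpace X] [MeasurableSpace Y] (f : X → Y) : Prop :=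
  @Measurable X Y (univComp X) _ f

/-- Universally measurable sets. -/
def UMSet {X : Type*} [MeasurableSpace X] (A : Set X) : Prop :=
  @MeasurableSet X (univComp X) A

section UM
variable {X Y Z : Type*} [MeasurableSpace X] [MeasurableSpace Y] [MeasurableSpace Z]

lemma le_univComp : (inferInstance : MeasurableSpace X) ≤ univComp X :=
  fun _ hs _ _ => hs.nullMeasurableSet

lemma _root_.MeasurableSet.umSet {A : Set X} (h : MeasurableSet A) : UMSet A := le_univComp _ h

lemma _root_.Measurable.uMeas {f : X → Y} (h : Measurable f) : UMeas f :=
  fun _ hs => (h hs).umSet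

lemma UMSet.nullMeasurableSet {A : Set X} (h : UMSet A) (μ : Measure X) [IsFiniteMeasure μ] :
    NullMeasurableSet A μ := by
  rcases eq_or_ne μ 0 with rfl | h0
  · exact NullMeasurableSet.of_null (by simp)
  · have : NeZero μ := ⟨h0⟩
    have h1 := h ((μ univ)⁻¹ • μ) inferInstance
    refine h1.mono_ac ?_
    intro s hs
    simpa using hs

lemma UMeas.aemeasurable {f : X → Y} [MeasurableSpace.CountablyGenerated Y] [Nonempty Y]
    (h : UMeas f) (μ : Measure X) [IsFiniteMeasure μ] : AEMeasurable f μ :=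
  NullMeasurable.aemeasurable fun _ hs => UMSet.nullMeasurableSet (h hs) μ

lemma UMeas.preimage [MeasurableSpace.CountablyGenerated Y] {f : X → Y} (hf : UMeas f)
    {A : Set Y} (hA : UMSet A) : UMSet (f ⁻¹' A) := by
  intro μ hμ
  have : Nonempty X := by
    by_contra hX
    have hX := not_nonempty_iff.1 hX
    have := hμ.measure_univ
    simp [Subsingleton.elim μ 0] at this
  have : Nonempty Y := this.map f
  have hae := hf.aemeasurable μ
  have h1 : NullMeasurableSet (hae.mk f ⁻¹' A) μ := by
    have hqm : Measure.QuasiMeasurePreserving (hae.mk f) μ (μ.map (hae.mk f)) :=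
      ⟨hae.measurable_mk, Measure.AbsolutelyContinuous.rfl⟩
    have := Measure.isProbabilityMeasure_map (μ := μ) hae.measurable_mk.aemeasurable
    exact (hA.nullMeasurableSet _).preimage hqm
  refine h1.congr ?_
  rw [Filter.eventuallyEq_set]
  filter_upwards [hae.ae_eq_mk] with x hx
  simp only [mem_preimage, hx]

lemma UMeas.comp [MeasurableSpace.CountablyGenerated Y] {f : X → Y} {g : Y → Z}
    (hg : UMeas g) (hf : UMeas f) : UMeas (g ∘ f) := fun _ hs => hf.preimage (hg hs)

lemma _root_.Measurable.comp_uMeas {f : X → Y} {g : Y → Z}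
    (hg : Measurable g) (hf : UMeas f) : UMeas (g ∘ f) := fun _ hs => hf (hg hs)

lemma UMSet.preimage_measurable {f : X → Y} {A : Set Y} (hA : UMSet A) (hf : Measurable f) :
    UMSet (f ⁻¹' A) := by
  intro μ hμ
  have := Measure.isProbabilityMeasure_map (μ := μ) hf.aemeasurable
  exact (hA _ this).preimage ⟨hf, Measure.AbsolutelyContinuous.rfl⟩

lemma UMeas.comp_measurable {f : X → Y} {g : Y → Z} (hg : UMeas g) (hf : Measurable f) :
    UMeas (g ∘ f) := fun s hs =>
  UMSet.preimage_measurable (A := g ⁻¹' s) (hg hs) hf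

lemma UMeas.prodMk {f : X → Y} {g : X → Z} (hf : UMeas f) (hg : UMeas g) :
    UMeas fun x => (f x, g x) :=
  let := univComp X
  Measurable.prodMk (f := f) (g := g) hf hg

lemma uMeas_pi_iff {ι : Type*} {f : X → ι → Y} : UMeas f ↔ ∀ i, UMeas fun x => f x i :=
  @measurable_pi_iff X ι _ (univComp X) _ f

lemma uMeas_const (y : Y) : UMeas fun _ : X => y := measurable_const.uMeas

open Classical in
lemma UMeas.ite {A : Set X} (hA : UMSet A) {f g : X → Y} (hf : UMeas f) (hg : UMeas g) :
    UMeas fun x => if x ∈ A then f x else g x :=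
  @Measurable.ite _ _ _ _ (univComp X) _ (fun x => x ∈ A) _ hA hf hg

lemma UMSet.compl {A : Set X} (h : UMSet A) : UMSet Aᶜ := @MeasurableSet.compl X A (univComp X) h
lemma UMSet.inter {A B : Set X} (h : UMSet A) (h' : UMSet B) : UMSet (A ∩ B) :=
  @MeasurableSet.inter X (univComp X) A B h h'
lemma UMSet.union {A B : Set X} (h : UMSet A) (h' : UMSet B) : UMSet (A ∪ B) :=
  @MeasurableSet.union X (univComp X) A B h h'
lemma UMSet.iUnion {ι : Type*} [Countable ι] {A : ι → Set X} (h : ∀ i, UMSet (A i)) :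
    UMSet (⋃ i, A i) := @MeasurableSet.iUnion X ι (univComp X) _ A h
lemma UMSet.iInter {ι : Type*} [Countable ι] {A : ι → Set X} (h : ∀ i, UMSet (A i)) :
    UMSet (⋂ i, A i) := @MeasurableSet.iInter X ι (univComp X) _ A h

lemma uMeas_to_countable [Countable Y] [MeasurableSingletonClass Y] {f : X → Y}
    (h : ∀ y, UMSet (f ⁻¹' {y})) : UMeas f :=
  @measurable_to_countable' Y X _ _ (univComp X) f h

end UM

lemma _root_.MeasureTheory.AnalyticSet.umSet {X : Type*} [TopologicalSpace X] [PolishSpace X]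
    [MeasurableSpace X] [BorelSpace X] {A : Set X} (hA : AnalyticSet A) : UMSet A :=
  fun μ _ => nullMeasurableSet_of_analyticSet hA μ

/-! ### Universally measurable selection -/

section Selection
variable {X : Type*} (a : (ℕ → ℕ) → X)

/-- The image under `a` of the cylinder of sequences extending `w` on `{0, …, k-1}` by `n`. -/
def cylImage (w : ℕ → ℕ) (k n : ℕ) : Set X := a '' {y | (∀ i < k, y i = w i) ∧ y k = n}

/-- Prefixes of the leftmost branch of the fibre of `a` over `x`. -/
def leftInit : ℕ → X → ℕ → ℕ
  | 0, _ => 0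
  | k + 1, x => Function.update (leftInit k x) k (sInf {n | x ∈ cylImage a (leftInit k x) k n})

/-- The leftmost branch of the fibre of `a` over `x`. -/
def leftBranch (x : X) (k : ℕ) : ℕ := leftInit a (k + 1) x k

lemma leftInit_eq (x : X) (i j : ℕ) (hij : i < j) : leftInit a j x i = leftBranch a x i := by
  induction j with
  | zero => omega
  | succ j ih =>
    rcases eq_or_ne i j with rfl | hne
    · rfl
    · rw [leftInit, Function.update_of_ne hne]; exact ih (by omega)

lemma exists_fibre_leftInit {x : X} (hx : x ∈ range a) (k : ℕ) :
    ∃ y, a y = x ∧ ∀ i < k, y i = leftInit a k x i := by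
  induction k with
  | zero => exact hx.imp fun y hy => ⟨hy, by simp⟩
  | succ k ih =>
    obtain ⟨y, hy, hyk⟩ := ih
    have hne : {n | x ∈ cylImage a (leftInit a k x) k n}.Nonempty :=
      ⟨y k, y, ⟨hyk, rfl⟩, hy⟩
    obtain ⟨y', ⟨hy', hn⟩, hax⟩ := Nat.sInf_mem hne
    refine ⟨y', hax, fun i hi => ?_⟩
    rw [leftInit]
    rcases eq_or_ne i k with rfl | hik
    · rw [Function.update_self]; exact hn
    · rw [Function.update_of_ne hik]; exact hy' i (by omega)

variable [TopologicalSpace X]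

lemma leftBranch_mem_fibre [T1Space X] (ha : Continuous a) {x : X} (hx : x ∈ range a) :
    a (leftBranch a x) = x := by
  choose y hy hyk using exists_fibre_leftInit a hx
  have hlim : Tendsto y atTop (𝓝 (leftBranch a x)) := by
    rw [tendsto_pi_nhds]
    intro i
    refine tendsto_const_nhds.congr' ?_
    filter_upwards [eventually_gt_atTop i] with k hk
    rw [hyk k i hk, leftInit_eq a x i k hk]
  have hcl : IsClosed (a ⁻¹' {x}) := isClosed_singleton.preimage ha
  exact hcl.mem_of_tendsto hlim (Eventually.of_forall hy)

variable [PolishSpace X] [MeasurableSpace X] [BorelSpace X]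

lemma uMeas_leftInit (ha : Continuous a) (k : ℕ) : UMeas (leftInit a k) := by
  induction k with
  | zero => exact uMeas_const _
  | succ k ih =>
    have hS : ∀ n, UMSet {x | x ∈ cylImage a (leftInit a k x) k n} := by
      intro n
      have hEq : {x | x ∈ cylImage a (leftInit a k x) k n} =
          ⋃ w : Fin k → ℕ, ((fun x => fun i : Fin k => leftInit a k x i) ⁻¹' {w}) ∩
            cylImage a (fun i => if h : i < k then w ⟨i, h⟩ else 0) k n := by
        have hc : ∀ (w w' : ℕ → ℕ), (∀ i < k, w i = w' i) →
            cylImage a w k n = cylImage a w' k n := by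
          intro w w' h
          unfold cylImage
          congr 1
          ext y
          exact and_congr_left fun _ => forall₂_congr fun i hi => by rw [h i hi]
        ext x
        simp only [mem_ofPred_eq, mem_iUnion, mem_inter_iff, mem_preimage, mem_singleton_iff]
        constructor
        · intro h
          refine ⟨_, rfl, ?_⟩
          rwa [hc _ (leftInit a k x) fun i hi => by simp [hi]]
        · rintro ⟨w, rfl, h⟩
          rwa [hc _ (leftInit a k x) fun i hi => by simp [hi]] at h
      rw [hEq]
      refine UMSet.iUnion fun w => UMSet.inter ?_ ?_
      · have : UMeas fun x => fun i : Fin k => leftInit a k x i :=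
          uMeas_pi_iff.2 fun i => uMeas_pi_iff.1 ih i
        exact this (measurableSet_singleton w)
      · refine AnalyticSet.umSet (AnalyticSet.image_of_continuous
          (MeasurableSet.analyticSet ?_) ha)
        measurability
    refine uMeas_pi_iff.2 fun j => ?_
    rcases eq_or_ne j k with rfl | hj
    · simp only [leftInit, Function.update_self]
      refine uMeas_to_countable fun n => ?_
      have : (fun x => sInf {n | x ∈ cylImage a (leftInit a j x) j n}) ⁻¹' {n} =
          ({x | x ∈ cylImage a (leftInit a j x) j n} ∩
            ⋂ m : Fin n, {x | x ∈ cylImage a (leftInit a j x) j m}ᶜ) ∪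
          (⋂ m, {x | x ∈ cylImage a (leftInit a j x) j m}ᶜ ∩ {_x | n = 0}) := by
        ext x
        simp only [mem_preimage, mem_singleton_iff, mem_union, mem_inter_iff, mem_iInter,
          mem_compl_iff, mem_ofPred_eq]
        constructor
        · intro h
          rcases Set.eq_empty_or_nonempty {n | x ∈ cylImage a (leftInit a j x) j n} with h0 | h0
          · right
            rw [h0, Nat.sInf_empty] at h
            exact fun m => ⟨fun hm => Set.notMem_empty m (h0 ▸ hm), h.symm⟩
          · left
            refine ⟨h ▸ Nat.sInf_mem h0, fun m => ?_⟩
            exact Nat.notMem_of_lt_sInf (s := {n | x ∈ cylImage a (leftInit a j x) j n})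
              (by rw [h]; exact m.2)
        · rintro (⟨h1, h2⟩ | h)
          · refine le_antisymm (Nat.sInf_le h1) ?_
            by_contra hlt
            push Not at hlt
            exact h2 ⟨_, hlt⟩ (Nat.sInf_mem (s := {n | x ∈ cylImage a (leftInit a j x) j n})
              ⟨n, h1⟩)
          · rw [(h 0).2, Nat.sInf_eq_zero]
            right
            ext m
            simpa using (h m).1
      rw [this]
      refine ((hS n).inter (UMSet.iInter fun m : Fin n => (hS m).compl)).union
        (UMSet.iInter fun m => (hS m).compl.inter (MeasurableSet.const _).umSet)
    · simp only [leftInit, Function.update_of_ne hj]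
      exact uMeas_pi_iff.1 ih j

lemma uMeas_leftBranch (ha : Continuous a) : UMeas (leftBranch a) :=
  uMeas_pi_iff.2 fun k => uMeas_pi_iff.1 (uMeas_leftInit a ha (k + 1)) k

end Selection

/-- Jankov–von Neumann selection. -/
lemma exists_uMeas_selection {X Y : Type*} [TopologicalSpace X] [PolishSpace X]
    [MeasurableSpace X] [BorelSpace X] [TopologicalSpace Y] [MeasurableSpace Y] [BorelSpace Y]
    [Nonempty Y] {A : Set (X × Y)} (hA : AnalyticSet A) :
    ∃ s : X → Y, UMeas s ∧ ∀ x y, (x, y) ∈ A → (x, s x) ∈ A := by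
  rw [AnalyticSet] at hA
  rcases hA with rfl | ⟨f, hf, rfl⟩
  · obtain ⟨y⟩ := ‹Nonempty Y›
    exact ⟨fun _ => y, uMeas_const y, by simp⟩
  have ha : Continuous fun z => (f z).1 := continuous_fst.comp hf
  refine ⟨fun x => (f (leftBranch (fun z => (f z).1) x)).2, ?_, ?_⟩
  · exact (continuous_snd.comp hf).measurable.comp_uMeas (uMeas_leftBranch _ ha)
  · rintro x y ⟨z, hz⟩
    have hx : x ∈ range fun z => (f z).1 := ⟨z, by simp [hz]⟩
    have := leftBranch_mem_fibre _ ha hx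
    exact ⟨leftBranch (fun z => (f z).1) x, Prod.ext this rfl⟩

/-! ### Spaces of probability measures -/

lemma measurable_coe_borel_probabilityMeasure {X : Type*} [TopologicalSpace X]
    [TopologicalSpace.PseudoMetrizableSpace X] [MeasurableSpace X] [BorelSpace X] :
    @Measurable _ _ (borel (ProbabilityMeasure X)) _
      (fun μ : ProbabilityMeasure X => (μ : Measure X)) := by
  let : MeasurableSpace (ProbabilityMeasure X) := borel _
  have : BorelSpace (ProbabilityMeasure X) := ⟨rfl⟩
  refine Measurable.measure_of_isPiSystem_of_isProbabilityMeasure (S := {s | IsClosed s})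
    (BorelSpace.measurable_eq.trans borel_eq_generateFrom_isClosed)
    (fun s hs t ht _ => hs.inter ht) fun F hF => ?_
  have hF : IsClosed F := hF
  refine UpperSemicontinuous.measurable ?_
  intro μ
  refine upperSemicontinuousAt_iff_limsup_le.2 ?_
  let := TopologicalSpace.pseudoMetrizableSpacePseudoMetric X
  exact ProbabilityMeasure.limsup_measure_closed_le_of_tendsto tendsto_id hF

lemma polishSpace_of_compactSpace (X : Type*) [TopologicalSpace X] [CompactSpace X]
    [TopologicalSpace.MetrizableSpace X] : PolishSpace X := by
  let := TopologicalSpace.metrizableSpaceMetric X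
  have : SecondCountableTopology X := inferInstance
  have : CompleteSpace X := inferInstance
  infer_instance

lemma exists_universal_kernel (X : Type*) [MeasurableSpace X] [StandardBorelSpace X]
    [Nonempty X] : ∃ K : Kernel (ℕ → ℕ) X, IsMarkovKernel K ∧
      ∀ μ : Measure X, IsProbabilityMeasure μ → ∃ z, K z = μ := by
  set ι := MeasurableSpace.mapNatBool X
  have hι : MeasurableEmbedding ι :=
    (MeasurableSpace.measurable_mapNatBool X).measurableEmbedding
      (MeasurableSpace.injective_mapNatBool X)
  let : MeasurableSpace (ProbabilityMeasure (ℕ → Bool)) := borel _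
  have : BorelSpace (ProbabilityMeasure (ℕ → Bool)) := ⟨rfl⟩
  have hmeas := measurable_coe_borel_probabilityMeasure (X := ℕ → Bool)
  have := polishSpace_of_compactSpace (ProbabilityMeasure (ℕ → Bool))
  set D : Set (ProbabilityMeasure (ℕ → Bool)) := {μ | (μ : Measure (ℕ → Bool)) (range ι) = 1}
  have hD : MeasurableSet D :=
    ((Measure.measurable_coe hι.measurableSet_range).comp hmeas) (measurableSet_singleton 1)
  have hmem : ∀ μ : Measure X, IsProbabilityMeasure μ → ∃ h, (⟨μ.map ι, h⟩ :
      ProbabilityMeasure (ℕ → Bool)) ∈ D := by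
    intro μ hμ
    refine ⟨Measure.isProbabilityMeasure_map hι.measurable.aemeasurable, ?_⟩
    change (μ.map ι) (range ι) = 1
    rw [hι.map_apply]
    simp
  have hA := hD.analyticSet
  rw [AnalyticSet] at hA
  rcases hA with h0 | ⟨h, hc, hr⟩
  · exfalso
    obtain ⟨x⟩ := ‹Nonempty X›
    obtain ⟨_, hx⟩ := hmem (Measure.dirac x) inferInstance
    rw [h0] at hx
    exact hx
  let K₀ : Kernel (ℕ → ℕ) (ℕ → Bool) := ⟨fun z => (h z : Measure _), hmeas.comp hc.measurable⟩
  have hK₀ : IsMarkovKernel K₀ := ⟨fun z => (h z).2⟩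
  refine ⟨Kernel.comapRight K₀ hι, Kernel.IsMarkovKernel.comapRight _ hι fun z => ?_, ?_⟩
  · have : h z ∈ D := hr ▸ mem_range_self z
    exact this
  · intro μ hμ
    obtain ⟨hp, hx⟩ := hmem μ hμ
    rw [← hr] at hx
    obtain ⟨z, hz⟩ := hx
    refine ⟨z, ?_⟩
    rw [Kernel.comapRight_apply]
    change Measure.comap ι (h z : Measure _) = μ
    rw [hz]
    exact hι.comap_map μ

section Arith
variable {X : Type*} [MeasurableSpace X] {f g : X → ℝ}

lemma UMeas.add (hf : UMeas f) (hg : UMeas g) : UMeas fun x => f x + g x :=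
  (measurable_fst.add measurable_snd : Measurable fun p : ℝ × ℝ => p.1 + p.2).comp_uMeas
    (hf.prodMk hg)

lemma UMeas.sub (hf : UMeas f) (hg : UMeas g) : UMeas fun x => f x - g x :=
  (measurable_fst.sub measurable_snd : Measurable fun p : ℝ × ℝ => p.1 - p.2).comp_uMeas
    (hf.prodMk hg)

lemma UMeas.mul (hf : UMeas f) (hg : UMeas g) : UMeas fun x => f x * g x :=
  (measurable_fst.mul measurable_snd : Measurable fun p : ℝ × ℝ => p.1 * p.2).comp_uMeas
    (hf.prodMk hg)

lemma UMeas.sum {ι : Type*} [Fintype ι] {F : ι → X → ℝ} (hF : ∀ i, UMeas (F i)) :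
    UMeas fun x => ∑ i, F i x := by
  have h : UMeas fun x i => F i x := uMeas_pi_iff.2 hF
  have hm : Measurable fun y : ι → ℝ => ∑ i, y i := by fun_prop
  exact hm.comp_uMeas h

lemma UMeas.umSet_le (hf : UMeas f) (hg : UMeas g) : UMSet {x | f x ≤ g x} :=
  (hf.prodMk hg) (measurableSet_le measurable_fst measurable_snd)

lemma UMeas.umSet_eq (hf : UMeas f) (hg : UMeas g) : UMSet {x | f x = g x} :=
  (hf.prodMk hg) (measurableSet_eq_fun measurable_fst measurable_snd)

end Arith

/-! ### Measurable versions of universally measurable kernels -/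

lemma exists_kernel_ae_eq {X Y : Type*} [MeasurableSpace X] [MeasurableSpace Y]
    [MeasurableSpace.CountablyGenerated Y] [Nonempty Y] {k : X → Measure Y}
    (hk : ∀ x, IsProbabilityMeasure (k x)) (ν : Measure X)
    (hm : ∀ s, MeasurableSet s → AEMeasurable (fun x => k x s) ν) :
    ∃ k' : Kernel X Y, IsMarkovKernel k' ∧ ∀ᵐ x ∂ν, k x = k' x := by
  classical
  set C := generateSetAlgebra (MeasurableSpace.countableGeneratingSet Y) with hC
  have hCc : C.Countable :=
    countable_generateSetAlgebra MeasurableSpace.countable_countableGeneratingSet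
  have hgen : (inferInstance : MeasurableSpace Y) = MeasurableSpace.generateFrom C := by
    rw [hC, generateFrom_generateSetAlgebra_eq, MeasurableSpace.generateFrom_countableGeneratingSet]
  have hCm : ∀ s ∈ C, MeasurableSet s := fun s hs => by
    have := MeasurableSpace.measurableSet_generateFrom hs
    rwa [← hgen] at this
  have hae : ∀ᵐ x ∂ν, ∀ s : C, k x s = (hm s (hCm s s.2)).mk _ x := by
    have := hCc.to_subtype
    exact ae_all_iff.2 fun s => (hm s (hCm s s.2)).ae_eq_mk
  obtain ⟨N, hN, hNm, hNs⟩ := eventually_iff_exists_mem.1 hae |>.elim fun v hv =>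
    (⟨(toMeasurable ν vᶜ)ᶜ, by
      rw [mem_ae_iff, compl_compl, measure_toMeasurable]; exact hv.1,
      (measurableSet_toMeasurable _ _).compl, fun x hx => hv.2 x (by
        by_contra h
        exact hx (subset_toMeasurable ν vᶜ h))⟩ : ∃ N : Set X, N ∈ ae ν ∧ MeasurableSet N ∧
        ∀ x ∈ N, ∀ s : C, k x s = (hm s (hCm s s.2)).mk _ x)
  obtain ⟨y₀⟩ := ‹Nonempty Y›
  let k' : X → Measure Y := fun x => if x ∈ N then k x else Measure.dirac y₀
  have hk'p : ∀ x, IsProbabilityMeasure (k' x) := by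
    intro x
    by_cases hx : x ∈ N
    · simp only [k', hx, if_true]; exact hk x
    · simp only [k', hx, if_false]; infer_instance
  have hk'm : Measurable k' := by
    refine Measurable.measure_of_isPiSystem_of_isProbabilityMeasure (S := C) hgen
      (fun s hs t ht _ => isSetAlgebra_generateSetAlgebra.inter_mem hs ht) fun s hs => ?_
    have : (fun x => k' x s) = fun x =>
        if x ∈ N then (hm s (hCm s hs)).mk _ x else Measure.dirac y₀ s := by
      ext x
      by_cases hx : x ∈ N
      · simp only [k', hx, if_true]; exact hNs x hx ⟨s, hs⟩
      · simp only [k', hx, if_false]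
    rw [this]
    exact Measurable.ite hNm (hm s (hCm s hs)).measurable_mk measurable_const
  refine ⟨⟨k', hk'm⟩, ⟨hk'p⟩, ?_⟩
  filter_upwards [hN] with x hx
  change k x = if x ∈ N then k x else _
  rw [if_pos hx]

/-! ### Path space -/

section Path
variable {Ω₁ : Type} [TopologicalSpace Ω₁]

/-- Appending a coordinate, as a homeomorphism. -/
def snocH (Ω₁ : Type) [TopologicalSpace Ω₁] (t : ℕ) :
    (Fin t → Ω₁) × Ω₁ ≃ₜ (Fin (t + 1) → Ω₁) where
  toFun p := Fin.snoc (α := fun _ => Ω₁) p.1 p.2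
  invFun ω := (Fin.init (α := fun _ => Ω₁) ω, ω (Fin.last t))
  left_inv p := by simp
  right_inv ω := by simp
  continuous_toFun := by
    refine continuous_pi fun i => ?_
    refine Fin.lastCases ?_ (fun j => ?_) i
    · simpa using continuous_snd
    · simpa [Function.comp_def] using (continuous_apply j).comp continuous_fst
  continuous_invFun := by
    refine Continuous.prodMk (continuous_pi fun i => ?_) (continuous_apply _)
    exact continuous_apply _

variable [MeasurableSpace Ω₁] [PolishSpace Ω₁] [BorelSpace Ω₁]

/-- Appending a coordinate, as a measurable equivalence. -/
def snocM (Ω₁ : Type) [TopologicalSpace Ω₁] [MeasurableSpace Ω₁] [PolishSpace Ω₁] [BorelSpace Ω₁]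
    (t : ℕ) : (Fin t → Ω₁) × Ω₁ ≃ᵐ (Fin (t + 1) → Ω₁) := (snocH Ω₁ t).toMeasurableEquiv

lemma snocM_apply (t : ℕ) (p : (Fin t → Ω₁) × Ω₁) :
    snocM Ω₁ t p = Fin.snoc (α := fun _ => Ω₁) p.1 p.2 :=
  rfl

lemma bind_map_snoc_eq {t : ℕ} (ν : Measure (Fin t → Ω₁)) [SFinite ν]
    {k : (Fin t → Ω₁) → Measure Ω₁}
    (k' : Kernel (Fin t → Ω₁) Ω₁) [IsMarkovKernel k'] (h : ∀ᵐ ω ∂ν, k ω = k' ω) :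
    ν.bind (fun ω => Measure.map (Fin.snoc (α := fun _ => Ω₁) ω) (k ω)) =
      (ν ⊗ₘ k').map (snocM Ω₁ t) := by
  have hsn : ∀ ω : Fin t → Ω₁, Measurable (Fin.snoc (α := fun _ => Ω₁) ω : Ω₁ → Fin (t + 1) → Ω₁) :=
    fun ω => (snocM Ω₁ t).measurable.comp measurable_prodMk_left
  have hmeas : Measurable fun ω => Measure.map (Fin.snoc (α := fun _ => Ω₁) ω) (k' ω) := by
    refine Measure.measurable_of_measurable_coe _ fun s hs => ?_
    have : (fun ω => Measure.map (Fin.snoc (α := fun _ => Ω₁) ω) (k' ω) s) =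
        fun ω => k' ω (Prod.mk ω ⁻¹' ((snocM Ω₁ t) ⁻¹' s)) := by
      ext ω
      rw [Measure.map_apply (hsn ω) hs]
      rfl
    rw [this]
    exact Kernel.measurable_kernel_prodMk_left ((snocM Ω₁ t).measurable hs)
  have h1 : ν.bind (fun ω => Measure.map (Fin.snoc (α := fun _ => Ω₁) ω) (k ω)) =
      ν.bind (fun ω => Measure.map (Fin.snoc (α := fun _ => Ω₁) ω) (k' ω)) := by
    unfold Measure.bind
    rw [Measure.map_congr]
    filter_upwards [h] with ω hω
    rw [hω]
  rw [h1]
  ext s hs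
  rw [Measure.bind_apply hs hmeas.aemeasurable, Measure.map_apply (snocM Ω₁ t).measurable hs,
    Measure.compProd_apply ((snocM Ω₁ t).measurable hs)]
  refine lintegral_congr fun ω => ?_
  rw [Measure.map_apply (hsn ω) hs]
  rfl

end Path

/-! ### Gains -/

section Gain
variable {Ω₁ : Type} [MeasurableSpace Ω₁] {d : ℕ}

omit [MeasurableSpace Ω₁] in
lemma restr_self {t : ℕ} (ω : Fin t → Ω₁) : restr Ω₁ t le_rfl ω = ω := rfl

omit [MeasurableSpace Ω₁] in
lemma gain_succ (S H : (t : ℕ) → (Fin t → Ω₁) → Fin d → ℝ) (t : ℕ) (ω : Fin t → Ω₁) (x : Ω₁) :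
    gain Ω₁ S H (t + 1) le_rfl (Fin.snoc (α := fun _ => Ω₁) ω x) =
      gain Ω₁ S H t le_rfl ω + ∑ i, H t ω i * incr Ω₁ S t ω x i := by
  have hr : ∀ (u : ℕ) (h : u ≤ t), restr Ω₁ u (h.trans (Nat.le_succ t))
      (Fin.snoc (α := fun _ => Ω₁) ω x) = restr Ω₁ u h ω := by
    intro u h
    ext i
    exact Fin.snoc_castSucc (α := fun _ => Ω₁) x ω (Fin.castLE h i)
  unfold gain
  rw [Fin.sum_univ_castSucc]
  congr 1
  · refine Finset.sum_congr rfl fun u _ => Finset.sum_congr rfl fun i _ => ?_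
    have h1 := hr u u.2.le
    have h2 := hr (u + 1) u.2
    simp only [Fin.val_castSucc]
    rw [← h1, ← h2]
  · refine Finset.sum_congr rfl fun i _ => ?_
    have h1 := hr t le_rfl
    rw [restr_self] at h1
    simp only [Fin.val_last, incr]
    rw [h1, restr_self]

lemma measurable_restr {T t : ℕ} (h : t ≤ T) : Measurable (restr Ω₁ t h) :=
  measurable_pi_iff.2 fun _ => measurable_pi_apply _

lemma uMeas_gain {T : ℕ}
    {S H : (t : ℕ) → (Fin t → Ω₁) → Fin d → ℝ}
    (hS : ∀ t ≤ T, Measurable (S t)) (hH : Pred Ω₁ d H) (t : ℕ) (ht : t ≤ T) :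
    UMeas (gain Ω₁ S H t (le_refl t)) := by
  unfold gain
  refine UMeas.sum fun u => UMeas.sum fun i => ?_
  have h1 : UMeas fun ω : Fin t → Ω₁ => H u (restr Ω₁ u u.2.le ω) i :=
    uMeas_pi_iff.1 (UMeas.comp_measurable (g := H u) (hH u) (measurable_restr (T := t) u.2.le)) i
  have h2 : UMeas fun ω : Fin t → Ω₁ => S (u + 1) (restr Ω₁ (u + 1) u.2 ω) i :=
    uMeas_pi_iff.1 (((hS (u + 1) (by omega)).comp (measurable_restr (T := t) u.2)).uMeas) i
  have h3 : UMeas fun ω : Fin t → Ω₁ => S u (restr Ω₁ u u.2.le ω) i :=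
    uMeas_pi_iff.1 (((hS u (by omega)).comp (measurable_restr (T := t) u.2.le)).uMeas) i
  exact h1.mul (h2.sub h3)

end Gain

lemma quasiSure_iff {X : Type*} [MeasurableSpace X] {PP : Set (Measure X)} {p : X → Prop}
    (hp : UMSet {x | p x}) :
    QuasiSure PP (univComp X) p ↔ ∀ P ∈ PP, ∀ᵐ x ∂P, p x := by
  constructor
  · rintro ⟨A, -, hA, h0⟩ P hP
    exact measure_mono_null hA (h0 P hP)
  · intro h
    exact ⟨{x | ¬ p x}, hp.compl, Subset.rfl, fun P hP => h P hP⟩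

/-! ### The one-period market -/

section OneStep
variable {Y : Type*} [MeasurableSpace Y] {d : ℕ}

lemma integral_neg_of_ae_neg {Q : Measure Y} [IsProbabilityMeasure Q] {f : Y → ℝ}
    (hf : Integrable f Q) (h : ∀ᵐ x ∂Q, f x < 0) : ∫ x, f x ∂Q < 0 := by
  have hpos : 0 < ∫ x, (-f x) ∂Q := by
    refine (integral_pos_iff_support_of_nonneg_ae (f := fun x => -f x)
      (h.mono fun x hx => by simpa using hx.le) hf.neg).2 ?_
    have : Function.support (fun x => -f x) =ᵐ[Q] univ := by
      rw [eventuallyEq_univ]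
      exact h.mono fun x hx => by simpa using hx.ne
    rw [measure_congr this]; simp
  rw [integral_neg] at hpos
  linarith

lemma exists_cond_integrable {P : Measure Y} [IsProbabilityMeasure P] {D : Y → Fin d → ℝ}
    (hD : AEMeasurable D P) {b w : Y → ℝ} (hb : AEMeasurable b P) (hw : AEMeasurable w P)
    {A : Set Y} (hA : NullMeasurableSet A P) (hPA : P A ≠ 0) :
    ∃ Q : Measure Y, IsProbabilityMeasure Q ∧ Q ≪ P ∧ (∀ i, Integrable (fun x => D x i) Q) ∧
      Integrable b Q ∧ Integrable w Q ∧ ∀ᵐ x ∂Q, x ∈ A := by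
  have hDi : ∀ i, AEMeasurable (fun x => D x i) P := fun i => (aemeasurable_pi_iff.1 hD) i
  set F : Y → ℝ := fun x => (∑ i, |D x i|) + |b x| + |w x| with hF
  have hFm : AEMeasurable F P := by
    refine ((Finset.aemeasurable_fun_sum _ fun i _ => ?_).add ?_).add ?_
    · exact (hDi i).abs
    · exact hb.abs
    · exact hw.abs
  obtain ⟨n, hn⟩ : ∃ n : ℕ, P (A ∩ {x | F x ≤ n}) ≠ 0 := by
    by_contra hcon
    push Not at hcon
    apply hPA
    have : A ⊆ ⋃ n : ℕ, A ∩ {x | F x ≤ n} := by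
      intro x hx
      obtain ⟨n, hn⟩ := exists_nat_ge (F x)
      exact mem_iUnion.2 ⟨n, hx, hn⟩
    exact measure_mono_null this (measure_iUnion_null hcon)
  set B := A ∩ {x | F x ≤ n} with hB
  have hBm : NullMeasurableSet B P := hA.inter (nullMeasurableSet_le hFm aemeasurable_const)
  set Q := (P B)⁻¹ • P.restrict B with hQ
  have hQp : IsProbabilityMeasure Q := by
    constructor
    rw [hQ, Measure.smul_apply, Measure.restrict_apply_univ, smul_eq_mul]
    exact ENNReal.inv_mul_cancel hn (measure_ne_top _ _)
  have hQP : Q ≪ P := (Measure.smul_absolutelyContinuous).trans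
    Measure.restrict_le_self.absolutelyContinuous
  have hQB : ∀ᵐ x ∂Q, x ∈ B :=
    (Measure.smul_absolutelyContinuous).ae_le (ae_restrict_mem₀ hBm)
  have hbd : ∀ f : Y → ℝ, AEMeasurable f P → (∀ x, |f x| ≤ F x) → Integrable f Q := by
    intro f hf hle
    refine Integrable.of_bound (hf.mono_ac hQP).aestronglyMeasurable n ?_
    filter_upwards [hQB] with x hx
    exact (hle x).trans hx.2
  have hsum : ∀ x, 0 ≤ ∑ i, |D x i| := fun x => Finset.sum_nonneg fun i _ => abs_nonneg _
  refine ⟨Q, hQp, hQP, fun i => hbd _ (hDi i) fun x => ?_, hbd _ hb fun x => ?_,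
    hbd _ hw fun x => ?_, hQB.mono fun x hx => hx.1⟩
  · have := Finset.single_le_sum (f := fun i => |D x i|) (fun j _ => abs_nonneg _)
      (Finset.mem_univ i)
    have h1 := abs_nonneg (b x)
    have h2 := abs_nonneg (w x)
    simp only [hF]; linarith
  · have h2 := abs_nonneg (w x)
    have := hsum x
    simp only [hF]; linarith
  · have h2 := abs_nonneg (b x)
    have := hsum x
    simp only [hF]; linarith

lemma integral_lin {Q : Measure Y} {D : Y → Fin d → ℝ} (hD : ∀ i, Integrable (fun x => D x i) Q)
    (y : Fin d → ℝ) : Integrable (fun x => ∑ i, y i * D x i) Q ∧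
      ∫ x, ∑ i, y i * D x i ∂Q = ∑ i, y i * ∫ x, D x i ∂Q := by
  refine ⟨integrable_finsetSum _ fun i _ => (hD i).const_mul _, ?_⟩
  rw [integral_finsetSum _ fun i _ => (hD i).const_mul _]
  simp_rw [integral_const_mul]

lemma aemeasurable_lin {Q : Measure Y} {D : Y → Fin d → ℝ} (hD : AEMeasurable D Q)
    (y : Fin d → ℝ) : AEMeasurable (fun x => ∑ i, y i * D x i) Q :=
  Finset.aemeasurable_fun_sum _ fun i _ => ((aemeasurable_pi_iff.1 hD) i).const_mul _

/-- One-period superhedging duality with a weight. -/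
lemma one_step_duality {PP : Set (Measure Y)} (hne : PP.Nonempty)
    (hprob : ∀ P ∈ PP, IsProbabilityMeasure P)
    (hdir : ∀ P₁ ∈ PP, ∀ P₂ ∈ PP, ∃ P₃ ∈ PP, P₁ ≪ P₃ ∧ P₂ ≪ P₃)
    {D : Y → Fin d → ℝ} (hD : ∀ P ∈ PP, AEMeasurable D P)
    (hNA : ∀ y : Fin d → ℝ, (∀ P ∈ PP, ∀ᵐ x ∂P, 0 ≤ ∑ i, y i * D x i) →
      ∀ P ∈ PP, ∀ᵐ x ∂P, ∑ i, y i * D x i = 0)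
    {b w : Y → ℝ} (hb : ∀ P ∈ PP, AEMeasurable b P) (hw : ∀ P ∈ PP, AEMeasurable w P) {c : ℝ}
    (hc : ∀ Q : Measure Y, IsProbabilityMeasure Q → (∃ P ∈ PP, Q ≪ P) →
      (∀ i, Integrable (fun x => D x i) Q) → Integrable b Q → Integrable w Q →
      (∀ i, ∫ x, D x i ∂Q = 0) → ∫ x, b x ∂Q ≤ c) :
    ∃ y : Fin d → ℝ, ∀ P ∈ PP, ∀ᵐ x ∂P, b x ≤ c + ∑ i, y i * D x i := by
  set R : Set (Measure Y) := {Q | IsProbabilityMeasure Q ∧ (∃ P ∈ PP, Q ≪ P) ∧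
    (∀ i, Integrable (fun x => D x i) Q) ∧ Integrable b Q ∧ Integrable w Q} with hR
  set K : Set ((Fin d → ℝ) × ℝ) := (fun Q : Measure Y => (fun i => ∫ x, D x i ∂Q, ∫ x, b x ∂Q)) '' R
    with hKdef
  have loc : ∀ P ∈ PP, ∀ A : Set Y, NullMeasurableSet A P → P A ≠ 0 →
      ∃ Q ∈ R, Q ≪ P ∧ ∀ᵐ x ∂Q, x ∈ A := by
    intro P hP A hA hPA
    have := hprob P hP
    obtain ⟨Q, h1, h2, h3, h4, h5, h6⟩ :=
      exists_cond_integrable (hD P hP) (hb P hP) (hw P hP) hA hPA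
    exact ⟨Q, ⟨h1, ⟨P, hP, h2⟩, h3, h4, h5⟩, h2, h6⟩
  have hKne : K.Nonempty := by
    obtain ⟨P, hP⟩ := hne
    have := hprob P hP
    obtain ⟨Q, hQ, -⟩ := loc P hP univ nullMeasurableSet_univ (by simp)
    exact ⟨_, Q, hQ, rfl⟩
  have hKconv : Convex ℝ K := by
    rintro _ ⟨Q₁, ⟨h1, ⟨P₁, hP₁, h2⟩, h3, h4, h5⟩, rfl⟩
      _ ⟨Q₂, ⟨h1', ⟨P₂, hP₂, h2'⟩, h3', h4', h5'⟩, rfl⟩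
      a a' ha ha' haa
    obtain ⟨P₃, hP₃, h6, h7⟩ := hdir P₁ hP₁ P₂ hP₂
    have hintg : ∀ f : Y → ℝ, Integrable f Q₁ → Integrable f Q₂ →
        Integrable f (ENNReal.ofReal a • Q₁ + ENNReal.ofReal a' • Q₂) ∧
        ∫ x, f x ∂(ENNReal.ofReal a • Q₁ + ENNReal.ofReal a' • Q₂) =
          a * ∫ x, f x ∂Q₁ + a' * ∫ x, f x ∂Q₂ := by
      intro f hf hf'
      have i1 := hf.smul_measure (c := ENNReal.ofReal a) ENNReal.ofReal_ne_top
      have i2 := hf'.smul_measure (c := ENNReal.ofReal a') ENNReal.ofReal_ne_top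
      refine ⟨i1.add_measure i2, ?_⟩
      rw [integral_add_measure i1 i2, integral_smul_measure, integral_smul_measure,
        ENNReal.toReal_ofReal ha, ENNReal.toReal_ofReal ha']
      rfl
    refine ⟨ENNReal.ofReal a • Q₁ + ENNReal.ofReal a' • Q₂, ⟨⟨?_⟩, ⟨P₃, hP₃, ?_⟩,
      fun i => (hintg _ (h3 i) (h3' i)).1, (hintg _ h4 h4').1, (hintg _ h5 h5').1⟩, ?_⟩
    · simp [← ENNReal.ofReal_add ha ha', haa]
    · intro s hs
      simp [h2 (h6 hs), h2' (h7 hs)]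
    · ext i
      · simp [(hintg _ (h3 i) (h3' i)).2]
      · simp [(hintg _ h4 h4').2]
  have hKNA : ∀ y : Fin d → ℝ, (∀ p ∈ K, 0 ≤ ∑ i, y i * p.1 i) →
      ∀ p ∈ K, ∑ i, y i * p.1 i = 0 := by
    intro y hy
    have h0 : ∀ P ∈ PP, ∀ᵐ x ∂P, 0 ≤ ∑ i, y i * D x i := by
      intro P hP
      by_contra hcon
      obtain ⟨Q, hQ, -, hA⟩ := loc P hP {x | ¬ 0 ≤ ∑ i, y i * D x i}
        (nullMeasurableSet_le aemeasurable_const (aemeasurable_lin (hD P hP) y)).compl hcon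
      have := hQ.1
      have h2 := integral_neg_of_ae_neg (integral_lin hQ.2.2.1 y).1
        (hA.mono fun x hx => not_le.1 hx)
      rw [(integral_lin hQ.2.2.1 y).2] at h2
      have h3 := hy _ ⟨Q, hQ, rfl⟩
      simp only at h3
      linarith
    rintro _ ⟨Q, ⟨h1, ⟨P, hP, h2⟩, h3, h4, h5⟩, rfl⟩
    simp only
    rw [← (integral_lin h3 y).2]
    exact integral_eq_zero_of_ae (h2.ae_le (hNA y h0 P hP))
  obtain ⟨y, hy⟩ := fd_duality hKconv hKne hKNA c (by
    rintro _ ⟨Q, ⟨h1, h2, h3, h4, h5⟩, rfl⟩ h0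
    exact hc Q h1 h2 h3 h4 h5 fun i => congrFun h0 i)
  refine ⟨y, fun P hP => ?_⟩
  by_contra hcon
  have hlin := aemeasurable_lin (hD P hP) y
  obtain ⟨Q, hQ, -, hA⟩ := loc P hP {x | ¬ b x ≤ c + ∑ i, y i * D x i}
    (nullMeasurableSet_le (hb P hP) (aemeasurable_const.add hlin)).compl hcon
  have := hQ.1
  have hi := (integral_lin hQ.2.2.1 y).1
  have hi2 : Integrable (fun x => c + ∑ i, y i * D x i) Q := (integrable_const c).add hi
  have h2 := integral_neg_of_ae_neg (hi2.sub hQ.2.2.2.1)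
    (hA.mono fun x hx => by
      have := not_le.1 hx
      simp only [Pi.sub_apply]; linarith)
  rw [integral_sub' hi2 hQ.2.2.2.1, integral_add (integrable_const c) hi,
    (integral_lin hQ.2.2.1 y).2] at h2
  have h3 := hy _ ⟨Q, hQ, rfl⟩
  simp at h2 h3
  linarith

/-- A martingale measure can be improved to integrate a given weight. -/
lemma exists_martingale_integrable {Q : Measure Y} [IsProbabilityMeasure Q] {D : Y → Fin d → ℝ}
    (hDi : ∀ i, Integrable (fun x => D x i) Q) (hD0 : ∀ i, ∫ x, D x i ∂Q = 0)
    {b w : Y → ℝ} (hb : Integrable b Q) (hw : AEMeasurable w Q) {c : ℝ} (hc : c < ∫ x, b x ∂Q) :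
    ∃ Q' : Measure Y, IsProbabilityMeasure Q' ∧ Q' ≪ Q ∧ (∀ i, Integrable (fun x => D x i) Q') ∧
      (∀ i, ∫ x, D x i ∂Q' = 0) ∧ Integrable b Q' ∧ Integrable w Q' ∧ c < ∫ x, b x ∂Q' := by
  by_contra hcon
  push Not at hcon
  obtain ⟨y, hy⟩ := one_step_duality (PP := {Q}) (singleton_nonempty Q)
    (by rintro P rfl; infer_instance) (by
      rintro P rfl P' rfl
      exact ⟨P', rfl, Measure.AbsolutelyContinuous.rfl, Measure.AbsolutelyContinuous.rfl⟩)
    (D := D) (by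
      rintro P rfl
      exact aemeasurable_pi_iff.2 fun i => (hDi i).aemeasurable) (by
      rintro y hy P rfl
      have h1 := (integral_lin hDi y).2
      simp only [hD0, mul_zero, Finset.sum_const_zero] at h1
      exact (integral_eq_zero_iff_of_nonneg_ae (hy P rfl) (integral_lin hDi y).1).1 h1)
    (b := b) (w := w) (by rintro P rfl; exact hb.aemeasurable) (by rintro P rfl; exact hw)
    (c := c) (by
      rintro Q' h1 ⟨P, rfl, h2⟩ h3 h4 h5 h6
      exact hcon Q' h1 h2 h3 h6 h4 h5)
  have hi := (integral_lin hDi y).1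
  have h7 := integral_mono_ae hb ((integrable_const c).add hi) (hy Q rfl)
  rw [integral_add' (integrable_const c) hi, (integral_lin hDi y).2] at h7
  simp [hD0] at h7
  linarith

end OneStep

/-! ### Universal pairs of a probability measure and a random variable -/

lemma exists_universal_pair (Y : Type*) [MeasurableSpace Y] [StandardBorelSpace Y] [Nonempty Y] :
    ∃ (R : Kernel (ℕ → ℕ) Y) (β : (ℕ → ℕ) × Y → ℝ), IsMarkovKernel R ∧ Measurable β ∧
      ∀ (Q : Measure Y) (b : Y → ℝ), IsProbabilityMeasure Q → AEMeasurable b Q →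
        ∃ q, R q = Q ∧ ∀ᵐ y ∂Q, β (q, y) = b y := by
  obtain ⟨K, hK, hKu⟩ := exists_universal_kernel (Y × ℝ)
  refine ⟨K.fst, fun p => ∫ s, s ∂(K.condKernel p), inferInstance, ?_, ?_⟩
  · exact (StronglyMeasurable.integral_kernel (κ := K.condKernel) stronglyMeasurable_id).measurable
  · intro Q b hQ hb
    have hpair : AEMeasurable (fun y => (y, b y)) Q := aemeasurable_id.prodMk hb
    have hmp := Measure.isProbabilityMeasure_map hpair
    obtain ⟨q, hq⟩ := hKu (Q.map fun y => (y, b y)) hmp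
    have hfst : K.fst q = Q := by
      rw [Kernel.fst_apply, hq, AEMeasurable.map_map_of_aemeasurable
        measurable_fst.aemeasurable hpair]
      exact Measure.map_id
    refine ⟨q, hfst, ?_⟩
    have hms : MeasurableSet {p : Y × ℝ | p.2 = hb.mk b p.1} :=
      measurableSet_eq_fun measurable_snd (hb.measurable_mk.comp measurable_fst)
    have h1 : ∀ᵐ p ∂(K q), p.2 = hb.mk b p.1 := by
      rw [hq, ae_map_iff hpair hms]
      exact hb.ae_eq_mk
    have h2 : K q = (K.fst ⊗ₖ K.condKernel) q := by rw [K.disintegrate]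
    rw [h2, Kernel.ae_compProd_iff hms, hfst] at h1
    filter_upwards [h1, hb.ae_eq_mk] with y hy hy2
    rw [integral_congr_ae (g := fun _ => hb.mk b y) hy]
    simp [hy2]

/-! ### Upper semianalytic functions -/

section USA
variable {X : Type*} [TopologicalSpace X] [PolishSpace X] [MeasurableSpace X] [BorelSpace X]

omit [PolishSpace X] [MeasurableSpace X] [BorelSpace X] in
lemma UpperSemianalyticE.analyticSet_bot_lt {v : X → EReal} (hv : UpperSemianalyticE v) :
    AnalyticSet {x | ⊥ < v x} := by
  have : {x | ⊥ < v x} = ⋃ n : ℕ, {x | ((-(n : ℝ) : ℝ) : EReal) < v x} := by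
    ext x
    simp only [mem_ofPred_eq, mem_iUnion]
    constructor
    · intro h
      induction hx : v x with
      | bot => simp [hx] at h
      | top => exact ⟨0, by simp⟩
      | coe r =>
        obtain ⟨n, hn⟩ := exists_nat_gt (-r)
        exact ⟨n, EReal.coe_lt_coe_iff.2 (by linarith)⟩
    · rintro ⟨n, hn⟩
      exact (EReal.bot_lt_coe _).trans hn
  rw [this]
  exact AnalyticSet.iUnion fun n => hv _

lemma UpperSemianalyticE.uMeas {v : X → EReal} (hv : UpperSemianalyticE v) : UMeas v := by
  refine @measurable_of_Ioi EReal X _ _ _ (univComp X) _ _ _ v fun c => ?_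
  induction c with
  | bot => exact hv.analyticSet_bot_lt.umSet
  | top =>
    have : v ⁻¹' Ioi ⊤ = ∅ := by ext; simp
    rw [this]
    exact MeasurableSet.empty.umSet
  | coe c => exact (hv c).umSet

omit [MeasurableSpace X] [BorelSpace X] in
lemma UpperSemianalyticE.comp_continuous {W : Type*} [TopologicalSpace W] [PolishSpace W]
    {v : X → EReal} (hv : UpperSemianalyticE v) {f : W → X} (hf : Continuous f) :
    UpperSemianalyticE (v ∘ f) := fun c => (hv c).preimage hf

end USA

/-! ### Half-space conditions through charged boxes -/

section Charged
variable {d : ℕ}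

/-- Index set for rational boxes and levels. -/
abbrev BoxIdx (d : ℕ) : Type := ((Fin d → ℚ) × ℚ) × ℚ

/-- The open box of an index. -/
def BoxIdx.box (i : BoxIdx d) : Set (Fin d → ℝ) := {δ | ∀ j, |δ j - (i.1.1 j : ℝ)| < i.1.2}

/-- Upper bound of the linear form `y` on the box of an index. -/
def BoxIdx.bd (i : BoxIdx d) (y : Fin d → ℝ) : ℝ :=
  ∑ j, y j * (i.1.1 j : ℝ) + (i.1.2 : ℝ) * ∑ j, |y j|

lemma BoxIdx.abs_sub_le {i : BoxIdx d} {δ : Fin d → ℝ} (h : δ ∈ i.box) (y : Fin d → ℝ) :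
    |∑ j, y j * δ j - ∑ j, y j * (i.1.1 j : ℝ)| ≤ (i.1.2 : ℝ) * ∑ j, |y j| := by
  rw [← Finset.sum_sub_distrib, Finset.mul_sum]
  refine (Finset.abs_sum_le_sum_abs _ _).trans (Finset.sum_le_sum fun j _ => ?_)
  rw [← mul_sub, abs_mul, mul_comm]
  exact mul_le_mul_of_nonneg_right (h j).le (abs_nonneg _)

lemma isOpen_box (i : BoxIdx d) : IsOpen i.box := by
  have : i.box = ⋂ j, {δ : Fin d → ℝ | |δ j - (i.1.1 j : ℝ)| < i.1.2} := by
    ext; simp [BoxIdx.box]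
  rw [this]
  exact isOpen_iInter_of_finite fun j => isOpen_lt (by fun_prop) continuous_const

lemma ae_le_iff_charged {Y : Type*} [MeasurableSpace Y] (P : Measure Y) (D : Y → Fin d → ℝ)
    (v : Y → EReal) (c : ℝ) (y : Fin d → ℝ) :
    (∀ᵐ x ∂P, v x ≤ ((c + ∑ j, y j * D x j : ℝ) : EReal)) ↔
      ∀ i : BoxIdx d, P {x | D x ∈ i.box ∧ ((i.2 : ℝ) : EReal) < v x} ≠ 0 →
        (i.2 : ℝ) ≤ c + i.bd y := by
  constructor
  · intro h i hi
    obtain ⟨x, ⟨hx1, hx2⟩, hx3⟩ : ∃ x, (D x ∈ i.box ∧ ((i.2 : ℝ) : EReal) < v x) ∧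
        v x ≤ ((c + ∑ j, y j * D x j : ℝ) : EReal) := by
      by_contra hcon
      push Not at hcon
      exact hi (measure_mono_null (fun x hx => not_le.2 (hcon x hx)) h)
    have h1 := EReal.coe_lt_coe_iff.1 (hx2.trans_le hx3)
    have h2 := (abs_le.1 (BoxIdx.abs_sub_le hx1 y)).2
    unfold BoxIdx.bd
    linarith
  · intro h
    have hnull : P (⋃ i : {i : BoxIdx d // ¬ (i.2 : ℝ) ≤ c + i.bd y},
        {x | D x ∈ i.1.box ∧ ((i.1.2 : ℝ) : EReal) < v x}) = 0 :=
      measure_iUnion_null fun i => by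
        by_contra hc
        exact i.2 (h i.1 hc)
    refine measure_mono_null ?_ hnull
    intro x hx
    have hx : ((c + ∑ j, y j * D x j : ℝ) : EReal) < v x := not_le.1 hx
    obtain ⟨s, hs1, hs2⟩ := EReal.lt_iff_exists_rat_btwn.1 hx
    have hs1 : c + ∑ j, y j * D x j < s := EReal.coe_lt_coe_iff.1 hs1
    set L := ∑ j, |y j| with hL
    have hL0 : 0 ≤ L := Finset.sum_nonneg fun j _ => abs_nonneg _
    obtain ⟨ρ, hρ0, hρ1⟩ := exists_rat_btwn
      (div_pos (sub_pos.2 hs1) (by linarith : (0 : ℝ) < 2 * L + 1))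
    have hρ2 : (ρ : ℝ) * (2 * L + 1) < s - (c + ∑ j, y j * D x j) := by
      rwa [lt_div_iff₀ (by linarith)] at hρ1
    have hq : ∀ j, ∃ q : ℚ, |D x j - q| < ρ := fun j => by
      obtain ⟨q, h1, h2⟩ := exists_rat_btwn (show D x j - ρ < D x j + ρ by linarith)
      exact ⟨q, by rw [abs_lt]; constructor <;> linarith⟩
    choose q hq using hq
    have hbox : D x ∈ BoxIdx.box (d := d) ((q, ρ), s) := hq
    have hbd := (abs_le.1 (BoxIdx.abs_sub_le hbox y)).1
    refine mem_iUnion.2 ⟨⟨((q, ρ), s), ?_⟩, hbox, hs2⟩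
    rw [not_le]
    unfold BoxIdx.bd
    simp only at hbd ⊢
    rw [← hL] at hbd ⊢
    nlinarith

/-- The admissible strategies for a given charge pattern and capital. -/
def admissible (d : ℕ) : Set (((BoxIdx d → Bool) × ℝ) × (Fin d → ℝ)) :=
  {p | ∀ i : BoxIdx d, p.1.1 i = true → (i.2 : ℝ) ≤ p.1.2 + i.bd p.2}

lemma measurableSet_admissible (d : ℕ) : MeasurableSet (admissible d) := by
  have : admissible d =
      ⋂ i : BoxIdx d, {p | p.1.1 i = true}ᶜ ∪ {p | (i.2 : ℝ) ≤ p.1.2 + i.bd p.2} := by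
    ext p
    simp only [admissible, mem_ofPred_eq, mem_iInter, mem_union, mem_compl_iff]
    exact forall_congr' fun i => by tauto
  rw [this]
  refine MeasurableSet.iInter fun i => MeasurableSet.union (MeasurableSet.compl ?_) ?_
  · exact (by fun_prop : Measurable fun p : ((BoxIdx d → Bool) × ℝ) × (Fin d → ℝ) => p.1.1 i)
      (measurableSet_singleton true)
  · refine measurableSet_le measurable_const ?_
    unfold BoxIdx.bd
    fun_prop

end Charged

lemma _root_.MeasureTheory.AnalyticSet.inter {X : Type*} [TopologicalSpace X] [T2Space X]
    {A B : Set X} (hA : AnalyticSet A) (hB : AnalyticSet B) : AnalyticSet (A ∩ B) := by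
  rw [inter_eq_iInter]
  exact AnalyticSet.iInter fun b => by cases b <;> assumption

lemma ae_compProd_of_ae_ae_umSet {X Y : Type*} [MeasurableSpace X] [MeasurableSpace Y]
    {ν : Measure X} [IsFiniteMeasure ν] {k : Kernel X Y} [IsMarkovKernel k] {r : X × Y → Prop}
    (hr : UMSet {q | r q}) (h : ∀ᵐ x ∂ν, ∀ᵐ y ∂k x, r (x, y)) : ∀ᵐ q ∂(ν ⊗ₘ k), r q := by
  obtain ⟨B, hBs, hBm, hBe⟩ :=
    (hr.compl.nullMeasurableSet (ν ⊗ₘ k)).exists_measurable_subset_ae_eq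
  have hB : (ν ⊗ₘ k) B = 0 := by
    rw [Measure.compProd_apply hBm,
      lintegral_eq_zero_iff (Kernel.measurable_kernel_prodMk_left hBm)]
    filter_upwards [h] with x hx
    exact measure_mono_null (fun y hy => hBs hy) hx
  exact (measure_congr hBe).symm.trans hB

section Section
variable {X Y Z : Type*} [TopologicalSpace X] [PolishSpace X] [MeasurableSpace X] [BorelSpace X]
  [TopologicalSpace Y] [PolishSpace Y] [MeasurableSpace Y] [BorelSpace Y]
  [TopologicalSpace Z] [PolishSpace Z] [MeasurableSpace Z] [BorelSpace Z]

omit [TopologicalSpace Y] [PolishSpace Y] [BorelSpace Y] [TopologicalSpace Z] [PolishSpace Z]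
    [BorelSpace Z] in
lemma deterministic_prod_apply {α : Z → X} (hα : Measurable α) (κ : Kernel Z Y) [IsMarkovKernel κ]
    (A : Set (X × Y)) (z : Z) :
    (Kernel.deterministic α hα ×ₖ κ) z A = κ z {y | (α z, y) ∈ A} := by
  rw [Kernel.prod_apply, Kernel.deterministic_apply, Measure.dirac_prod,
    (measurableEmbedding_prodMk_left (α z)).map_apply]
  rfl

lemma analyticSet_section_lt {α : Z → X} (hα : Measurable α) (κ : Kernel Z Y) [IsMarkovKernel κ]
    {A : Set (X × Y)} (hA : AnalyticSet A) (r : ℝ≥0∞) :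
    AnalyticSet {z | r < κ z {y | (α z, y) ∈ A}} := by
  simp_rw [← deterministic_prod_apply hα κ A]
  exact analyticSet_setOf_lt_measure (Kernel.measurable _) (fun z => inferInstance) hA r

lemma analyticSet_section_ae {α : Z → X} (hα : Measurable α) (κ : Kernel Z Y) [IsMarkovKernel κ]
    {A : Set (X × Y)} (hA : AnalyticSet A) :
    AnalyticSet {z | ∀ᵐ y ∂κ z, (α z, y) ∈ A} := by
  have : {z | ∀ᵐ y ∂κ z, (α z, y) ∈ A} = {z | (Kernel.deterministic α hα ×ₖ κ) z A = 1} := by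
    ext z
    rw [mem_ofPred_eq, mem_ofPred_eq, deterministic_prod_apply hα κ A]
    have hm : NullMeasurableSet {y | (α z, y) ∈ A} (κ z) :=
      nullMeasurableSet_of_analyticSet (hA.preimage (by fun_prop : Continuous fun y => (α z, y))) _
    exact mem_ae_iff_prob_eq_one₀ hm
  rw [this]
  exact analyticSet_setOf_measure_eq_one (Kernel.measurable _) (fun z => inferInstance) hA

end Section

/-! ### The one-step market over a history -/

section Univ
variable (Y : Type*) [MeasurableSpace Y] [StandardBorelSpace Y] [Nonempty Y]

/-- A kernel parametrizing all probability measures. -/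
def univR : Kernel (ℕ → ℕ) Y := (exists_universal_pair Y).choose

/-- Random variables parametrized jointly with `univR`. -/
def univB : (ℕ → ℕ) × Y → ℝ := (exists_universal_pair Y).choose_spec.choose

instance : IsMarkovKernel (univR Y) := (exists_universal_pair Y).choose_spec.choose_spec.1

lemma measurable_univB : Measurable (univB Y) :=
  (exists_universal_pair Y).choose_spec.choose_spec.2.1

variable {Y} in
lemma exists_univR_univB (Q : Measure Y) (b : Y → ℝ) [h : IsProbabilityMeasure Q]
    (hb : AEMeasurable b Q) : ∃ q, univR Y q = Q ∧ ∀ᵐ y ∂Q, univB Y (q, y) = b y :=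
  (exists_universal_pair Y).choose_spec.choose_spec.2.2 Q b h hb

end Univ

section Step
variable {X Y : Type*} [TopologicalSpace X] [PolishSpace X] [MeasurableSpace X] [BorelSpace X]
  [TopologicalSpace Y] [PolishSpace Y] [MeasurableSpace Y] [BorelSpace Y] [Nonempty Y] {d : ℕ}

/-- Parameters of models that do not charge `{v = ⊥}`. -/
def goodSet (a : (ℕ → ℕ) → X) (p : Kernel (ℕ → ℕ) Y) (v : X × Y → EReal) : Set (ℕ → ℕ) :=
  {z | ∀ᵐ y ∂p z, ⊥ < v (a z, y)}

/-- The one-step models at `x` that do not charge `{v = ⊥}`. -/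
def goodModels (a : (ℕ → ℕ) → X) (p : Kernel (ℕ → ℕ) Y) (v : X × Y → EReal) (x : X) :
    Set (Measure Y) :=
  {P | ∃ z, a z = x ∧ z ∈ goodSet a p v ∧ p z = P}

/-- Parameters of one-step martingale measures under which the mean of some random variable
below `v` exceeds a given level. -/
def dualSet (a : (ℕ → ℕ) → X) (p : Kernel (ℕ → ℕ) Y) (D : X × Y → Fin d → ℝ) (v : X × Y → EReal) :
    Set ((X × ℝ) × ((ℕ → ℕ) × (ℕ → ℕ))) :=
  {s | a s.2.1 = s.1.1 ∧ univR Y s.2.2 ≪ p s.2.1 ∧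
    (∀ i, Integrable (fun y => D (s.1.1, y) i) (univR Y s.2.2) ∧
      ∫ y, D (s.1.1, y) i ∂univR Y s.2.2 = 0) ∧
    (∀ᵐ y ∂univR Y s.2.2, ((univB Y (s.2.2, y) : ℝ) : EReal) < v (s.1.1, y)) ∧
    Integrable (fun y => univB Y (s.2.2, y)) (univR Y s.2.2) ∧
    s.1.2 < ∫ y, univB Y (s.2.2, y) ∂univR Y s.2.2}

/-- The one-step dual value. -/
def condSup (a : (ℕ → ℕ) → X) (p : Kernel (ℕ → ℕ) Y) (D : X × Y → Fin d → ℝ)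
    (v : X × Y → EReal) (x : X) : EReal :=
  sSup {r | ∃ c : ℝ, r = c ∧ ∃ s, ((x, c), s) ∈ dualSet a p D v}

variable {a : (ℕ → ℕ) → X} {p : Kernel (ℕ → ℕ) Y} [IsMarkovKernel p] {D : X × Y → Fin d → ℝ}
  {v : X × Y → EReal}

omit [Nonempty Y] in
lemma analyticSet_goodSet (ha : Continuous a) (hv : UpperSemianalyticE v) :
    AnalyticSet (goodSet a p v) :=
  analyticSet_section_ae ha.measurable p hv.analyticSet_bot_lt

lemma analyticSet_dualSet (ha : Continuous a) (hD : Measurable D) (hv : UpperSemianalyticE v) :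
    AnalyticSet (dualSet a p D v) := by
  set κ : Kernel ((X × ℝ) × ((ℕ → ℕ) × (ℕ → ℕ))) Y :=
    (univR Y).comap (fun s : ((X × ℝ) × ((ℕ → ℕ) × (ℕ → ℕ))) => s.2.2) (by fun_prop) with hκ
  have e1 : MeasurableSet {s : ((X × ℝ) × ((ℕ → ℕ) × (ℕ → ℕ))) | a s.2.1 = s.1.1} :=
    (isClosed_eq (by fun_prop) (by fun_prop)).measurableSet
  have e2 : MeasurableSet {s : ((X × ℝ) × ((ℕ → ℕ) × (ℕ → ℕ))) | univR Y s.2.2 ≪ p s.2.1} :=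
    Kernel.measurableSet_absolutelyContinuous κ
      (p.comap (fun s : ((X × ℝ) × ((ℕ → ℕ) × (ℕ → ℕ))) => s.2.1) (by fun_prop))
  have hDm : ∀ i, Measurable fun q : ((X × ℝ) × ((ℕ → ℕ) × (ℕ → ℕ))) × Y => D (q.1.1.1, q.2) i :=
    fun i =>
    (measurable_pi_apply i).comp (hD.comp (by fun_prop))
  have e3 : ∀ i, MeasurableSet {s : ((X × ℝ) × ((ℕ → ℕ) × (ℕ → ℕ))) |
      Integrable (fun y => D (s.1.1, y) i) (univR Y s.2.2)} :=
    fun i => measurableSet_kernel_integrable (κ := κ) (hDm i).stronglyMeasurable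
  have e4 : ∀ i, MeasurableSet {s : ((X × ℝ) × ((ℕ → ℕ) × (ℕ → ℕ))) |
      ∫ y, D (s.1.1, y) i ∂univR Y s.2.2 = 0} :=
    fun i => (StronglyMeasurable.integral_kernel_prod_right (κ := κ)
      (f := fun s y => D (s.1.1, y) i) (hDm i).stronglyMeasurable).measurable
        (measurableSet_singleton 0)
  have hBm : Measurable fun q : ((X × ℝ) × ((ℕ → ℕ) × (ℕ → ℕ))) × Y => univB Y (q.1.2.2, q.2) :=
    (measurable_univB Y).comp (by fun_prop)
  have e5 : MeasurableSet {s : ((X × ℝ) × ((ℕ → ℕ) × (ℕ → ℕ))) |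
      Integrable (fun y => univB Y (s.2.2, y)) (univR Y s.2.2)} :=
    measurableSet_kernel_integrable (κ := κ) hBm.stronglyMeasurable
  have e6 : MeasurableSet {s : ((X × ℝ) × ((ℕ → ℕ) × (ℕ → ℕ))) |
      s.1.2 < ∫ y, univB Y (s.2.2, y) ∂univR Y s.2.2} :=
    measurableSet_lt (by fun_prop) (StronglyMeasurable.integral_kernel_prod_right (κ := κ)
      (f := fun s y => univB Y (s.2.2, y)) hBm.stronglyMeasurable).measurable
  have hA : AnalyticSet {q : ((X × ℝ) × ((ℕ → ℕ) × (ℕ → ℕ))) × Y |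
      ((univB Y (q.1.2.2, q.2) : ℝ) : EReal) < v (q.1.1.1, q.2)} := by
    have : {q : ((X × ℝ) × ((ℕ → ℕ) × (ℕ → ℕ))) × Y |
      ((univB Y (q.1.2.2, q.2) : ℝ) : EReal) < v (q.1.1.1, q.2)} =
        ⋃ r : ℚ, {q : ((X × ℝ) × ((ℕ → ℕ) × (ℕ → ℕ))) × Y | univB Y (q.1.2.2, q.2) < r} ∩
          (fun q : ((X × ℝ) × ((ℕ → ℕ) × (ℕ → ℕ))) × Y => (q.1.1.1, q.2)) ⁻¹'
            {w | ((r : ℝ) : EReal) < v w} := by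
      ext q
      simp only [mem_ofPred_eq, mem_iUnion, mem_inter_iff, mem_preimage]
      rw [EReal.lt_iff_exists_rat_btwn]
      exact exists_congr fun r => and_congr_left fun _ => EReal.coe_lt_coe_iff
    rw [this]
    refine AnalyticSet.iUnion fun r => AnalyticSet.inter ?_ ?_
    · exact (measurableSet_lt hBm measurable_const).analyticSet
    · exact (hv r).preimage (by fun_prop)
  have e7 : AnalyticSet {s : ((X × ℝ) × ((ℕ → ℕ) × (ℕ → ℕ))) | ∀ᵐ y ∂univR Y s.2.2,
      ((univB Y (s.2.2, y) : ℝ) : EReal) < v (s.1.1, y)} :=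
    analyticSet_section_ae (α := fun s : ((X × ℝ) × ((ℕ → ℕ) × (ℕ → ℕ))) => s) measurable_id κ hA
  have key := ((e1.inter e2).inter ((MeasurableSet.iInter fun i => (e3 i).inter (e4 i)).inter
    (e5.inter e6))).analyticSet.inter e7
  convert key using 1
  ext s
  simp only [dualSet, mem_ofPred_eq, mem_inter_iff, mem_iInter]
  tauto

omit [TopologicalSpace X] [PolishSpace X] [MeasurableSpace X] [BorelSpace X] [IsMarkovKernel p] in
lemma lt_condSup_iff {x : X} {c : ℝ} :
    (c : EReal) < condSup a p D v x ↔ ∃ s, ((x, c), s) ∈ dualSet a p D v := by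
  rw [condSup, lt_sSup_iff]
  constructor
  · rintro ⟨_, ⟨c', rfl, s, h1, h2, h3, h4, h5, h6⟩, hcc⟩
    exact ⟨s, h1, h2, h3, h4, h5, (EReal.coe_lt_coe_iff.1 hcc).trans h6⟩
  · rintro ⟨s, h1, h2, h3, h4, h5, h6⟩
    obtain ⟨c', hc1, hc2⟩ := exists_between h6
    exact ⟨c', ⟨c', rfl, s, h1, h2, h3, h4, h5, hc2⟩, EReal.coe_lt_coe_iff.2 hc1⟩

lemma upperSemianalyticE_condSup (ha : Continuous a) (hD : Measurable D)
    (hv : UpperSemianalyticE v) : UpperSemianalyticE (condSup a p D v) := by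
  intro c
  have : {x | (c : EReal) < condSup a p D v x} =
      Prod.fst '' ((fun w : X × ((ℕ → ℕ) × (ℕ → ℕ)) => ((w.1, c), w.2)) ⁻¹' dualSet a p D v) := by
    ext x
    simp only [mem_ofPred_eq, lt_condSup_iff, mem_image, mem_preimage]
    exact ⟨fun ⟨s, hs⟩ => ⟨(x, s), hs, rfl⟩, fun ⟨w, hw, e⟩ => ⟨w.2, e ▸ hw⟩⟩
  rw [this]
  exact ((analyticSet_dualSet ha hD hv).preimage (by fun_prop)).image_of_continuous continuous_fst

omit [TopologicalSpace X] [PolishSpace X] [MeasurableSpace X] [BorelSpace X] [IsMarkovKernel p] in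
lemma lt_condSup {z : ℕ → ℕ} {Q : Measure Y} [IsProbabilityMeasure Q] (hQ : Q ≪ p z)
    (hDi : ∀ i, Integrable (fun y => D (a z, y) i) Q) (hD0 : ∀ i, ∫ y, D (a z, y) i ∂Q = 0)
    {b : Y → ℝ} (hb : Integrable b Q) (hbv : ∀ᵐ y ∂Q, (b y : EReal) < v (a z, y)) {c : ℝ}
    (hc : c < ∫ y, b y ∂Q) : (c : EReal) < condSup a p D v (a z) := by
  obtain ⟨q, rfl, hq⟩ := exists_univR_univB Q b hb.aemeasurable
  refine lt_condSup_iff.2 ⟨(z, q), rfl, hQ, fun i => ⟨hDi i, hD0 i⟩, ?_, hb.congr ?_, ?_⟩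
  · filter_upwards [hq, hbv] with y h1 h2
    rwa [h1]
  · filter_upwards [hq] with y h1 using h1.symm
  · simp only
    rwa [integral_congr_ae hq]

/-- One-step no-arbitrage at `x`. -/
def NAat (a : (ℕ → ℕ) → X) (p : Kernel (ℕ → ℕ) Y) (D : X × Y → Fin d → ℝ) (v : X × Y → EReal)
    (x : X) : Prop :=
  ∀ y : Fin d → ℝ, (∀ P ∈ goodModels a p v x, ∀ᵐ ω ∂P, 0 ≤ ∑ i, y i * D (x, ω) i) →
    ∀ P ∈ goodModels a p v x, ∀ᵐ ω ∂P, ∑ i, y i * D (x, ω) i = 0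

omit [TopologicalSpace X] [PolishSpace X] [MeasurableSpace X] [BorelSpace X]
    [TopologicalSpace Y] [PolishSpace Y] [BorelSpace Y] [Nonempty Y] in
lemma isProbabilityMeasure_of_mem_goodModels {x : X} {P : Measure Y}
    (hP : P ∈ goodModels a p v x) : IsProbabilityMeasure P := by
  obtain ⟨z, -, -, rfl⟩ := hP
  infer_instance

omit [TopologicalSpace X] [PolishSpace X] [MeasurableSpace X] [BorelSpace X]
    [TopologicalSpace Y] [PolishSpace Y] [BorelSpace Y] [Nonempty Y] [IsMarkovKernel p] in
lemma goodModels_directed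
    (hconv : ∀ z₁ z₂, a z₁ = a z₂ → ∃ z₃, a z₃ = a z₁ ∧
      p z₃ = (2⁻¹ : ℝ≥0∞) • p z₁ + (2⁻¹ : ℝ≥0∞) • p z₂) (x : X) :
    ∀ P₁ ∈ goodModels a p v x, ∀ P₂ ∈ goodModels a p v x, ∃ P₃ ∈ goodModels a p v x,
      P₁ ≪ P₃ ∧ P₂ ≪ P₃ := by
  rintro _ ⟨z₁, rfl, hg₁, rfl⟩ _ ⟨z₂, h12, hg₂, rfl⟩
  obtain ⟨z₃, h3, hp3⟩ := hconv z₁ z₂ h12.symm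
  have h2 : (2⁻¹ : ℝ≥0∞) ≠ 0 := by simp
  refine ⟨p z₃, ⟨z₃, h3, ?_, rfl⟩, ?_, ?_⟩
  · unfold goodSet at *
    rw [mem_ofPred_eq] at *
    rw [hp3, ae_add_measure_iff, h3]
    rw [h12] at hg₂
    exact ⟨Measure.ae_smul_measure hg₁ _, Measure.ae_smul_measure hg₂ _⟩
  · rw [hp3]
    exact (Measure.absolutelyContinuous_smul h2).trans
      (Measure.le_add_right le_rfl).absolutelyContinuous
  · rw [hp3]
    exact (Measure.absolutelyContinuous_smul h2).trans
      (Measure.le_add_left le_rfl).absolutelyContinuous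

end Step

section Step
variable {X Y : Type*} [TopologicalSpace X] [PolishSpace X] [MeasurableSpace X] [BorelSpace X]
  [TopologicalSpace Y] [PolishSpace Y] [MeasurableSpace Y] [BorelSpace Y] [Nonempty Y] {d : ℕ}
  {a : (ℕ → ℕ) → X} {p : Kernel (ℕ → ℕ) Y} [IsMarkovKernel p] {D : X × Y → Fin d → ℝ}
  {v : X × Y → EReal}

/-- The integrable lower bound of `v` used to localize. -/
def lowerPart (v : EReal) : ℝ := (min v 0).toReal

lemma measurable_lowerPart : Measurable lowerPart :=
  measurable_ereal_toReal.comp (measurable_id.min measurable_const)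

lemma lowerPart_le {v : EReal} (h : ⊥ < v) : (lowerPart v : EReal) ≤ v := by
  unfold lowerPart
  rw [EReal.coe_toReal]
  · exact min_le_left _ _
  · exact ne_top_of_le_ne_top (by simp) (min_le_right v 0)
  · exact (lt_min h (by simp)).ne'

lemma lowerPart_sub_one_lt {v : EReal} (h : ⊥ < v) : ((lowerPart v - 1 : ℝ) : EReal) < v :=
  (EReal.coe_lt_coe_iff.2 (by linarith)).trans_le (lowerPart_le h)

section At
variable {x : X} (hD : Measurable D) (hv : UpperSemianalyticE v)
  (hconv : ∀ z₁ z₂, a z₁ = a z₂ → ∃ z₃, a z₃ = a z₁ ∧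
      p z₃ = (2⁻¹ : ℝ≥0∞) • p z₁ + (2⁻¹ : ℝ≥0∞) • p z₂)
  (hne : (goodModels a p v x).Nonempty) (hNA : NAat a p D v x)
include hD hv hconv hne hNA

omit hD hconv hne hNA [IsMarkovKernel p] [Nonempty Y] in
omit [MeasurableSpace X] [BorelSpace X] in
lemma aemeasurable_section (P : Measure Y) [IsFiniteMeasure P] :
    AEMeasurable (fun y => v (x, y)) P :=
  UMeas.aemeasurable (UpperSemianalyticE.uMeas (v := fun y => v (x, y))
    (hv.comp_continuous (by fun_prop : Continuous fun y : Y => (x, y)))) P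

omit hD hv hconv hne hNA [IsMarkovKernel p] in
omit [TopologicalSpace X] [PolishSpace X] [MeasurableSpace X] [BorelSpace X]
    [TopologicalSpace Y] [PolishSpace Y] [BorelSpace Y] [Nonempty Y] in
lemma ae_bot_lt_of_dominated {Q : Measure Y} (hQ : ∃ P ∈ goodModels a p v x, Q ≪ P) :
    ∀ᵐ y ∂Q, ⊥ < v (x, y) := by
  obtain ⟨_, ⟨z, rfl, hz, rfl⟩, hQ⟩ := hQ
  exact hQ.ae_le hz

omit hv in
omit [TopologicalSpace X] [PolishSpace X] [BorelSpace X] [TopologicalSpace Y] [PolishSpace Y]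
    [BorelSpace Y] [Nonempty Y] in
lemma exists_null_strategy {b w : Y → ℝ} (hb0 : ∀ y, 0 ≤ b y)
    (hb : ∀ P ∈ goodModels a p v x, AEMeasurable b P)
    (hw : ∀ P ∈ goodModels a p v x, AEMeasurable w P)
    (hc : ∀ Q : Measure Y, IsProbabilityMeasure Q → (∃ P ∈ goodModels a p v x, Q ≪ P) →
      (∀ i, Integrable (fun y => D (x, y) i) Q) → Integrable b Q → Integrable w Q →
      (∀ i, ∫ y, D (x, y) i ∂Q = 0) → ∫ y, b y ∂Q ≤ 0) :
    ∀ P ∈ goodModels a p v x, ∀ᵐ y ∂P, b y ≤ 0 := by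
  have hDx : Measurable fun y => D (x, y) := hD.comp measurable_prodMk_left
  obtain ⟨y, hy⟩ := one_step_duality hne
    (fun P hP => isProbabilityMeasure_of_mem_goodModels hP) (goodModels_directed hconv x)
    (fun P _ => hDx.aemeasurable) hNA hb hw hc
  intro P hP
  have h0 := hNA y (fun P hP => (hy P hP).mono fun ω h => by linarith [hb0 ω]) P hP
  filter_upwards [hy P hP, h0] with ω h1 h2
  linarith

omit [BorelSpace X] in
lemma bot_lt_condSup : ⊥ < condSup a p D v x := by
  by_contra hcon
  rw [not_bot_lt_iff] at hcon
  have hnull := exists_null_strategy hD hconv hne hNA (b := fun _ => 1)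
    (w := fun y => lowerPart (v (x, y)))
    (fun _ => zero_le_one) (fun _ _ => aemeasurable_const)
    (fun P hP => by
      have := isProbabilityMeasure_of_mem_goodModels hP
      exact measurable_lowerPart.comp_aemeasurable (aemeasurable_section hv P))
    (fun Q hQ hQP hDi _ hwi hD0 => by
      exfalso
      have hbot := ae_bot_lt_of_dominated hQP
      obtain ⟨_, ⟨z, rfl, hz, rfl⟩, hQ⟩ := hQP
      have := lt_condSup (v := v) (c := ∫ y, (lowerPart (v (a z, y)) - 1) ∂Q - 1) hQ hDi hD0
        (hwi.sub (integrable_const 1))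
        (hbot.mono fun y hy => lowerPart_sub_one_lt hy) (by simp only [Pi.sub_apply]; linarith)
      rw [hcon] at this
      exact not_lt_bot this)
  obtain ⟨P, hP⟩ := hne
  have := isProbabilityMeasure_of_mem_goodModels hP
  obtain ⟨y, hy⟩ := (hnull P hP).exists
  linarith

omit [BorelSpace X] in
lemma exists_hedge_of_condSup_le {c : ℝ} (hc : condSup a p D v x ≤ c) :
    ∃ y : Fin d → ℝ, ∀ P ∈ goodModels a p v x, ∀ᵐ ω ∂P,
      v (x, ω) ≤ ((c + ∑ i, y i * D (x, ω) i : ℝ) : EReal) := by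
  classical
  have hDx : Measurable fun y => D (x, y) := hD.comp measurable_prodMk_left
  have hw : ∀ P ∈ goodModels a p v x, AEMeasurable (fun y => lowerPart (v (x, y))) P :=
    fun P hP => by
      have := isProbabilityMeasure_of_mem_goodModels hP
      exact measurable_lowerPart.comp_aemeasurable (aemeasurable_section hv P)
  have htop : Measurable fun e : EReal => if e = ⊤ then (1 : ℝ) else 0 :=
    Measurable.ite (measurableSet_singleton _) measurable_const measurable_const
  have hnull := exists_null_strategy hD hconv hne hNA
    (b := fun y => if v (x, y) = ⊤ then 1 else 0)
    (w := fun y => lowerPart (v (x, y)))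
    (fun y => by split_ifs <;> norm_num)
    (fun P hP => by
      have := isProbabilityMeasure_of_mem_goodModels hP
      exact htop.comp_aemeasurable (aemeasurable_section hv P)) hw
    (fun Q hQ hQP hDi hbi hwi hD0 => by
      by_contra hpos
      rw [not_le] at hpos
      have hbot := ae_bot_lt_of_dominated hQP
      obtain ⟨_, ⟨z, rfl, hz, rfl⟩, hQ⟩ := hQP
      set ε := ∫ y, (if v (a z, y) = ⊤ then (1 : ℝ) else 0) ∂Q with hε
      set m := ∫ y, lowerPart (v (a z, y)) ∂Q with hm
      obtain ⟨n, hn⟩ := exists_nat_gt ((c - m + 1) / ε)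
      rw [div_lt_iff₀ hpos] at hn
      refine absurd (lt_condSup (v := v) (c := c) hQ hDi hD0
        (b := fun y => (lowerPart (v (a z, y)) - 1) + n * (if v (a z, y) = ⊤ then 1 else 0))
        ((hwi.sub (integrable_const 1)).add (hbi.const_mul _)) ?_ ?_) (not_lt.2 hc)
      · filter_upwards [hbot] with y hy
        by_cases h : v (a z, y) = ⊤
        · rw [h]
          exact EReal.coe_lt_top _
        · simp only [h, if_false, mul_zero, add_zero]
          exact lowerPart_sub_one_lt hy
      · have h1 : Integrable (fun y => lowerPart (v (a z, y)) - 1) Q := hwi.sub (integrable_const 1)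
        rw [integral_add h1 (hbi.const_mul _), integral_const_mul,
          integral_sub hwi (integrable_const 1), ← hm, ← hε]
        simp
        linarith)
  obtain ⟨y, hy⟩ := one_step_duality hne
    (fun P hP => isProbabilityMeasure_of_mem_goodModels hP) (goodModels_directed hconv x)
    (fun P _ => hDx.aemeasurable) hNA (b := fun y => (v (x, y)).toReal)
    (w := fun _ => 0) (c := c) (fun P hP => by
      have := isProbabilityMeasure_of_mem_goodModels hP
      exact measurable_ereal_toReal.comp_aemeasurable (aemeasurable_section hv P))
    (fun _ _ => aemeasurable_const) (fun Q hQ hQP hDi hbi _ hD0 => by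
      have hbot := ae_bot_lt_of_dominated hQP
      obtain ⟨P, hP, hQ⟩ := hQP
      have hfin := hQ.ae_le (hnull P hP)
      obtain ⟨z, rfl, hz, rfl⟩ := hP
      by_contra hlt
      rw [not_le] at hlt
      obtain ⟨ε, hε0, hε⟩ : ∃ ε : ℝ, 0 < ε ∧ c < ∫ y, (v (a z, y)).toReal ∂Q - ε :=
        ⟨(∫ y, (v (a z, y)).toReal ∂Q - c) / 2, by linarith, by linarith⟩
      refine absurd (lt_condSup (v := v) (c := c) hQ hDi hD0
        (b := fun y => (v (a z, y)).toReal - ε) (hbi.sub (integrable_const _)) ?_ ?_) (not_lt.2 hc)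
      · filter_upwards [hbot, hfin] with y h1 h2
        have h3 : v (a z, y) ≠ ⊤ := by
          intro h
          simp [h] at h2
          linarith
        nth_rewrite 2 [← EReal.coe_toReal h3 h1.ne']
        exact EReal.coe_lt_coe_iff.2 (by linarith)
      · rw [integral_sub hbi (integrable_const _)]
        simpa using hε)
  refine ⟨y, fun P hP => ?_⟩
  have hbot := ae_bot_lt_of_dominated ⟨P, hP, Measure.AbsolutelyContinuous.rfl⟩
  filter_upwards [hy P hP, hbot, hnull P hP] with ω h1 h2 h3
  have h4 : v (x, ω) ≠ ⊤ := by
    intro h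
    simp [h] at h3
    linarith
  rw [← EReal.coe_toReal h4 h2.ne']
  exact EReal.coe_le_coe_iff.2 h1

end At

/-! ### Measurable strategies -/

instance : PolishSpace (BoxIdx d → Bool) := polishSpace_of_compactSpace _

omit [Nonempty Y] in
lemma exists_charge_pattern (ha : Continuous a) (hD : Measurable D) {Z : Set (ℕ → ℕ)}
    (hZ : AnalyticSet Z) (hv : UpperSemianalyticE v) :
    ∃ χ : X → BoxIdx d → Bool, UMeas χ ∧ ∀ x c y,
      ((∀ z ∈ Z, a z = x → ∀ᵐ ω ∂p z, v (x, ω) ≤ ((c + ∑ i, y i * D (x, ω) i : ℝ) : EReal)) ↔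
        ((χ x, c), y) ∈ admissible d) := by
  classical
  set C : BoxIdx d → Set X := fun i => a '' (Z ∩ {z | 0 < p z {ω | (a z, ω) ∈
    {q : X × Y | D q ∈ i.box} ∩ {q | ((i.2 : ℝ) : EReal) < v q}}}) with hC
  have hCa : ∀ i, AnalyticSet (C i) := fun i =>
    (hZ.inter (analyticSet_section_lt ha.measurable p
      ((hD (isOpen_box i).measurableSet).analyticSet.inter (hv i.2)) 0)).image_of_continuous ha
  refine ⟨fun x i => decide (x ∈ C i), uMeas_pi_iff.2 fun i => ?_, fun x c y => ?_⟩
  · have := UMeas.ite (hCa i).umSet (uMeas_const true) (uMeas_const false)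
    simpa [Bool.if_true_left] using this
  · simp only [admissible, mem_ofPred_eq, decide_eq_true_eq]
    constructor
    · rintro h i ⟨z, ⟨hz, hpz⟩, rfl⟩
      exact (ae_le_iff_charged (p z) (fun ω => D (a z, ω)) (fun ω => v (a z, ω)) c y).1
        (h z hz rfl) i (ne_of_gt hpz)
    · rintro h z hz rfl
      refine (ae_le_iff_charged (p z) (fun ω => D (a z, ω)) (fun ω => v (a z, ω)) c y).2 ?_
      exact fun i hi => h i ⟨z, ⟨hz, pos_iff_ne_zero.2 hi⟩, rfl⟩

omit [Nonempty Y] in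
lemma exists_uMeas_hedge (ha : Continuous a) (hD : Measurable D) (hv : UpperSemianalyticE v)
    {c : X → ℝ} (hc : UMeas c) :
    ∃ η : X → Fin d → ℝ, UMeas η ∧ ∀ (x : X) (y : Fin d → ℝ),
      (∀ P ∈ goodModels a p v x, ∀ᵐ ω ∂P,
        v (x, ω) ≤ ((c x + ∑ i, y i * D (x, ω) i : ℝ) : EReal)) →
      ∀ P ∈ goodModels a p v x, ∀ᵐ ω ∂P,
        v (x, ω) ≤ ((c x + ∑ i, η x i * D (x, ω) i : ℝ) : EReal) := by
  obtain ⟨χ, hχ, hχi⟩ := exists_charge_pattern (p := p) ha hD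
    (analyticSet_goodSet (p := p) ha hv) hv
  obtain ⟨s, hs, hsi⟩ := exists_uMeas_selection (measurableSet_admissible d).analyticSet
  refine ⟨fun x => s (χ x, c x), UMeas.comp hs (hχ.prodMk hc), fun x y h => ?_⟩
  have h1 := (hχi x (c x) y).1 fun z hz hx => h (p z) ⟨z, hx, hz, rfl⟩
  rintro _ ⟨z, hx, hz, rfl⟩
  exact (hχi x (c x) _).2 (hsi _ _ h1) z hz hx

end Step

section Family
variable {X Y : Type*} [TopologicalSpace X] [PolishSpace X] [MeasurableSpace X] [BorelSpace X]
  [TopologicalSpace Y] [PolishSpace Y] [MeasurableSpace Y] [BorelSpace Y] [Nonempty Y] {d : ℕ}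

/-- `Fam'` consists of the measures obtained from `Fam` by appending one-step models
parametrized by `(a, p)`. -/
structure StepFam (a : (ℕ → ℕ) → X) (p : Kernel (ℕ → ℕ) Y) (Fam : Set (Measure X))
    (Fam' : Set (Measure (X × Y))) : Prop where
  continuous : Continuous a
  surjective : Function.Surjective a
  half : ∀ z₁ z₂, a z₁ = a z₂ → ∃ z₃, a z₃ = a z₁ ∧
    p z₃ = (2⁻¹ : ℝ≥0∞) • p z₁ + (2⁻¹ : ℝ≥0∞) • p z₂
  prob : ∀ ν ∈ Fam, IsProbabilityMeasure ν
  disint : ∀ μ ∈ Fam', ∃ ν ∈ Fam, ∃ k : Kernel X Y, IsMarkovKernel k ∧ μ = ν ⊗ₘ k ∧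
    ∀ᵐ x ∂ν, ∃ z, a z = x ∧ p z = k x
  glue : ∀ ν ∈ Fam, ∀ ζ : X → ℕ → ℕ, UMeas ζ → (∀ x, a (ζ x) = x) → ∀ k : Kernel X Y,
    IsMarkovKernel k → (∀ᵐ x ∂ν, p (ζ x) = k x) → ν ⊗ₘ k ∈ Fam'

variable {a : (ℕ → ℕ) → X} {p : Kernel (ℕ → ℕ) Y} [IsMarkovKernel p] {D : X × Y → Fin d → ℝ}
  {v : X × Y → EReal} {Fam : Set (Measure X)} {Fam' : Set (Measure (X × Y))}

omit [TopologicalSpace X] [PolishSpace X] [BorelSpace X] [Nonempty Y] in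
lemma exists_kernel_of_uMeas [Nonempty Y] (κ : Kernel (ℕ → ℕ) Y) [IsMarkovKernel κ]
    {ζ : X → ℕ → ℕ} (hζ : UMeas ζ) (ν : Measure X) [IsFiniteMeasure ν] :
    ∃ k : Kernel X Y, IsMarkovKernel k ∧ ∀ᵐ x ∂ν, κ (ζ x) = k x :=
  exists_kernel_ae_eq (fun _ => inferInstance) ν fun _ hs =>
    UMeas.aemeasurable ((κ.measurable_coe hs).comp_uMeas hζ) ν

omit [TopologicalSpace Y] [PolishSpace Y] [BorelSpace Y] [Nonempty Y] [IsMarkovKernel p] in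
lemma StepFam.exists_section (h : StepFam a p Fam Fam') :
    ∃ ζ : X → ℕ → ℕ, UMeas ζ ∧ ∀ x, a (ζ x) = x := by
  have hcl : IsClosed {q : X × (ℕ → ℕ) | a q.2 = q.1} :=
    isClosed_eq (h.continuous.comp continuous_snd) continuous_fst
  obtain ⟨ζ, hζ, hζi⟩ := exists_uMeas_selection hcl.measurableSet.analyticSet
  refine ⟨ζ, hζ, fun x => ?_⟩
  obtain ⟨z, hz⟩ := h.surjective x
  exact hζi x z hz

omit [BorelSpace X] [TopologicalSpace Y] [PolishSpace Y] [BorelSpace Y] [Nonempty Y]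
    [IsMarkovKernel p] in
lemma StepFam.ae_mem_goodModels {ν : Measure X} [IsProbabilityMeasure ν] {k : Kernel X Y}
    [IsMarkovKernel k] (hk : ∀ᵐ x ∂ν, ∃ z, a z = x ∧ p z = k x)
    (hv : ∀ᵐ q ∂(ν ⊗ₘ k), ⊥ < v q) : ∀ᵐ x ∂ν, k x ∈ goodModels a p v x := by
  filter_upwards [hk, Measure.ae_ae_of_ae_compProd hv] with x ⟨z, hz, hpz⟩ h2
  refine ⟨z, hz, ?_, hpz⟩
  unfold goodSet
  rw [mem_ofPred_eq, hz, hpz]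
  exact h2

lemma StepFam.ae_goodModels_nonempty (h : StepFam a p Fam Fam')
    (hv : ∀ μ ∈ Fam', ∀ᵐ q ∂μ, ⊥ < v q) {ν : Measure X} (hν : ν ∈ Fam) :
    ∀ᵐ x ∂ν, (goodModels a p v x).Nonempty := by
  have := h.prob ν hν
  obtain ⟨ζ, hζ, hζa⟩ := h.exists_section
  obtain ⟨k, hk, hkζ⟩ := exists_kernel_of_uMeas p hζ ν
  filter_upwards [StepFam.ae_mem_goodModels (hkζ.mono fun x hx => ⟨ζ x, hζa x, hx⟩)
    (hv _ (h.glue ν hν ζ hζ hζa k hk hkζ))] with x hx using ⟨_, hx⟩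

omit [TopologicalSpace X] [PolishSpace X] [BorelSpace X] [TopologicalSpace Y] [PolishSpace Y]
    [BorelSpace Y] [Nonempty Y] in
lemma uMeas_lin {η : X → Fin d → ℝ} (hη : UMeas η) (hD : Measurable D) :
    UMeas fun q : X × Y => ∑ i, η q.1 i * D q i :=
  UMeas.sum fun i => UMeas.mul
    (uMeas_pi_iff.1 (hη.comp_measurable (measurable_fst : Measurable (Prod.fst : X × Y → X))) i)
    ((measurable_pi_apply i).comp hD).uMeas

lemma StepFam.ae_NAat (h : StepFam a p Fam Fam') (hD : Measurable D) (hvu : UpperSemianalyticE v)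
    (hv : ∀ μ ∈ Fam', ∀ᵐ q ∂μ, ⊥ < v q)
    (hNA : ∀ η : X → Fin d → ℝ, UMeas η →
      (∀ μ ∈ Fam', ∀ᵐ q ∂μ, 0 ≤ ∑ i, η q.1 i * D q i) →
      ∀ μ ∈ Fam', ∀ᵐ q ∂μ, ∑ i, η q.1 i * D q i = 0)
    {ν : Measure X} (hν : ν ∈ Fam) : ∀ᵐ x ∂ν, NAat a p D v x := by
  classical
  have hνp := h.prob ν hν
  have hzero : UpperSemianalyticE fun _ : X × Y => (0 : EReal) := fun c => by
    by_cases hc : (c : EReal) < 0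
    · simpa [hc] using MeasurableSet.univ.analyticSet
    · simpa [hc] using analyticSet_empty
  obtain ⟨χ, hχ, hχi⟩ := exists_charge_pattern (p := p) (D := D) h.continuous hD
    (analyticSet_goodSet (p := p) h.continuous hvu) hzero
  have hχ0 : ∀ x y, (∀ P ∈ goodModels a p v x, ∀ᵐ ω ∂P, 0 ≤ ∑ i, y i * D (x, ω) i) ↔
      ((χ x, 0), y) ∈ admissible d := by
    intro x y
    rw [← hχi x 0 y]
    constructor
    · intro h z hz hx
      filter_upwards [h _ ⟨z, hx, hz, rfl⟩] with ω hω
      rw [zero_add]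
      exact_mod_cast hω
    · rintro h _ ⟨z, hx, hz, rfl⟩
      filter_upwards [h z hz hx] with ω hω
      rw [zero_add] at hω
      exact_mod_cast hω
  set ARB : Set ((BoxIdx d → Bool) × (Fin d → ℝ)) :=
    {q | ((q.1, 0), q.2) ∈ admissible d ∧ ((q.1, 0), -q.2) ∉ admissible d} with hARB
  have hARBm : MeasurableSet ARB :=
    ((by fun_prop : Measurable fun q : (BoxIdx d → Bool) × (Fin d → ℝ) => ((q.1, (0 : ℝ)), q.2))
      (measurableSet_admissible d)).inter
    ((by fun_prop : Measurable fun q : (BoxIdx d → Bool) × (Fin d → ℝ) => ((q.1, (0 : ℝ)), -q.2))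
      (measurableSet_admissible d)).compl
  obtain ⟨s, hs, hsi⟩ := exists_uMeas_selection hARBm.analyticSet
  have hsχ : UMeas fun x => s (χ x) := UMeas.comp hs hχ
  set A : Set X := {x | (χ x, s (χ x)) ∈ ARB} with hA
  have hAu : UMSet A := (hχ.prodMk hsχ) hARBm
  set η : X → Fin d → ℝ := fun x => if x ∈ A then s (χ x) else 0 with hη
  have hηu : UMeas η := by convert UMeas.ite hAu hsχ (uMeas_const 0)
  have hηpos : ∀ x, ∀ P ∈ goodModels a p v x, ∀ᵐ ω ∂P, 0 ≤ ∑ i, η x i * D (x, ω) i := by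
    intro x
    by_cases hx : x ∈ A
    · have : η x = s (χ x) := if_pos hx
      rw [this]
      exact (hχ0 x _).2 hx.1
    · have : η x = 0 := if_neg hx
      intro P _
      filter_upwards with ω
      simp [this]
  have hlin := uMeas_lin (D := D) hηu hD
  have hz := hNA η hηu fun μ hμ => by
    obtain ⟨ν', hν', k, hk, rfl, hka⟩ := h.disint μ hμ
    have := h.prob ν' hν'
    refine ae_compProd_of_ae_ae_umSet (UMeas.umSet_le (uMeas_const 0) hlin) ?_
    filter_upwards [StepFam.ae_mem_goodModels hka (hv _ hμ)] with x hx using hηpos x _ hx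
  -- select models witnessing the arbitrage
  set B : Set ((X × (Fin d → ℝ)) × (ℕ → ℕ)) :=
    {q | a q.2 = q.1.1 ∧ q.2 ∈ goodSet a p v ∧
      0 < p q.2 {ω | (q, ω) ∈ {r : ((X × (Fin d → ℝ)) × (ℕ → ℕ)) × Y |
        0 < ∑ i, r.1.1.2 i * D (r.1.1.1, r.2) i}}} with hB
  have hBa : AnalyticSet B := by
    refine AnalyticSet.inter ?_ (AnalyticSet.inter ?_ ?_)
    · exact (isClosed_eq (h.continuous.comp continuous_snd)
        (continuous_fst.comp continuous_fst)).measurableSet.analyticSet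
    · exact (analyticSet_goodSet (p := p) h.continuous hvu).preimage continuous_snd
    · refine analyticSet_section_lt measurable_id (p.comap Prod.snd measurable_snd)
        (MeasurableSet.analyticSet ?_) 0
      refine measurableSet_lt measurable_const (Finset.measurable_sum _ fun i _ => ?_)
      refine Measurable.mul (by fun_prop) ((measurable_pi_apply i).comp (hD.comp (by fun_prop)))
  obtain ⟨σ, hσ, hσi⟩ := exists_uMeas_selection hBa
  obtain ⟨ζ₀, hζ₀, hζ₀a⟩ := h.exists_section
  have hση : UMeas fun x => σ (x, η x) := UMeas.comp hσ (measurable_id.uMeas.prodMk hηu)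
  have hEu : UMSet {x | a (σ (x, η x)) = x} :=
    ((h.continuous.measurable.comp_uMeas hση).prodMk measurable_id.uMeas)
      (measurableSet_eq_fun measurable_fst measurable_snd)
  set ζ : X → ℕ → ℕ := fun x => if x ∈ {x | a (σ (x, η x)) = x} then σ (x, η x) else ζ₀ x with hζ
  have hζu : UMeas ζ := UMeas.ite hEu hση hζ₀
  have hζa : ∀ x, a (ζ x) = x := fun x => by
    by_cases hx : x ∈ {x | a (σ (x, η x)) = x}
    · rw [hζ]
      simp only [hx, if_true]
      exact hx
    · rw [hζ]
      simp only [hx, if_false]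
      exact hζ₀a x
  obtain ⟨k, hk, hkζ⟩ := exists_kernel_of_uMeas p hζu ν
  have hz2 := Measure.ae_ae_of_ae_compProd (hz _ (h.glue ν hν ζ hζu hζa k hk hkζ))
  filter_upwards [hz2, hkζ] with x hx1 hx2
  rw [← hx2] at hx1
  have hxA : x ∉ A := by
    intro hxA
    have hηx : η x = s (χ x) := if_pos hxA
    have hnot := hxA.2
    rw [← hχ0 x] at hnot
    simp only [not_forall] at hnot
    obtain ⟨P, ⟨z, hza, hzg, rfl⟩, hzP⟩ := hnot
    have hzB : ((x, η x), z) ∈ B := by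
      refine ⟨hza, hzg, pos_iff_ne_zero.2 fun h0 => hzP ?_⟩
      refine measure_mono_null (fun ω hω => ?_) h0
      change ¬ (0 ≤ ∑ i, (-(s (χ x))) i * D (x, ω) i) at hω
      rw [not_le] at hω
      change 0 < ∑ i, η x i * D (x, ω) i
      rw [hηx]
      simpa using hω
    have hσB := hσi _ _ hzB
    have hζx : ζ x = σ (x, η x) := if_pos hσB.1
    rw [hζx] at hx1
    refine hσB.2.2.ne' (measure_mono_null (fun ω hω => ?_) hx1)
    exact (ne_of_gt hω : ∑ i, η x i * D (x, ω) i ≠ 0)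
  intro y hy
  by_contra hcon
  refine hxA (hsi (χ x) y ⟨(hχ0 x y).1 hy, fun hneg => hcon fun P hP => ?_⟩)
  filter_upwards [hy P hP, (hχ0 x (-y)).2 hneg P hP] with ω h1 h2
  simp only [Pi.neg_apply, neg_mul, Finset.sum_neg_distrib] at h2
  linarith

/-- One-step hedging: a strategy bounding `v` by its one-step dual value. -/
lemma StepFam.exists_hedge (h : StepFam a p Fam Fam') (hD : Measurable D)
    (hvu : UpperSemianalyticE v) (hv : ∀ μ ∈ Fam', ∀ᵐ q ∂μ, ⊥ < v q)
    (hNA : ∀ η : X → Fin d → ℝ, UMeas η →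
      (∀ μ ∈ Fam', ∀ᵐ q ∂μ, 0 ≤ ∑ i, η q.1 i * D q i) →
      ∀ μ ∈ Fam', ∀ᵐ q ∂μ, ∑ i, η q.1 i * D q i = 0) :
    (∀ ν ∈ Fam, ∀ᵐ x ∂ν, ⊥ < condSup a p D v x) ∧
    ∃ η : X → Fin d → ℝ, UMeas η ∧ ∀ μ ∈ Fam', ∀ᵐ q ∂μ, ∀ c : ℝ, condSup a p D v q.1 ≤ c →
      v q ≤ ((c + ∑ i, η q.1 i * D q i : ℝ) : EReal) := by
  have hne : ∀ ν ∈ Fam, ∀ᵐ x ∂ν, (goodModels a p v x).Nonempty := fun ν hν =>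
    h.ae_goodModels_nonempty hv hν
  have hna : ∀ ν ∈ Fam, ∀ᵐ x ∂ν, NAat a p D v x := fun ν hν => h.ae_NAat hD hvu hv hNA hν
  have hbot : ∀ ν ∈ Fam, ∀ᵐ x ∂ν, ⊥ < condSup a p D v x := fun ν hν => by
    filter_upwards [hne ν hν, hna ν hν] with x h1 h2 using bot_lt_condSup hD hvu h.half h1 h2
  refine ⟨hbot, ?_⟩
  have hEu : UMeas (condSup a p D v) := (upperSemianalyticE_condSup h.continuous hD hvu).uMeas
  have hcu : UMeas fun x => (condSup a p D v x).toReal := measurable_ereal_toReal.comp_uMeas hEu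
  obtain ⟨η, hη, hηi⟩ := exists_uMeas_hedge (p := p) h.continuous hD hvu hcu
  refine ⟨η, hη, fun μ hμ => ?_⟩
  obtain ⟨ν, hν, k, hk, rfl, hka⟩ := h.disint μ hμ
  have hνp := h.prob ν hν
  have hlin := uMeas_lin (D := D) hη hD
  have hset : UMSet {q : X × Y | condSup a p D v q.1 = ⊤ ∨
      v q ≤ (((condSup a p D v q.1).toReal + ∑ i, η q.1 i * D q i : ℝ) : EReal)} := by
    refine UMSet.union ?_ ?_
    · exact (hEu.comp_measurable (measurable_fst : Measurable (Prod.fst : X × Y → X)))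
        (measurableSet_singleton ⊤)
    · have h1 := UMeas.add (hcu.comp_measurable
        (measurable_fst : Measurable (Prod.fst : X × Y → X)))
        hlin
      exact (hvu.uMeas.prodMk (measurable_coe_real_ereal.comp_uMeas h1))
        (measurableSet_le measurable_fst measurable_snd)
  have key : ∀ᵐ q ∂(ν ⊗ₘ k), condSup a p D v q.1 = ⊤ ∨
      v q ≤ (((condSup a p D v q.1).toReal + ∑ i, η q.1 i * D q i : ℝ) : EReal) := by
    refine ae_compProd_of_ae_ae_umSet hset ?_
    filter_upwards [hne ν hν, hna ν hν, hbot ν hν, StepFam.ae_mem_goodModels hka (hv _ hμ)]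
      with x h1 h2 h3 h4
    by_cases htop : condSup a p D v x = ⊤
    · exact Eventually.of_forall fun _ => Or.inl htop
    · obtain ⟨y, hy⟩ := exists_hedge_of_condSup_le hD hvu h.half h1 h2
        (EReal.coe_toReal htop h3.ne').ge
      exact (hηi x y hy _ h4).mono fun ω hω => Or.inr hω
  have hbot' : ∀ᵐ q ∂(ν ⊗ₘ k), ⊥ < condSup a p D v q.1 := by
    refine ae_compProd_of_ae_ae_umSet ?_ ?_
    · exact (hEu.comp_measurable (measurable_fst : Measurable (Prod.fst : X × Y → X)))
        measurableSet_Ioi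
    · filter_upwards [hbot ν hν] with x hx using Eventually.of_forall fun _ => hx
  filter_upwards [key, hbot'] with q h1 h2 c hc
  rcases h1 with h1 | h1
  · rw [h1] at hc
    exact absurd hc (by simp)
  · refine h1.trans (EReal.coe_le_coe_iff.2 ?_)
    have htop : condSup a p D v q.1 ≠ ⊤ := ne_top_of_le_ne_top (by simp) hc
    have : (condSup a p D v q.1).toReal ≤ c := by
      rw [← EReal.coe_toReal htop h2.ne'] at hc
      exact EReal.coe_le_coe_iff.1 hc
    linarith

end Family

section Dual
variable {X Y : Type*} [TopologicalSpace X] [PolishSpace X] [MeasurableSpace X] [BorelSpace X]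
  [TopologicalSpace Y] [PolishSpace Y] [MeasurableSpace Y] [BorelSpace Y] [Nonempty Y] {d : ℕ}

/-- Some measure dominated by `Fam` carries a random variable below `v` whose mean exceeds `c`
under equivalent-to-smaller martingale measures integrating any given finite weight. -/
def DualAbove (Fam : Set (Measure X)) (Mart : Measure X → Prop) (v : X → EReal) (c : ℝ) : Prop :=
  ∃ P ∈ Fam, ∃ Q : Measure X, IsProbabilityMeasure Q ∧ Q ≪ P ∧ ∃ b : X → ℝ, Measurable b ∧
    (∀ᵐ x ∂Q, (b x : EReal) < v x) ∧
    ∀ w : X → ℝ≥0∞, Measurable w → (∀ᵐ x ∂Q, w x < ⊤) →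
      ∃ Q' : Measure X, IsProbabilityMeasure Q' ∧ Q' ≪ Q ∧ Mart Q' ∧ Integrable b Q' ∧
        ∫⁻ x, w x ∂Q' < ⊤ ∧ c < ∫ x, b x ∂Q'

variable {a : (ℕ → ℕ) → X} {p : Kernel (ℕ → ℕ) Y} [IsMarkovKernel p] {D : X × Y → Fin d → ℝ}
  {v : X × Y → EReal} {Fam : Set (Measure X)} {Fam' : Set (Measure (X × Y))}

omit [BorelSpace X] [TopologicalSpace Y] [PolishSpace Y] [BorelSpace Y] [Nonempty Y] in
lemma integrable_compProd_of_lintegral {ν : Measure X} [IsProbabilityMeasure ν] {k : Kernel X Y}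
    [IsMarkovKernel k] {f : X × Y → ℝ} (hf : Measurable f)
    (h : ∫⁻ x, ∫⁻ y, ‖f (x, y)‖ₑ ∂k x ∂ν < ⊤) : Integrable f (ν ⊗ₘ k) := by
  refine ⟨hf.aestronglyMeasurable, ?_⟩
  rw [HasFiniteIntegral, Measure.lintegral_compProd hf.enorm]
  exact h

omit [TopologicalSpace X] [PolishSpace X] [BorelSpace X] [TopologicalSpace Y] [PolishSpace Y]
    [BorelSpace Y] [Nonempty Y] in
lemma integrable_integral_compProd {ν : Measure X} [SFinite ν] {k : Kernel X Y}
    [IsSFiniteKernel k] {f : X × Y → ℝ} (hf : Integrable f (ν ⊗ₘ k)) :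
    Integrable (fun x => ∫ y, f (x, y) ∂k x) ν :=
  Integrable.integral_compProd (κ := Kernel.const Unit ν) (η := Kernel.prodMkLeft Unit k)
    (a := ()) hf

/-- Kernel selection of martingale measures with an integrable weight. -/
lemma exists_martingale_kernel (hD : Measurable D) {Q : Measure X} [IsProbabilityMeasure Q]
    {k : Kernel X Y} [IsMarkovKernel k] {b : X → ℝ} (hb : Measurable b) {β : X × Y → ℝ}
    (hβ : Measurable β)
    (hk : ∀ᵐ x ∂Q, (∀ i, Integrable (fun y => D (x, y) i) (k x) ∧ ∫ y, D (x, y) i ∂k x = 0) ∧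
      Integrable (fun y => β (x, y)) (k x) ∧ b x < ∫ y, β (x, y) ∂k x)
    {w : X × Y → ℝ≥0∞} (hw : Measurable w) (hwf : ∀ᵐ q ∂(Q ⊗ₘ k), w q < ⊤) :
    ∃ k' : Kernel X Y, IsMarkovKernel k' ∧ ∀ᵐ x ∂Q, k' x ≪ k x ∧
      (∀ i, Integrable (fun y => D (x, y) i) (k' x) ∧ ∫ y, D (x, y) i ∂k' x = 0) ∧
      Integrable (fun y => β (x, y)) (k' x) ∧ b x < ∫ y, β (x, y) ∂k' x ∧
      ∫⁻ y, w (x, y) ∂k' x < ⊤ := by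
  set κ : Kernel (X × (ℕ → ℕ)) Y := (univR Y).comap Prod.snd measurable_snd with hκ
  have hDm : ∀ i, Measurable fun q : (X × (ℕ → ℕ)) × Y => D (q.1.1, q.2) i := fun i =>
    (measurable_pi_apply i).comp (hD.comp (by fun_prop))
  have hβm : Measurable fun q : (X × (ℕ → ℕ)) × Y => β (q.1.1, q.2) := hβ.comp (by fun_prop)
  have hwm : Measurable fun q : (X × (ℕ → ℕ)) × Y => w (q.1.1, q.2) := hw.comp (by fun_prop)
  set B : Set (X × (ℕ → ℕ)) := {s | univR Y s.2 ≪ k s.1 ∧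
    (∀ i, Integrable (fun y => D (s.1, y) i) (univR Y s.2) ∧
      ∫ y, D (s.1, y) i ∂univR Y s.2 = 0) ∧
    Integrable (fun y => β (s.1, y)) (univR Y s.2) ∧ b s.1 < ∫ y, β (s.1, y) ∂univR Y s.2 ∧
    ∫⁻ y, w (s.1, y) ∂univR Y s.2 < ⊤} with hB
  have hBm : MeasurableSet B := by
    refine MeasurableSet.inter ?_ (MeasurableSet.inter ?_ (MeasurableSet.inter ?_
      (MeasurableSet.inter ?_ ?_)))
    · exact Kernel.measurableSet_absolutelyContinuous κ (k.comap Prod.fst measurable_fst)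
    · have h1 : ∀ i, MeasurableSet {s : X × (ℕ → ℕ) | Integrable (fun y => D (s.1, y) i) (κ s)} :=
        fun i => measurableSet_kernel_integrable (κ := κ)
          (f := fun (s : X × (ℕ → ℕ)) y => D (s.1, y) i) (hDm i).stronglyMeasurable
      have h2 : ∀ i, MeasurableSet {s : X × (ℕ → ℕ) | ∫ y, D (s.1, y) i ∂κ s = 0} := fun i =>
        (StronglyMeasurable.integral_kernel_prod_right (κ := κ)
          (f := fun s y => D (s.1, y) i) (hDm i).stronglyMeasurable).measurable
            (measurableSet_singleton 0)
      have h3 : {s : X × (ℕ → ℕ) | ∀ i, Integrable (fun y => D (s.1, y) i) (univR Y s.2) ∧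
          ∫ y, D (s.1, y) i ∂univR Y s.2 = 0} =
          ⋂ i, {s : X × (ℕ → ℕ) | Integrable (fun y => D (s.1, y) i) (κ s)} ∩
            {s : X × (ℕ → ℕ) | ∫ y, D (s.1, y) i ∂κ s = 0} := by
        ext s
        simp only [mem_iInter]
        rfl
      change MeasurableSet {s : X × (ℕ → ℕ) |
        ∀ i, Integrable (fun y => D (s.1, y) i) (univR Y s.2) ∧
          ∫ y, D (s.1, y) i ∂univR Y s.2 = 0}
      rw [h3]
      exact MeasurableSet.iInter fun i => (h1 i).inter (h2 i)
    · exact measurableSet_kernel_integrable (κ := κ) (f := fun s y => β (s.1, y))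
        hβm.stronglyMeasurable
    · exact measurableSet_lt (by fun_prop) (StronglyMeasurable.integral_kernel_prod_right (κ := κ)
        (f := fun s y => β (s.1, y)) hβm.stronglyMeasurable).measurable
    · exact measurableSet_lt (Measurable.lintegral_kernel_prod_right (κ := κ)
        (f := fun s y => w (s.1, y)) hwm) measurable_const
  obtain ⟨r, hr, hri⟩ := exists_uMeas_selection hBm.analyticSet
  have hra := hr.aemeasurable Q
  refine ⟨(univR Y).comap (hra.mk r) hra.measurable_mk, inferInstance, ?_⟩
  filter_upwards [hk, Measure.ae_ae_of_ae_compProd hwf, hra.ae_eq_mk] with x ⟨h1, h2, h3⟩ h4 h5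
  have hwx : Measurable fun y => w (x, y) := hw.comp measurable_prodMk_left
  obtain ⟨Q', hQ', hQac, hDi, hD0, hβi, hwi, hlt⟩ := exists_martingale_integrable
    (D := fun y => D (x, y)) (fun i => (h1 i).1) (fun i => (h1 i).2) h2
    (w := fun y => (w (x, y)).toReal) hwx.ennreal_toReal.aemeasurable h3
  obtain ⟨ρ, hρ, -⟩ := exists_univR_univB Q' (fun _ => 0) aemeasurable_const
  have hmem : (x, ρ) ∈ B := by
    rw [hB, mem_ofPred_eq]
    simp only [hρ]
    refine ⟨hQac, fun i => ⟨hDi i, hD0 i⟩, hβi, hlt, ?_⟩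
    have := hwi.lintegral_lt_top
    refine lt_of_eq_of_lt (lintegral_congr_ae ?_) this
    filter_upwards [hQac.ae_le h4] with y hy
    rw [ENNReal.ofReal_toReal hy.ne]
  have := hri x ρ hmem
  rw [h5] at this
  exact this

lemma StepFam.dualAbove (h : StepFam a p Fam Fam') (hD : Measurable D) (hvu : UpperSemianalyticE v)
    {Mart : Measure X → Prop} {Mart' : Measure (X × Y) → Prop}
    (hMart : ∀ (ν : Measure X) (k : Kernel X Y), IsProbabilityMeasure ν → IsMarkovKernel k →
      Mart ν → (∀ i, Integrable (fun q => D q i) (ν ⊗ₘ k)) →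
      (∀ᵐ x ∂ν, ∀ i, ∫ y, D (x, y) i ∂k x = 0) → Mart' (ν ⊗ₘ k)) {c : ℝ}
    (hdual : DualAbove Fam Mart (condSup a p D v) c) : DualAbove Fam' Mart' v c := by
  classical
  obtain ⟨P, hP, Q, hQ, hQP, b, hb, hbv, hdual⟩ := hdual
  have hPp := h.prob P hP
  obtain ⟨s, hs, hsi⟩ := exists_uMeas_selection (analyticSet_dualSet (p := p) h.continuous hD hvu)
  have hsb : UMeas fun x => s (x, b x) := hs.comp_measurable (measurable_id.prodMk hb)
  have hs1 : UMeas fun x => (s (x, b x)).1 := measurable_fst.comp_uMeas hsb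
  have hs2 : UMeas fun x => (s (x, b x)).2 := measurable_snd.comp_uMeas hsb
  obtain ⟨ζ₀, hζ₀, hζ₀a⟩ := h.exists_section
  have hEu : UMSet {x | a (s (x, b x)).1 = x} :=
    ((h.continuous.measurable.comp_uMeas hs1).prodMk measurable_id.uMeas)
      (measurableSet_eq_fun measurable_fst measurable_snd)
  set ζ : X → ℕ → ℕ := fun x => if x ∈ {x | a (s (x, b x)).1 = x} then (s (x, b x)).1 else ζ₀ x
    with hζ
  have hζu : UMeas ζ := UMeas.ite hEu hs1 hζ₀
  have hζa : ∀ x, a (ζ x) = x := fun x => by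
    by_cases hx : x ∈ {x | a (s (x, b x)).1 = x}
    · rw [hζ]
      simp only [hx, if_true]
      exact hx
    · rw [hζ]
      simp only [hx, if_false]
      exact hζ₀a x
  obtain ⟨kP, hkP, hkPζ⟩ := exists_kernel_of_uMeas p hζu P
  have hqa := hs2.aemeasurable Q
  set q : X → ℕ → ℕ := hqa.mk _ with hq
  have hqm : Measurable q := hqa.measurable_mk
  set kQ : Kernel X Y := (univR Y).comap q hqm with hkQ
  have hkQx : ∀ x, kQ x = univR Y (q x) := fun x => rfl
  set β : X × Y → ℝ := fun r => univB Y (q r.1, r.2) with hβ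
  have hβm : Measurable β := (measurable_univB Y).comp (by fun_prop)
  have hF : ∀ᵐ x ∂Q, kQ x ≪ kP x ∧
      (∀ i, Integrable (fun y => D (x, y) i) (kQ x) ∧ ∫ y, D (x, y) i ∂kQ x = 0) ∧
      (∀ᵐ y ∂kQ x, (β (x, y) : EReal) < v (x, y)) ∧
      Integrable (fun y => β (x, y)) (kQ x) ∧ b x < ∫ y, β (x, y) ∂kQ x := by
    filter_upwards [hbv, hqa.ae_eq_mk, hQP.ae_le hkPζ] with x h1 h2 h3
    obtain ⟨s₀, hs₀⟩ := lt_condSup_iff.1 h1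
    obtain ⟨e1, e2, e3, e4, e5, e6⟩ := hsi _ _ hs₀
    have hζx : ζ x = (s (x, b x)).1 := if_pos e1
    simp only at e2 e3 e4 e5 e6
    rw [h2] at e2 e3 e4 e5 e6
    rw [hζx] at h3
    rw [h3] at e2
    exact ⟨e2, e3, e4, e5, e6⟩
  refine ⟨P ⊗ₘ kP, h.glue P hP ζ hζu hζa kP hkP hkPζ, Q ⊗ₘ kQ, inferInstance,
    Measure.AbsolutelyContinuous.compProd hQP (hF.mono fun x hx => hx.1), β, hβm, ?_, ?_⟩
  · refine ae_compProd_of_ae_ae_umSet ?_ (hF.mono fun x hx => hx.2.2.1)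
    exact ((measurable_coe_real_ereal.comp hβm).uMeas.prodMk hvu.uMeas)
      (measurableSet_lt measurable_fst measurable_snd)
  · intro w hw hwf
    obtain ⟨k', hk', hk'F⟩ := exists_martingale_kernel hD (Q := Q) hb hβm
      (hF.mono fun x hx => ⟨hx.2.1, hx.2.2.2.1, hx.2.2.2.2⟩) hw hwf
    have hDe : ∀ i, Measurable fun r : X × Y => ‖D r i‖ₑ := fun i =>
      ((measurable_pi_apply i).comp hD).enorm
    have hwx : ∀ x, Measurable fun y => w (x, y) := fun x => hw.comp measurable_prodMk_left
    have hβx : ∀ x, Measurable fun y => ‖β (x, y)‖ₑ :=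
      fun x => hβm.enorm.comp measurable_prodMk_left
    have hDx : ∀ x i, Measurable fun y => ‖D (x, y) i‖ₑ := fun x i =>
      (hDe i).comp measurable_prodMk_left
    set ψ : X → ℝ≥0∞ := fun x => ∫⁻ y, (w (x, y) + ‖β (x, y)‖ₑ + ∑ i, ‖D (x, y) i‖ₑ) ∂k' x with hψ
    have hψm : Measurable ψ := Measurable.lintegral_kernel_prod_right' (κ := k')
      (f := fun r => w r + ‖β r‖ₑ + ∑ i, ‖D r i‖ₑ)
      ((hw.add hβm.enorm).add (Finset.measurable_sum _ fun i _ => hDe i))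
    have hψf : ∀ᵐ x ∂Q, ψ x < ⊤ := by
      filter_upwards [hk'F] with x ⟨_, h2, h3, _, h5⟩
      rw [hψ]
      simp only
      rw [lintegral_add_right _ (Finset.measurable_sum _ fun i _ => hDx x i),
        lintegral_add_right _ (hβx x), lintegral_finsetSum _ fun i _ => hDx x i]
      refine ENNReal.add_lt_top.2 ⟨ENNReal.add_lt_top.2 ⟨h5, h3.2⟩, ?_⟩
      exact ENNReal.sum_lt_top.2 fun i _ => (h2 i).1.2
    obtain ⟨Q', hQ', hQ'Q, hM, hbi, hψi, hlt⟩ := hdual ψ hψm hψf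
    have hle : ∀ g : X × Y → ℝ≥0∞, (∀ r, g r ≤ w r + ‖β r‖ₑ + ∑ i, ‖D r i‖ₑ) →
        ∫⁻ x, ∫⁻ y, g (x, y) ∂k' x ∂Q' < ⊤ := fun g hg =>
      (lintegral_mono fun x => lintegral_mono fun y => hg (x, y)).trans_lt hψi
    have hβi : Integrable β (Q' ⊗ₘ k') := integrable_compProd_of_lintegral hβm
      (hle (fun r => ‖β r‖ₑ) fun r => le_add_right le_add_self)
    have hDi : ∀ i, Integrable (fun r => D r i) (Q' ⊗ₘ k') := fun i =>
      integrable_compProd_of_lintegral ((measurable_pi_apply i).comp hD)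
        (hle (fun r => ‖D r i‖ₑ) fun r => le_add_left
          (Finset.single_le_sum (f := fun i => ‖D r i‖ₑ) (fun _ _ => zero_le) (Finset.mem_univ i)))
    have hk'Q : ∀ᵐ x ∂Q', k' x ≪ kQ x ∧
        (∀ i, Integrable (fun y => D (x, y) i) (k' x) ∧ ∫ y, D (x, y) i ∂k' x = 0) ∧
        Integrable (fun y => β (x, y)) (k' x) ∧ b x < ∫ y, β (x, y) ∂k' x ∧
        ∫⁻ y, w (x, y) ∂k' x < ⊤ := hQ'Q.ae_le hk'F
    refine ⟨Q' ⊗ₘ k', inferInstance,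
      Measure.AbsolutelyContinuous.compProd hQ'Q (hk'Q.mono fun x hx => hx.1),
      hMart Q' k' hQ' hk' hM hDi (hk'Q.mono fun x hx i => (hx.2.1 i).2), hβi, ?_, ?_⟩
    · rw [Measure.lintegral_compProd hw]
      exact hle w fun r => le_add_right le_self_add
    · rw [Measure.integral_compProd hβi]
      refine hlt.trans_le (integral_mono_ae hbi (integrable_integral_compProd hβi) ?_)
      exact hk'Q.mono fun x hx => hx.2.2.2.1.le

end Dual

section Directed
variable {X Y : Type*} [TopologicalSpace X] [PolishSpace X] [MeasurableSpace X] [BorelSpace X]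
  [TopologicalSpace Y] [PolishSpace Y] [MeasurableSpace Y] [BorelSpace Y] [Nonempty Y]
  {a : (ℕ → ℕ) → X} {p : Kernel (ℕ → ℕ) Y} [IsMarkovKernel p]
  {Fam : Set (Measure X)} {Fam' : Set (Measure (X × Y))}

omit [Nonempty Y] in
lemma StepFam.exists_section_dominating (h : StepFam a p Fam Fam') {ν : Measure X}
    {k : Kernel X Y} [IsMarkovKernel k] (hk : ∀ᵐ x ∂ν, ∃ z, a z = x ∧ p z = k x) :
    ∃ ζ : X → ℕ → ℕ, UMeas ζ ∧ (∀ x, a (ζ x) = x) ∧ ∀ᵐ x ∂ν, k x ≪ p (ζ x) := by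
  classical
  have hB : MeasurableSet {s : X × (ℕ → ℕ) | a s.2 = s.1 ∧ k s.1 ≪ p s.2} :=
    (isClosed_eq (h.continuous.comp continuous_snd) continuous_fst).measurableSet.inter
      (Kernel.measurableSet_absolutelyContinuous (k.comap Prod.fst measurable_fst)
        (p.comap Prod.snd measurable_snd))
  obtain ⟨r, hr, hri⟩ := exists_uMeas_selection hB.analyticSet
  obtain ⟨ζ₀, hζ₀, hζ₀a⟩ := h.exists_section
  have hE : UMSet {x | a (r x) = x} :=
    ((h.continuous.measurable.comp_uMeas hr).prodMk measurable_id.uMeas)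
      (measurableSet_eq_fun measurable_fst measurable_snd)
  refine ⟨fun x => if x ∈ {x | a (r x) = x} then r x else ζ₀ x, UMeas.ite hE hr hζ₀, fun x => ?_,
    ?_⟩
  · by_cases hx : x ∈ {x | a (r x) = x}
    · exact (congrArg a (if_pos hx)).trans hx
    · exact (congrArg a (if_neg hx)).trans (hζ₀a x)
  · filter_upwards [hk] with x ⟨z, hz, hpz⟩
    have := hri x z ⟨hz, hpz ▸ Measure.AbsolutelyContinuous.rfl⟩
    rw [if_pos (show a (r x) = x from this.1)]
    exact this.2

omit [BorelSpace X] [Nonempty Y] in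
lemma StepFam.exists_section_join (h : StepFam a p Fam Fam') {ζ₁ ζ₂ : X → ℕ → ℕ}
    (h₁ : UMeas ζ₁) (h₂ : UMeas ζ₂) (ha₁ : ∀ x, a (ζ₁ x) = x) (ha₂ : ∀ x, a (ζ₂ x) = x) :
    ∃ ζ : X → ℕ → ℕ, UMeas ζ ∧ (∀ x, a (ζ x) = x) ∧
      ∀ x, p (ζ₁ x) ≪ p (ζ x) ∧ p (ζ₂ x) ≪ p (ζ x) := by
  have : PolishSpace (ℕ → ℕ) := inferInstance
  have : PolishSpace ((ℕ → ℕ) × (ℕ → ℕ)) := inferInstance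
  have hB : MeasurableSet {s : ((ℕ → ℕ) × (ℕ → ℕ)) × (ℕ → ℕ) | a s.2 = a s.1.1 ∧
      p s.1.1 ≪ p s.2 ∧ p s.1.2 ≪ p s.2} :=
    (isClosed_eq (h.continuous.comp continuous_snd)
      (h.continuous.comp (continuous_fst.comp continuous_fst))).measurableSet.inter
      ((Kernel.measurableSet_absolutelyContinuous
        (p.comap (fun s : ((ℕ → ℕ) × (ℕ → ℕ)) × (ℕ → ℕ) => s.1.1)
          (measurable_fst.comp measurable_fst)) (p.comap Prod.snd measurable_snd)).inter
      (Kernel.measurableSet_absolutelyContinuous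
        (p.comap (fun s : ((ℕ → ℕ) × (ℕ → ℕ)) × (ℕ → ℕ) => s.1.2)
          (measurable_snd.comp measurable_fst)) (p.comap Prod.snd measurable_snd)))
  obtain ⟨r, hr, hri⟩ := exists_uMeas_selection hB.analyticSet
  have key : ∀ x, a (r (ζ₁ x, ζ₂ x)) = a (ζ₁ x) ∧ p (ζ₁ x) ≪ p (r (ζ₁ x, ζ₂ x)) ∧
      p (ζ₂ x) ≪ p (r (ζ₁ x, ζ₂ x)) := fun x => by
    obtain ⟨z, hz, hpz⟩ := h.half (ζ₁ x) (ζ₂ x) (by rw [ha₁, ha₂])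
    refine hri (ζ₁ x, ζ₂ x) z ⟨hz, ?_, ?_⟩
    · rw [hpz]
      exact (Measure.absolutelyContinuous_smul (by simp)).add_right _
    · rw [hpz, add_comm]
      exact (Measure.absolutelyContinuous_smul (by simp)).add_right _
  exact ⟨fun x => r (ζ₁ x, ζ₂ x), hr.comp (h₁.prodMk h₂), fun x => (key x).1.trans (ha₁ x),
    fun x => (key x).2⟩

lemma StepFam.directed (h : StepFam a p Fam Fam')
    (hF : ∀ P₁ ∈ Fam, ∀ P₂ ∈ Fam, ∃ P₃ ∈ Fam, P₁ ≪ P₃ ∧ P₂ ≪ P₃) :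
    ∀ P₁ ∈ Fam', ∀ P₂ ∈ Fam', ∃ P₃ ∈ Fam', P₁ ≪ P₃ ∧ P₂ ≪ P₃ := by
  intro P₁ hP₁ P₂ hP₂
  obtain ⟨ν₁, hν₁, k₁, hk₁, rfl, hm₁⟩ := h.disint P₁ hP₁
  obtain ⟨ν₂, hν₂, k₂, hk₂, rfl, hm₂⟩ := h.disint P₂ hP₂
  obtain ⟨ν₃, hν₃, h13, h23⟩ := hF ν₁ hν₁ ν₂ hν₂
  obtain ⟨ζ₁, hζ₁, ha₁, hd₁⟩ := h.exists_section_dominating hm₁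
  obtain ⟨ζ₂, hζ₂, ha₂, hd₂⟩ := h.exists_section_dominating hm₂
  obtain ⟨ζ, hζ, ha, hd⟩ := h.exists_section_join hζ₁ hζ₂ ha₁ ha₂
  have := h.prob ν₁ hν₁
  have := h.prob ν₂ hν₂
  have := h.prob ν₃ hν₃
  obtain ⟨k, hk, hkζ⟩ := exists_kernel_of_uMeas p hζ ν₃
  refine ⟨ν₃ ⊗ₘ k, h.glue ν₃ hν₃ ζ hζ ha k hk hkζ, ?_, ?_⟩
  · refine Measure.AbsolutelyContinuous.compProd h13 ?_
    filter_upwards [hd₁, h13.ae_le hkζ] with x h1 h2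
    rw [← h2]
    exact h1.trans (hd x).1
  · refine Measure.AbsolutelyContinuous.compProd h23 ?_
    filter_upwards [hd₂, h23.ae_le hkζ] with x h1 h2
    rw [← h2]
    exact h1.trans (hd x).2

end Directed

section Models
variable {Ω₁ : Type} [MeasurableSpace Ω₁] [TopologicalSpace Ω₁] [PolishSpace Ω₁]
  [BorelSpace Ω₁] [Nonempty Ω₁]
  {Pt : (t : ℕ) → (Fin t → Ω₁) → Set (ProbabilityMeasure Ω₁)}

lemma exists_kernel_of_selector {X : Type*} [MeasurableSpace X] {κ : X → ProbabilityMeasure Ω₁}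
    (hκ : @Measurable _ _ (univComp X) (borel (ProbabilityMeasure Ω₁)) κ)
    (ν : Measure X) [IsFiniteMeasure ν] :
    ∃ k : Kernel X Ω₁, IsMarkovKernel k ∧ ∀ᵐ x ∂ν, (κ x : Measure Ω₁) = k x := by
  refine exists_kernel_ae_eq (fun _ => inferInstance) ν fun s hs => UMeas.aemeasurable ?_ ν
  have h1 : @Measurable _ _ (borel (ProbabilityMeasure Ω₁)) _
      fun μ : ProbabilityMeasure Ω₁ => (μ : Measure Ω₁) s :=
    (Measure.measurable_coe hs).comp measurable_coe_borel_probabilityMeasure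
  exact h1.comp hκ

lemma measFam_prob (t : ℕ) : ∀ P ∈ MeasFam Ω₁ Pt t, IsProbabilityMeasure P := by
  induction t with
  | zero =>
    rintro P rfl
    infer_instance
  | succ t ih =>
    rintro P ⟨ν, hν, κ, hκ, -, rfl⟩
    have := ih ν hν
    obtain ⟨k, hk, hkν⟩ := exists_kernel_of_selector hκ ν
    rw [bind_map_snoc_eq ν k hkν]
    exact Measure.isProbabilityMeasure_map (snocM Ω₁ t).measurable.aemeasurable

/-- The one-step extensions of the models in `MeasFam`, on the product space. -/
def stepModels (Pt : (t : ℕ) → (Fin t → Ω₁) → Set (ProbabilityMeasure Ω₁)) (t : ℕ) :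
    Set (Measure ((Fin t → Ω₁) × Ω₁)) :=
  {μ | μ.map (snocM Ω₁ t) ∈ MeasFam Ω₁ Pt (t + 1)}

lemma exists_stepFam {t : ℕ} (hne : ∀ ω, (Pt t ω).Nonempty) (hconv : ∀ ω, ConvexPM (Pt t ω))
    (hgraph : AnalyticSet {p : (Fin t → Ω₁) × ProbabilityMeasure Ω₁ | p.2 ∈ Pt t p.1}) :
    ∃ (a : (ℕ → ℕ) → Fin t → Ω₁) (p : Kernel (ℕ → ℕ) Ω₁), IsMarkovKernel p ∧
      StepFam a p (MeasFam Ω₁ Pt t) (stepModels Pt t) := by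
  have ω₀ : Fin t → Ω₁ := fun _ => Classical.arbitrary Ω₁
  rw [AnalyticSet] at hgraph
  rcases hgraph with h0 | ⟨q, hq, hqr⟩
  · obtain ⟨μ, hμ⟩ := hne ω₀
    have : (ω₀, μ) ∈ (∅ : Set ((Fin t → Ω₁) × ProbabilityMeasure Ω₁)) := h0 ▸ hμ
    exact this.elim
  have hqm : ∀ z, (q z).2 ∈ Pt t (q z).1 := fun z => by
    have : q z ∈ range q := ⟨z, rfl⟩
    rw [hqr] at this
    exact this
  have hqs : ∀ ω, ∀ μ ∈ Pt t ω, ∃ z, q z = (ω, μ) := fun ω μ hμ => by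
    have : (ω, μ) ∈ range q := hqr ▸ hμ
    exact this
  have hp2 : @Measurable _ _ _ (borel (ProbabilityMeasure Ω₁)) fun z => (q z).2 := by
    borelize (ProbabilityMeasure Ω₁)
    exact (continuous_snd.comp hq).measurable
  have hpm : Measurable fun z => ((q z).2 : Measure Ω₁) :=
    measurable_coe_borel_probabilityMeasure.comp hp2
  have hmk : IsMarkovKernel (⟨fun z => ((q z).2 : Measure Ω₁), hpm⟩ : Kernel (ℕ → ℕ) Ω₁) :=
    ⟨fun z => inferInstanceAs (IsProbabilityMeasure ((q z).2 : Measure Ω₁))⟩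
  refine ⟨fun z => (q z).1, ⟨fun z => ((q z).2 : Measure Ω₁), hpm⟩, hmk, continuous_fst.comp hq,
    ?_, ?_, measFam_prob t, ?_, ?_⟩
  · intro ω
    obtain ⟨μ, hμ⟩ := hne ω
    obtain ⟨z, hz⟩ := hqs ω μ hμ
    exact ⟨z, by simp [hz]⟩
  · intro z₁ z₂ h12
    have hpr : IsProbabilityMeasure ((2⁻¹ : ℝ≥0∞) • ((q z₁).2 : Measure Ω₁) +
        (2⁻¹ : ℝ≥0∞) • ((q z₂).2 : Measure Ω₁)) := ⟨by simp [ENNReal.inv_two_add_inv_two]⟩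
    obtain ⟨z, hz⟩ := hqs (q z₁).1 ⟨_, hpr⟩ (hconv (q z₁).1 _ (hqm z₁) (q z₂).2
      (by have := hqm z₂; rwa [← show (q z₁).1 = (q z₂).1 from h12] at this) 2⁻¹ 2⁻¹
      ENNReal.inv_two_add_inv_two _ rfl)
    refine ⟨z, by simp [hz], ?_⟩
    change ((q z).2 : Measure Ω₁) = _
    rw [hz]
    rfl
  · rintro μ ⟨ν, hν, κ, hκ, hκP, hμ⟩
    have := measFam_prob t ν hν
    obtain ⟨k, hk, hkν⟩ := exists_kernel_of_selector hκ ν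
    rw [bind_map_snoc_eq ν k hkν] at hμ
    refine ⟨ν, hν, k, hk, (snocM Ω₁ t).map_measurableEquiv_injective hμ, ?_⟩
    filter_upwards [hkν] with ω hω
    obtain ⟨z, hz⟩ := hqs ω _ (hκP ω)
    refine ⟨z, by simp [hz], ?_⟩
    change ((q z).2 : Measure Ω₁) = _
    rw [hz, ← hω]
  · intro ν hν ζ hζ hζa k hk hkζ
    have := measFam_prob t ν hν
    refine ⟨ν, hν, fun ω => (q (ζ ω)).2, hp2.comp hζ, fun ω => ?_, ?_⟩
    · have := hqm (ζ ω)
      rwa [show (q (ζ ω)).1 = ω from hζa ω] at this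
    · exact (bind_map_snoc_eq ν k hkζ).symm

lemma measFam_directed {T : ℕ} (hne : ∀ t, t < T → ∀ ω, (Pt t ω).Nonempty)
    (hconv : ∀ t, t < T → ∀ ω, ConvexPM (Pt t ω))
    (hgraph : ∀ t, t < T →
      AnalyticSet {p : (Fin t → Ω₁) × ProbabilityMeasure Ω₁ | p.2 ∈ Pt t p.1}) :
    ∀ t ≤ T, ∀ P₁ ∈ MeasFam Ω₁ Pt t, ∀ P₂ ∈ MeasFam Ω₁ Pt t, ∃ P₃ ∈ MeasFam Ω₁ Pt t,
      P₁ ≪ P₃ ∧ P₂ ≪ P₃ := by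
  intro t
  induction t with
  | zero =>
    rintro - P₁ rfl P₂ rfl
    exact ⟨_, rfl, Measure.AbsolutelyContinuous.rfl, Measure.AbsolutelyContinuous.rfl⟩
  | succ t ih =>
    intro ht P₁ hP₁ P₂ hP₂
    obtain ⟨a, p, hp, h⟩ := exists_stepFam (hne t ht) (hconv t ht) (hgraph t ht)
    have hs : ∀ P ∈ MeasFam Ω₁ Pt (t + 1), P.map (snocM Ω₁ t).symm ∈ stepModels Pt t :=
      fun P hP => by
        change (P.map (snocM Ω₁ t).symm).map (snocM Ω₁ t) ∈ MeasFam Ω₁ Pt (t + 1)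
        rwa [MeasurableEquiv.map_map_symm]
    obtain ⟨μ, hμ, h1, h2⟩ := h.directed (ih (by omega)) _ (hs P₁ hP₁) _ (hs P₂ hP₂)
    have h1' := h1.map (snocM Ω₁ t).measurable
    have h2' := h2.map (snocM Ω₁ t).measurable
    rw [MeasurableEquiv.map_map_symm] at h1' h2'
    exact ⟨_, hμ, h1', h2'⟩

end Models

section Mart
variable {Ω₁ : Type} [MeasurableSpace Ω₁] {d : ℕ} {S : (t : ℕ) → (Fin t → Ω₁) → Fin d → ℝ}

/-- The martingale property in terms of the marginals on the path spaces and Borel sets. -/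
lemma isMartMeas_iff_map {T : ℕ} (hS : ∀ t ≤ T, Measurable (S t)) (Q : Measure (Fin T → Ω₁))
    [IsProbabilityMeasure Q] : IsMartMeas Ω₁ S Q ↔
    (∀ (t : ℕ) (h : t ≤ T) (i : Fin d), Integrable (fun ω => S t ω i) (Q.map (restr Ω₁ t h))) ∧
    ∀ (t : ℕ) (h : t + 1 ≤ T) (i : Fin d) (B : Set (Fin t → Ω₁)), MeasurableSet B →
      ∫ ω in restr Ω₁ t t.le_succ ⁻¹' B, S (t + 1) ω i ∂Q.map (restr Ω₁ (t + 1) h) =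
        ∫ ω in B, S t ω i ∂Q.map (restr Ω₁ t (t.le_succ.trans h)) := by
  have hSi : ∀ t ≤ T, ∀ i, Measurable fun ω => S t ω i := fun t ht i =>
    (measurable_pi_apply i).comp (hS t ht)
  refine and_congr ?_ ?_
  · refine forall_congr' fun t => forall_congr' fun h => forall_congr' fun i => ?_
    exact (integrable_map_measure (hSi t h i).aestronglyMeasurable
      (measurable_restr h).aemeasurable).symm
  · refine forall_congr' fun t => forall_congr' fun h => forall_congr' fun i => ?_
    have e1 : ∀ B : Set (Fin t → Ω₁), MeasurableSet B →
        ∫ ω in restr Ω₁ t t.le_succ ⁻¹' B, S (t + 1) ω i ∂Q.map (restr Ω₁ (t + 1) h) =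
          ∫ ω in restr Ω₁ t (t.le_succ.trans h) ⁻¹' B, S (t + 1) (restr Ω₁ (t + 1) h ω) i ∂Q :=
      fun B hB => setIntegral_map (measurable_restr _ hB) (hSi _ h i).aestronglyMeasurable
        (measurable_restr h).aemeasurable
    have e2 : ∀ B : Set (Fin t → Ω₁), MeasurableSet B →
        ∫ ω in B, S t ω i ∂Q.map (restr Ω₁ t (t.le_succ.trans h)) =
          ∫ ω in restr Ω₁ t (t.le_succ.trans h) ⁻¹' B,
            S t (restr Ω₁ t (t.le_succ.trans h) ω) i ∂Q :=
      fun B hB => setIntegral_map hB (hSi _ (t.le_succ.trans h) i).aestronglyMeasurable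
        (measurable_restr _).aemeasurable
    constructor
    · intro H B hB
      rw [e1 B hB, e2 B hB]
      exact H _ ⟨B, hB.umSet, rfl⟩
    · rintro H A ⟨B, hB, rfl⟩
      have hp : IsProbabilityMeasure (Q.map (restr Ω₁ t (t.le_succ.trans h))) :=
        Measure.isProbabilityMeasure_map (measurable_restr _).aemeasurable
      obtain ⟨B', -, hB', hBB'⟩ := (UMSet.nullMeasurableSet hB
        (Q.map (restr Ω₁ t (t.le_succ.trans h)))).exists_measurable_superset_ae_eq
      have hA : restr Ω₁ t (t.le_succ.trans h) ⁻¹' B =ᵐ[Q] restr Ω₁ t (t.le_succ.trans h) ⁻¹' B' :=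
        ae_of_ae_map (measurable_restr (t.le_succ.trans h)).aemeasurable hBB'.symm
      rw [setIntegral_congr_set hA, setIntegral_congr_set hA, ← e1 B' hB', ← e2 B' hB']
      exact H B' hB'

variable [TopologicalSpace Ω₁] [PolishSpace Ω₁] [BorelSpace Ω₁] [Nonempty Ω₁]

omit [Nonempty Ω₁] in
lemma measurable_incr {t : ℕ} (h0 : Measurable (S t)) (h1 : Measurable (S (t + 1))) :
    Measurable fun q : (Fin t → Ω₁) × Ω₁ => incr Ω₁ S t q.1 q.2 :=
  measurable_pi_iff.2 fun i =>
    ((measurable_pi_apply i).comp (h1.comp (snocM Ω₁ t).measurable)).sub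
      ((measurable_pi_apply i).comp (h0.comp measurable_fst))

omit [Nonempty Ω₁] in
lemma isMartMeas_map_snoc_iff {t : ℕ} (hS : ∀ s ≤ t + 1, Measurable (S s))
    (ν : Measure (Fin t → Ω₁)) [IsProbabilityMeasure ν] (k : Kernel (Fin t → Ω₁) Ω₁)
    [IsMarkovKernel k] : IsMartMeas Ω₁ S ((ν ⊗ₘ k).map (snocM Ω₁ t)) ↔
    IsMartMeas Ω₁ S ν ∧ (∀ i, Integrable (fun q => incr Ω₁ S t q.1 q.2 i) (ν ⊗ₘ k)) ∧
      ∀ᵐ ω ∂ν, ∀ i, ∫ x, incr Ω₁ S t ω x i ∂k ω = 0 := by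
  have hμ : IsProbabilityMeasure ((ν ⊗ₘ k).map (snocM Ω₁ t)) :=
    Measure.isProbabilityMeasure_map (snocM Ω₁ t).measurable.aemeasurable
  have hm : ∀ s (h : s ≤ t), ((ν ⊗ₘ k).map (snocM Ω₁ t)).map (restr Ω₁ s (h.trans t.le_succ)) =
      ν.map (restr Ω₁ s h) := fun s h => by
    rw [Measure.map_map (measurable_restr _) (snocM Ω₁ t).measurable]
    have : restr Ω₁ s (h.trans t.le_succ) ∘ snocM Ω₁ t = restr Ω₁ s h ∘ Prod.fst := by
      ext q i
      exact Fin.snoc_castSucc (α := fun _ => Ω₁) q.2 q.1 (Fin.castLE h i)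
    rw [this, ← Measure.map_map (measurable_restr _) measurable_fst]
    congr 1
    exact Measure.fst_compProd ν k
  have hid : ∀ (s : ℕ) (μ : Measure (Fin s → Ω₁)), μ.map (restr Ω₁ s le_rfl) = μ := fun s μ =>
    Measure.map_id
  have hSi : ∀ s ≤ t + 1, ∀ i, Measurable fun ω => S s ω i := fun s hs i =>
    (measurable_pi_apply i).comp (hS s hs)
  have hDi : ∀ i, Measurable fun q : (Fin t → Ω₁) × Ω₁ => incr Ω₁ S t q.1 q.2 i := fun i =>
    (measurable_pi_apply i).comp (measurable_incr (hS t t.le_succ) (hS _ le_rfl))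
  have hfst : ∀ i, Integrable (fun ω => S t ω i) ν →
      Integrable (fun q : (Fin t → Ω₁) × Ω₁ => S t q.1 i) (ν ⊗ₘ k) := fun i hi => by
    have : Integrable (fun ω => S t ω i) ((ν ⊗ₘ k).map Prod.fst) := by
      rwa [show (ν ⊗ₘ k).map Prod.fst = ν from Measure.fst_compProd ν k]
    exact this.comp_measurable measurable_fst
  have hintg : ∀ i, Integrable (fun ω => S t ω i) ν →
      (Integrable (fun ω => S (t + 1) ω i) ((ν ⊗ₘ k).map (snocM Ω₁ t)) ↔
        Integrable (fun q => incr Ω₁ S t q.1 q.2 i) (ν ⊗ₘ k)) := fun i hi => by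
    rw [integrable_map_measure (hSi _ le_rfl i).aestronglyMeasurable
      (snocM Ω₁ t).measurable.aemeasurable]
    constructor
    · exact fun H => H.sub (hfst i hi)
    · intro H
      refine (H.add (hfst i hi)).congr (ae_of_all _ fun q => ?_)
      simp [incr, snocM_apply]
  have hset : ∀ i, Integrable (fun ω => S t ω i) ν →
      Integrable (fun q => incr Ω₁ S t q.1 q.2 i) (ν ⊗ₘ k) → ∀ B : Set (Fin t → Ω₁),
      MeasurableSet B →
      ∫ ω in restr Ω₁ t t.le_succ ⁻¹' B, S (t + 1) ω i ∂(ν ⊗ₘ k).map (snocM Ω₁ t) =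
        ∫ ω in B, S t ω i ∂ν + ∫ ω in B, ∫ x, incr Ω₁ S t ω x i ∂k ω ∂ν := by
    intro i h1 h2 B hB
    rw [setIntegral_map (measurable_restr _ hB) (hSi _ le_rfl i).aestronglyMeasurable
      (snocM Ω₁ t).measurable.aemeasurable]
    have hpre : snocM Ω₁ t ⁻¹' (restr Ω₁ t t.le_succ ⁻¹' B) = B ×ˢ univ := by
      ext q
      have : restr Ω₁ t t.le_succ (snocM Ω₁ t q) = q.1 := by
        ext i
        exact Fin.snoc_castSucc (α := fun _ => Ω₁) q.2 q.1 i
      simp [this]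
    have hsum : ∀ q : (Fin t → Ω₁) × Ω₁, S (t + 1) (snocM Ω₁ t q) i =
        S t q.1 i + incr Ω₁ S t q.1 q.2 i := fun q => by simp [incr, snocM_apply]
    rw [hpre]
    simp only [hsum]
    rw [integral_add (hfst i h1).integrableOn h2.integrableOn,
      Measure.setIntegral_compProd hB MeasurableSet.univ (hfst i h1).integrableOn,
      Measure.setIntegral_compProd hB MeasurableSet.univ h2.integrableOn]
    simp
  rw [isMartMeas_iff_map hS, isMartMeas_iff_map fun s hs => hS s (hs.trans t.le_succ)]
  constructor
  · rintro ⟨h1, h2⟩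
    have h1' : ∀ (s : ℕ) (h : s ≤ t) (i : Fin d), Integrable (fun ω => S s ω i)
        (ν.map (restr Ω₁ s h)) := fun s h i => by
      rw [← hm s h]
      exact h1 s _ i
    have ht : ∀ i, Integrable (fun ω => S t ω i) ν := fun i => by
      have := h1' t le_rfl i
      rwa [hid] at this
    have hD : ∀ i, Integrable (fun q => incr Ω₁ S t q.1 q.2 i) (ν ⊗ₘ k) := fun i => by
      have := h1 (t + 1) le_rfl i
      rwa [hid, hintg i (ht i)] at this
    refine ⟨⟨h1', fun s h i B hB => ?_⟩, hD, ?_⟩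
    · have := h2 s (h.trans t.le_succ) i B hB
      rwa [hm (s + 1) h, hm s] at this
    · refine ae_all_iff.2 fun i => ?_
      refine ae_eq_zero_of_forall_setIntegral_eq_of_sigmaFinite
        (fun s _ _ => (integrable_integral_compProd (hD i)).integrableOn) fun B hB _ => ?_
      have := h2 t le_rfl i B hB
      rw [hid, hset i (ht i) (hD i) B hB, hm t le_rfl, hid] at this
      linarith
  · rintro ⟨⟨h1, h2⟩, hD, h0⟩
    have ht : ∀ i, Integrable (fun ω => S t ω i) ν := fun i => by
      have := h1 t le_rfl i
      rwa [hid] at this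
    refine ⟨fun s h i => ?_, fun s h i B hB => ?_⟩
    · rcases Nat.lt_or_eq_of_le h with h' | rfl
      · rw [hm s (by omega)]
        exact h1 s _ i
      · rw [hid, hintg i (ht i)]
        exact hD i
    · rcases Nat.lt_or_eq_of_le h with h' | h'
      · rw [hm (s + 1) (by omega), hm s (by omega)]
        exact h2 s (by omega) i B hB
      · obtain rfl : s = t := by omega
        rw [hid, hset i (ht i) (hD i) B hB, hm s le_rfl, hid]
        rw [setIntegral_congr_ae (g := fun _ => 0) hB (h0.mono fun ω hω _ => hω i)]
        simp

lemma exists_disintegration {t : ℕ} (Q : Measure (Fin (t + 1) → Ω₁)) [IsProbabilityMeasure Q] :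
    ∃ (ν : Measure (Fin t → Ω₁)) (k : Kernel (Fin t → Ω₁) Ω₁), IsProbabilityMeasure ν ∧
      IsMarkovKernel k ∧ Q = (ν ⊗ₘ k).map (snocM Ω₁ t) := by
  have : IsProbabilityMeasure (Q.map (snocM Ω₁ t).symm) :=
    Measure.isProbabilityMeasure_map (snocM Ω₁ t).symm.measurable.aemeasurable
  refine ⟨(Q.map (snocM Ω₁ t).symm).fst, (Q.map (snocM Ω₁ t).symm).condKernel, inferInstance,
    inferInstance, ?_⟩
  rw [Measure.disintegrate, MeasurableEquiv.map_map_symm]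

/-- Superhedging strategies are at least as expensive as martingale expectations. -/
lemma integral_le_of_le_gain {t : ℕ} (hS : ∀ s ≤ t, Measurable (S s)) {Q : Measure (Fin t → Ω₁)}
    [hQ : IsProbabilityMeasure Q] (hM : IsMartMeas Ω₁ S Q)
    (H : (u : ℕ) → (Fin u → Ω₁) → Fin d → ℝ) {F : (Fin t → Ω₁) → ℝ} (hF : Integrable F Q) {x : ℝ}
    (h : ∀ᵐ ω ∂Q, F ω ≤ x + gain Ω₁ S H t le_rfl ω) : ∫ ω, F ω ∂Q ≤ x := by
  induction t with
  | zero =>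
    have : ∫ ω, F ω ∂Q ≤ ∫ _, x ∂Q := by
      refine integral_mono_ae hF (integrable_const x) (h.mono fun ω hω => ?_)
      simpa [gain] using hω
    simpa using this
  | succ t ih =>
    obtain ⟨ν, k, hν, hk, rfl⟩ := exists_disintegration Q
    obtain ⟨hMν, hD, h0⟩ := (isMartMeas_map_snoc_iff hS ν k).1 hM
    have hF' : Integrable (fun q => F (snocM Ω₁ t q)) (ν ⊗ₘ k) :=
      hF.comp_measurable (snocM Ω₁ t).measurable
    have h' := Measure.ae_ae_of_ae_compProd
      (ae_of_ae_map (snocM Ω₁ t).measurable.aemeasurable h)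
    rw [MeasurableEmbedding.integral_map (snocM Ω₁ t).measurableEmbedding,
      Measure.integral_compProd hF']
    refine ih (fun s hs => hS s (hs.trans t.le_succ)) hMν (integrable_integral_compProd hF') ?_
    have hDk : ∀ᵐ ω ∂ν, ∀ i, Integrable (fun x => incr Ω₁ S t ω x i) (k ω) :=
      ae_all_iff.2 fun i => ((Measure.integrable_compProd_iff (hD i).1).1 (hD i)).1
    filter_upwards [h', h0, hDk, ((Measure.integrable_compProd_iff hF'.1).1 hF').1]
      with ω h1 h2 h3 h4
    have hsum : Integrable (fun y => ∑ i, H t ω i * incr Ω₁ S t ω y i) (k ω) :=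
      integrable_finsetSum _ fun i _ => (h3 i).const_mul _
    calc ∫ y, F (snocM Ω₁ t (ω, y)) ∂k ω
        ≤ ∫ y, ((x + gain Ω₁ S H t le_rfl ω) + ∑ i, H t ω i * incr Ω₁ S t ω y i) ∂k ω := by
          refine integral_mono_ae h4 ((integrable_const _).add hsum) (h1.mono fun y hy => ?_)
          have := gain_succ S H t ω y
          simp only [snocM_apply] at hy ⊢
          rw [this] at hy
          linarith
      _ = x + gain Ω₁ S H t le_rfl ω := by
          rw [integral_add (integrable_const _) hsum, integral_finsetSum _ fun i _ =>
            (h3 i).const_mul _]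
          simp [integral_const_mul, h2]

end Mart

section Induction
variable {Ω₁ : Type} [MeasurableSpace Ω₁] [TopologicalSpace Ω₁] [PolishSpace Ω₁]
  [BorelSpace Ω₁] [Nonempty Ω₁] {d : ℕ}
  {Pt : (t : ℕ) → (Fin t → Ω₁) → Set (ProbabilityMeasure Ω₁)}
  {S : (t : ℕ) → (Fin t → Ω₁) → Fin d → ℝ}

/-- Absence of arbitrage in the stocks up to time `t`. -/
def NAStock (Pt : (t : ℕ) → (Fin t → Ω₁) → Set (ProbabilityMeasure Ω₁))
    (S : (t : ℕ) → (Fin t → Ω₁) → Fin d → ℝ) (t : ℕ) : Prop :=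
  ∀ H, Pred Ω₁ d H → (∀ P ∈ MeasFam Ω₁ Pt t, ∀ᵐ ω ∂P, 0 ≤ gain Ω₁ S H t le_rfl ω) →
    ∀ P ∈ MeasFam Ω₁ Pt t, ∀ᵐ ω ∂P, gain Ω₁ S H t le_rfl ω = 0

omit [Nonempty Ω₁] in
lemma ae_measFam_succ_iff {t : ℕ} {r : (Fin (t + 1) → Ω₁) → Prop} :
    (∀ P ∈ MeasFam Ω₁ Pt (t + 1), ∀ᵐ ω ∂P, r ω) ↔
      ∀ μ ∈ stepModels Pt t, ∀ᵐ q ∂μ, r (snocM Ω₁ t q) := by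
  constructor
  · exact fun h μ hμ => ((snocM Ω₁ t).measurableEmbedding.ae_map_iff).1 (h _ hμ)
  · intro h P hP
    have : P = (P.map (snocM Ω₁ t).symm).map (snocM Ω₁ t) := by
      rw [MeasurableEquiv.map_map_symm]
    rw [this]
    refine ((snocM Ω₁ t).measurableEmbedding.ae_map_iff).2 (h _ ?_)
    change (P.map (snocM Ω₁ t).symm).map (snocM Ω₁ t) ∈ MeasFam Ω₁ Pt (t + 1)
    rwa [← this]

omit [Nonempty Ω₁] in
lemma gain_update (H : (u : ℕ) → (Fin u → Ω₁) → Fin d → ℝ) (t : ℕ) (η : (Fin t → Ω₁) → Fin d → ℝ)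
    (q : (Fin t → Ω₁) × Ω₁) :
    gain Ω₁ S (Function.update H t η) (t + 1) le_rfl (snocM Ω₁ t q) =
      gain Ω₁ S H t le_rfl q.1 + ∑ i, η q.1 i * incr Ω₁ S t q.1 q.2 i := by
  rw [snocM_apply, gain_succ, Function.update_self]
  congr 1
  unfold gain
  refine Finset.sum_congr rfl fun u _ => ?_
  rw [Function.update_of_ne u.2.ne]

omit [TopologicalSpace Ω₁] [PolishSpace Ω₁] [BorelSpace Ω₁] [Nonempty Ω₁] in
lemma pred_update {H : (u : ℕ) → (Fin u → Ω₁) → Fin d → ℝ} (hH : Pred Ω₁ d H) {t : ℕ}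
    {η : (Fin t → Ω₁) → Fin d → ℝ} (hη : UMeas η) : Pred Ω₁ d (Function.update H t η) := by
  intro u
  by_cases hu : u = t
  · subst hu
    rw [Function.update_self]
    exact hη
  · rw [Function.update_of_ne hu]
    exact hH u

omit [TopologicalSpace Ω₁] [PolishSpace Ω₁] [BorelSpace Ω₁] [Nonempty Ω₁] in
lemma pred_zero : Pred Ω₁ d fun _ _ => 0 := fun _ => @measurable_const _ _ _ (univComp _) _

omit [MeasurableSpace Ω₁] [TopologicalSpace Ω₁] [PolishSpace Ω₁] [BorelSpace Ω₁] [Nonempty Ω₁] in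
lemma gain_zero (t : ℕ) (ω : Fin t → Ω₁) : gain Ω₁ S (fun _ _ => 0) t le_rfl ω = 0 := by
  simp [gain]

omit [Nonempty Ω₁] in
lemma StepFam.ae_fst {t : ℕ} {a : (ℕ → ℕ) → Fin t → Ω₁} {p : Kernel (ℕ → ℕ) Ω₁}
    (h : StepFam a p (MeasFam Ω₁ Pt t) (stepModels Pt t)) {r : (Fin t → Ω₁) → Prop}
    (hr : ∀ P ∈ MeasFam Ω₁ Pt t, ∀ᵐ ω ∂P, r ω) : ∀ μ ∈ stepModels Pt t, ∀ᵐ q ∂μ, r q.1 := by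
  intro μ hμ
  obtain ⟨ν, hν, k, hk, rfl, -⟩ := h.disint μ hμ
  have := h.prob ν hν
  have h1 : ∀ᵐ ω ∂(ν ⊗ₘ k).map Prod.fst, r ω := by
    rw [show (ν ⊗ₘ k).map Prod.fst = ν from Measure.fst_compProd ν k]
    exact hr ν hν
  exact ae_of_ae_map measurable_fst.aemeasurable h1

lemma StepFam.naStock {t : ℕ} {a : (ℕ → ℕ) → Fin t → Ω₁} {p : Kernel (ℕ → ℕ) Ω₁}
    [IsMarkovKernel p] (h : StepFam a p (MeasFam Ω₁ Pt t) (stepModels Pt t))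
    (hNA : NAStock Pt S (t + 1)) : NAStock Pt S t := by
  intro H hH h0 P hP
  have h1 := hNA _ (pred_update (t := t) hH (uMeas_const 0)) (ae_measFam_succ_iff.2 (by
    intro μ hμ
    filter_upwards [h.ae_fst h0 μ hμ] with q hq
    rw [gain_update]
    simpa using hq))
  rw [ae_measFam_succ_iff] at h1
  have := h.prob P hP
  obtain ⟨ζ, hζ, hζa⟩ := h.exists_section
  obtain ⟨k, hk, hkζ⟩ := exists_kernel_of_uMeas p hζ P
  filter_upwards [Measure.ae_ae_of_ae_compProd (h1 _ (h.glue P hP ζ hζ hζa k hk hkζ))] with ω hω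
  obtain ⟨y, hy⟩ := hω.exists
  rw [gain_update] at hy
  simpa using hy

omit [Nonempty Ω₁] in
lemma dualAbove_of_stepModels {t : ℕ} {v : (Fin (t + 1) → Ω₁) → EReal} {c : ℝ}
    (h : DualAbove (stepModels Pt t) (fun μ => IsMartMeas Ω₁ S (μ.map (snocM Ω₁ t)))
      (fun q => v (snocM Ω₁ t q)) c) :
    DualAbove (MeasFam Ω₁ Pt (t + 1)) (IsMartMeas Ω₁ S) v c := by
  obtain ⟨P, hP, Q, hQ, hQP, b, hb, hbv, hd⟩ := h
  have hm := (snocM Ω₁ t).measurable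
  have he := (snocM Ω₁ t).measurableEmbedding
  have hbs : ∀ q, b ((snocM Ω₁ t).symm (snocM Ω₁ t q)) = b q := fun q => by simp
  refine ⟨P.map (snocM Ω₁ t), hP, Q.map (snocM Ω₁ t),
    Measure.isProbabilityMeasure_map hm.aemeasurable, hQP.map hm, b ∘ (snocM Ω₁ t).symm,
    hb.comp (snocM Ω₁ t).symm.measurable, ?_, ?_⟩
  · rw [he.ae_map_iff]
    filter_upwards [hbv] with q hq
    simpa using hq
  · intro w hw hwf
    obtain ⟨Q', hQ', hQQ, hM, hbi, hwi, hc⟩ := hd (fun q => w (snocM Ω₁ t q)) (hw.comp hm)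
      (he.ae_map_iff.1 hwf)
    refine ⟨Q'.map (snocM Ω₁ t), Measure.isProbabilityMeasure_map hm.aemeasurable, hQQ.map hm, hM,
      ?_, ?_, ?_⟩
    · rw [he.integrable_map_iff]
      refine hbi.congr (ae_of_all _ fun q => (hbs q).symm)
    · rwa [lintegral_map hw hm]
    · rw [he.integral_map]
      simpa using hc

/-- Either the price `c` allows superhedging `v`, or some martingale expectation exceeds `c`. -/
theorem hedge_or_dualAbove {T : ℕ} (hne : ∀ t, t < T → ∀ ω, (Pt t ω).Nonempty)
    (hconv : ∀ t, t < T → ∀ ω, ConvexPM (Pt t ω))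
    (hgraph : ∀ t, t < T →
      AnalyticSet {p : (Fin t → Ω₁) × ProbabilityMeasure Ω₁ | p.2 ∈ Pt t p.1})
    (hS : ∀ t, t ≤ T → Measurable (S t)) (c : ℝ) : ∀ t ≤ T, NAStock Pt S t →
    ∀ v : (Fin t → Ω₁) → EReal, UpperSemianalyticE v →
    (∀ P ∈ MeasFam Ω₁ Pt t, ∀ᵐ ω ∂P, ⊥ < v ω) →
    (∃ H, Pred Ω₁ d H ∧
      ∀ P ∈ MeasFam Ω₁ Pt t, ∀ᵐ ω ∂P, v ω ≤ ((c + gain Ω₁ S H t le_rfl ω : ℝ) : EReal)) ∨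
    DualAbove (MeasFam Ω₁ Pt t) (IsMartMeas Ω₁ S) v c := by
  intro t
  induction t with
  | zero =>
    intro _ _ v _ _
    have hω : ∀ ω : Fin 0 → Ω₁, ω = Fin.elim0 := fun ω => Subsingleton.elim _ _
    rcases le_or_gt (v Fin.elim0) c with hc | hc
    · refine Or.inl ⟨fun _ _ => 0, pred_zero, fun P _ => ae_of_all _ fun ω => ?_⟩
      rw [gain_zero, hω ω]
      simpa using hc
    · obtain ⟨b, hcb, hbv⟩ := EReal.lt_iff_exists_real_btwn.1 hc
      refine Or.inr ⟨_, rfl, Measure.dirac Fin.elim0, inferInstance,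
        Measure.AbsolutelyContinuous.rfl, fun _ => b, measurable_const,
        ae_of_all _ fun ω => (hω ω).symm ▸ hbv, fun w hw hwf => ⟨Measure.dirac Fin.elim0,
          inferInstance, Measure.AbsolutelyContinuous.rfl, ⟨?_, ?_⟩, integrable_const b, ?_, ?_⟩⟩
      · intro s hs i
        refine (integrable_const (S s (restr Ω₁ s hs Fin.elim0) i)).congr (ae_of_all _ fun ω => ?_)
        rw [hω ω]
      · intro s hs
        omega
      · rw [lintegral_dirac' _ hw]
        obtain ⟨ω, h⟩ := hwf.exists
        rwa [hω ω] at h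
      · simpa using hcb
  | succ t ih =>
    intro ht hNA v hvu hv
    obtain ⟨a, p, hp, h⟩ := exists_stepFam (hne t ht) (hconv t ht) (hgraph t ht)
    have hvu' : UpperSemianalyticE fun q => v (snocM Ω₁ t q) :=
      hvu.comp_continuous (snocH Ω₁ t).continuous
    have hD := measurable_incr (hS t (by omega)) (hS (t + 1) ht)
    rw [ae_measFam_succ_iff] at hv
    obtain ⟨hbot, η, hη, hηv⟩ := h.exists_hedge (D := fun q => incr Ω₁ S t q.1 q.2) hD hvu' hv (by
      intro η hη h0
      have := hNA _ (pred_update pred_zero hη) (ae_measFam_succ_iff.2 (by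
        intro μ hμ
        filter_upwards [h0 μ hμ] with q hq
        rw [gain_update, gain_zero]
        simpa using hq))
      rw [ae_measFam_succ_iff] at this
      intro μ hμ
      filter_upwards [this μ hμ] with q hq
      rw [gain_update, gain_zero] at hq
      simpa using hq)
    rcases ih (by omega) (h.naStock hNA) _ (upperSemianalyticE_condSup h.continuous hD hvu') hbot
      with ⟨H, hH, hHv⟩ | hdual
    · refine Or.inl ⟨_, pred_update hH hη, ae_measFam_succ_iff.2 fun μ hμ => ?_⟩
      filter_upwards [h.ae_fst hHv μ hμ, hηv μ hμ] with q h1 h2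
      have := h2 _ h1
      rw [gain_update, ← add_assoc]
      exact this
    · refine Or.inr (dualAbove_of_stepModels (h.dualAbove hD hvu' ?_ hdual))
      intro ν k hν hk hM hDi h0
      exact (isMartMeas_map_snoc_iff (fun s hs => hS s (hs.trans ht)) ν k).2 ⟨hM, hDi, h0⟩

end Induction

lemma expec_eq_integral {X : Type*} [MeasurableSpace X] {Q : Measure X} {f : X → ℝ}
    (hf : Integrable f Q) : expec Q f = ((∫ x, f x ∂Q : ℝ) : EReal) := by
  have h1 : ∫⁻ x, ENNReal.ofReal (f x) ∂Q ≠ ⊤ := hf.lintegral_lt_top.ne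
  have h2 : ∫⁻ x, ENNReal.ofReal (-f x) ∂Q ≠ ⊤ := hf.neg.lintegral_lt_top.ne
  rw [integral_eq_lintegral_pos_part_sub_lintegral_neg_part hf, expec, EReal.coe_sub,
    EReal.coe_ennreal_toReal h1, EReal.coe_ennreal_toReal h2]

section USAReal
variable {X : Type*} [TopologicalSpace X] [PolishSpace X] [MeasurableSpace X] [BorelSpace X]

omit [PolishSpace X] [MeasurableSpace X] [BorelSpace X] in
lemma UpperSemianalytic.coe {f : X → ℝ} (hf : UpperSemianalytic f) :
    UpperSemianalyticE fun x => (f x : EReal) := fun c => by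
  simpa only [EReal.coe_lt_coe_iff] using hf c

lemma UpperSemianalytic.uMeas {f : X → ℝ} (hf : UpperSemianalytic f) : UMeas f :=
  @measurable_of_Ioi _ _ _ _ _ (univComp X) _ _ _ _ fun c => (hf c).umSet

lemma UpperSemianalytic.sub_measurable {f k : X → ℝ} (hf : UpperSemianalytic f)
    (hk : Measurable k) : UpperSemianalytic fun x => f x - k x := fun c => by
  have : {x | c < f x - k x} = ⋃ q : ℚ, {x | (q : ℝ) < f x} ∩ {x | k x < q - c} := by
    ext x
    simp only [mem_iUnion]
    constructor
    · intro h
      obtain ⟨q, h1, h2⟩ := exists_rat_btwn (show k x + c < f x from by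
        have : c < f x - k x := h
        linarith)
      exact ⟨q, h2, show k x < q - c by linarith⟩
    · rintro ⟨q, h1, h2⟩
      have h1 : (q : ℝ) < f x := h1
      have h2 : k x < q - c := h2
      show c < f x - k x
      linarith
  rw [this]
  exact AnalyticSet.iUnion fun q => (hf q).inter
    (measurableSet_lt hk measurable_const).analyticSet

lemma upperSemianalytic_of_measurable {f : X → ℝ} (hf : Measurable f) : UpperSemianalytic f :=
  fun _ => (measurableSet_lt measurable_const hf).analyticSet

end USAReal

section Options
variable {Ω₁ : Type} [MeasurableSpace Ω₁] [TopologicalSpace Ω₁] [PolishSpace Ω₁]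
  [BorelSpace Ω₁] [Nonempty Ω₁] {T d e : ℕ}
  {Pt : (t : ℕ) → (Fin t → Ω₁) → Set (ProbabilityMeasure Ω₁)}
  {S : (t : ℕ) → (Fin t → Ω₁) → Fin d → ℝ} {φ : (Fin T → Ω₁) → ℝ}

/-- Martingale measures for the stocks which integrate `φ`. -/
def stockMeas (Pt : (t : ℕ) → (Fin t → Ω₁) → Set (ProbabilityMeasure Ω₁))
    (S : (t : ℕ) → (Fin t → Ω₁) → Fin d → ℝ) (φ : (Fin T → Ω₁) → ℝ) :
    Set (Measure (Fin T → Ω₁)) :=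
  {Q | IsProbabilityMeasure Q ∧ (∃ P ∈ MeasFam Ω₁ Pt T, Q ≪ P) ∧ IsMartMeas Ω₁ S Q ∧
    ∫⁻ ω, ENNReal.ofReal (φ ω) ∂Q < ⊤}

omit [PolishSpace Ω₁] [Nonempty Ω₁] in
lemma integrable_of_abs_le {Q : Measure (Fin T → Ω₁)} (hQ : Q ∈ stockMeas Pt S φ)
    (hφ0 : ∀ ω, 0 ≤ φ ω) {f : (Fin T → Ω₁) → ℝ}
    (hf : UMeas f) {C : ℝ} (hfφ : ∀ ω, |f ω| ≤ C * φ ω) : Integrable f Q := by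
  obtain ⟨hQp, -, -, hφ⟩ := hQ
  refine ⟨(hf.aemeasurable Q).aestronglyMeasurable, ?_⟩
  have : ∫⁻ ω, ‖f ω‖ₑ ∂Q ≤ ∫⁻ ω, ENNReal.ofReal C * ENNReal.ofReal (φ ω) ∂Q := by
    refine lintegral_mono fun ω => ?_
    rw [← ENNReal.ofReal_mul' (hφ0 ω), Real.enorm_eq_ofReal_abs]
    exact ENNReal.ofReal_le_ofReal (hfφ ω)
  refine this.trans_lt ?_
  rw [lintegral_const_mul' _ _ ENNReal.ofReal_ne_top]
  exact ENNReal.mul_lt_top ENNReal.ofReal_lt_top hφ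

lemma measFam_nonempty (hne : ∀ t, t < T → ∀ ω, (Pt t ω).Nonempty)
    (hconv : ∀ t, t < T → ∀ ω, ConvexPM (Pt t ω))
    (hgraph : ∀ t, t < T →
      AnalyticSet {p : (Fin t → Ω₁) × ProbabilityMeasure Ω₁ | p.2 ∈ Pt t p.1}) :
    ∀ t ≤ T, (MeasFam Ω₁ Pt t).Nonempty := by
  intro t
  induction t with
  | zero => exact fun _ => ⟨_, rfl⟩
  | succ t ih =>
    intro ht
    obtain ⟨P, hP⟩ := ih (by omega)
    obtain ⟨a, p, hp, h⟩ := exists_stepFam (hne t ht) (hconv t ht) (hgraph t ht)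
    have := h.prob P hP
    obtain ⟨ζ, hζ, hζa⟩ := h.exists_section
    obtain ⟨k, hk, hkζ⟩ := exists_kernel_of_uMeas p hζ P
    exact ⟨_, h.glue P hP ζ hζ hζa k hk hkζ⟩

/-- Superhedging with stocks only. -/
theorem exists_stock_hedge (hne : ∀ t, t < T → ∀ ω, (Pt t ω).Nonempty)
    (hconv : ∀ t, t < T → ∀ ω, ConvexPM (Pt t ω))
    (hgraph : ∀ t, t < T →
      AnalyticSet {p : (Fin t → Ω₁) × ProbabilityMeasure Ω₁ | p.2 ∈ Pt t p.1})
    (hS : ∀ t, t ≤ T → Measurable (S t)) (hNA : NAStock Pt S T) (hφm : UMeas φ)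
    (hφ0 : ∀ ω, 0 ≤ φ ω) {f : (Fin T → Ω₁) → ℝ} (hf : UpperSemianalytic f) {C : ℝ}
    (hfφ : ∀ ω, |f ω| ≤ C * φ ω) {c : ℝ} (hc : ∀ Q ∈ stockMeas Pt S φ, ∫ ω, f ω ∂Q ≤ c) :
    ∃ H, Pred Ω₁ d H ∧ ∀ P ∈ MeasFam Ω₁ Pt T, ∀ᵐ ω ∂P, f ω ≤ c + gain Ω₁ S H T le_rfl ω := by
  rcases hedge_or_dualAbove hne hconv hgraph hS c T le_rfl hNA _ hf.coe
    (fun P _ => ae_of_all _ fun ω => EReal.bot_lt_coe _) with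
    ⟨H, hH, h⟩ | ⟨P, hP, Q, hQ, hQP, b, hb, hbf, h⟩
  · exact ⟨H, hH, fun P hP => (h P hP).mono fun ω hω => EReal.coe_le_coe_iff.1 hω⟩
  · exfalso
    have hw := (hφm.aemeasurable Q).ennreal_ofReal
    obtain ⟨Q', hQ', hQ'Q, hM, hbi, hwi, hcb⟩ := h (hw.mk _) hw.measurable_mk (by
      filter_upwards [hw.ae_eq_mk] with ω hω
      rw [← hω]
      exact ENNReal.ofReal_lt_top)
    have hmem : Q' ∈ stockMeas Pt S φ := by
      refine ⟨hQ', ⟨P, hP, hQ'Q.trans hQP⟩, hM, ?_⟩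
      rwa [lintegral_congr_ae (hQ'Q.ae_le hw.ae_eq_mk)]
    have := hc Q' hmem
    have hle : ∫ ω, b ω ∂Q' ≤ ∫ ω, f ω ∂Q' := by
      refine integral_mono_ae hbi (integrable_of_abs_le hmem hφ0 hf.uMeas hfφ) ?_
      have h' : ∀ᵐ ω ∂Q', (b ω : EReal) < f ω := hQ'Q.ae_le hbf
      filter_upwards [h'] with ω hω
      exact (EReal.coe_lt_coe_iff.1 hω).le
    linarith

lemma stockMeas_convex_comb (hne : ∀ t, t < T → ∀ ω, (Pt t ω).Nonempty)
    (hconv : ∀ t, t < T → ∀ ω, ConvexPM (Pt t ω))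
    (hgraph : ∀ t, t < T →
      AnalyticSet {p : (Fin t → Ω₁) × ProbabilityMeasure Ω₁ | p.2 ∈ Pt t p.1})
    {Q₁ Q₂ : Measure (Fin T → Ω₁)} (h₁ : Q₁ ∈ stockMeas Pt S φ) (h₂ : Q₂ ∈ stockMeas Pt S φ)
    {a b : ℝ≥0∞} (hab : a + b = 1) : a • Q₁ + b • Q₂ ∈ stockMeas Pt S φ := by
  obtain ⟨hp₁, ⟨P₁, hP₁, hac₁⟩, ⟨hi₁, hm₁⟩, hφ₁⟩ := h₁
  obtain ⟨hp₂, ⟨P₂, hP₂, hac₂⟩, ⟨hi₂, hm₂⟩, hφ₂⟩ := h₂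
  obtain ⟨P, hP, h1, h2⟩ := measFam_directed hne hconv hgraph T le_rfl P₁ hP₁ P₂ hP₂
  have ha : a ≠ ⊤ := ne_top_of_le_ne_top ENNReal.one_ne_top (hab ▸ le_self_add)
  have hb : b ≠ ⊤ := ne_top_of_le_ne_top ENNReal.one_ne_top (hab ▸ le_add_self)
  refine ⟨⟨by simp [hab]⟩, ⟨P, hP, ?_⟩, ⟨?_, ?_⟩, ?_⟩
  · exact Measure.AbsolutelyContinuous.add_left
      (Measure.smul_absolutelyContinuous.trans (hac₁.trans h1))
      (Measure.smul_absolutelyContinuous.trans (hac₂.trans h2))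
  · exact fun t h i => ((hi₁ t h i).smul_measure ha).add_measure ((hi₂ t h i).smul_measure hb)
  · intro t h i A hA
    rw [Measure.restrict_add, Measure.restrict_smul, Measure.restrict_smul,
      integral_add_measure ((hi₁ _ h i).restrict.smul_measure ha)
        ((hi₂ _ h i).restrict.smul_measure hb),
      integral_add_measure ((hi₁ _ _ i).restrict.smul_measure ha)
        ((hi₂ _ _ i).restrict.smul_measure hb),
      integral_smul_measure, integral_smul_measure, integral_smul_measure, integral_smul_measure,
      hm₁ t h i A hA, hm₂ t h i A hA]
  · rw [lintegral_add_measure, lintegral_smul_measure, lintegral_smul_measure]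
    exact ENNReal.add_lt_top.2 ⟨ENNReal.mul_lt_top ha.lt_top hφ₁, ENNReal.mul_lt_top hb.lt_top hφ₂⟩

end Options

section Semistatic
variable {Ω₁ : Type} [MeasurableSpace Ω₁] [TopologicalSpace Ω₁] [PolishSpace Ω₁]
  [BorelSpace Ω₁] [Nonempty Ω₁] {T d e : ℕ}
  {Pt : (t : ℕ) → (Fin t → Ω₁) → Set (ProbabilityMeasure Ω₁)}
  {S : (t : ℕ) → (Fin t → Ω₁) → Fin d → ℝ} {φ : (Fin T → Ω₁) → ℝ}
  {g : Fin e → (Fin T → Ω₁) → ℝ}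

omit [MeasurableSpace Ω₁] [TopologicalSpace Ω₁] [PolishSpace Ω₁] [BorelSpace Ω₁] [Nonempty Ω₁] in
lemma abs_sum_mul_le (hgφ : ∀ i ω, |g i ω| ≤ φ ω) (y : Fin e → ℝ) (ω : Fin T → Ω₁) :
    |∑ i, y i * g i ω| ≤ (∑ i, |y i|) * φ ω := by
  rw [Finset.sum_mul]
  refine (Finset.abs_sum_le_sum_abs _ _).trans (Finset.sum_le_sum fun i _ => ?_)
  rw [abs_mul]
  exact mul_le_mul_of_nonneg_left (hgφ i ω) (abs_nonneg _)

omit [TopologicalSpace Ω₁] [PolishSpace Ω₁] [BorelSpace Ω₁] [Nonempty Ω₁] in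
lemma measurable_sum_mul (hg : ∀ i, Measurable (g i)) (y : Fin e → ℝ) :
    Measurable fun ω => ∑ i, y i * g i ω :=
  Finset.measurable_sum _ fun i _ => (hg i).const_mul _

omit [MeasurableSpace Ω₁] [TopologicalSpace Ω₁] [PolishSpace Ω₁] [BorelSpace Ω₁] [Nonempty Ω₁] in
lemma gain_neg (H : (u : ℕ) → (Fin u → Ω₁) → Fin d → ℝ) (ω : Fin T → Ω₁) :
    gain Ω₁ S (fun u ω => -H u ω) T le_rfl ω = -gain Ω₁ S H T le_rfl ω := by
  simp [gain]

omit [PolishSpace Ω₁] [Nonempty Ω₁] in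
/-- Almost sure form of the no-arbitrage condition. -/
lemma NA.ae (hS : ∀ t, t ≤ T → Measurable (S t)) (hg : ∀ i, Measurable (g i))
    (hNA : NA Ω₁ (MeasFam Ω₁ Pt T) S g) {H} (hH : Pred Ω₁ d H) (h : Fin e → ℝ)
    (h0 : ∀ P ∈ MeasFam Ω₁ Pt T, ∀ᵐ ω ∂P, 0 ≤ gain Ω₁ S H T le_rfl ω + ∑ i, h i * g i ω) :
    ∀ P ∈ MeasFam Ω₁ Pt T, ∀ᵐ ω ∂P, gain Ω₁ S H T le_rfl ω + ∑ i, h i * g i ω = 0 := by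
  have hu : UMeas fun ω => gain Ω₁ S H T le_rfl ω + ∑ i, h i * g i ω :=
    (uMeas_gain hS hH T le_rfl).add (measurable_sum_mul hg h).uMeas
  rw [← quasiSure_iff (hu.umSet_eq (uMeas_const 0))]
  rw [← quasiSure_iff ((uMeas_const 0).umSet_le hu)] at h0
  exact hNA H hH h h0

omit [PolishSpace Ω₁] [Nonempty Ω₁] in
lemma NA.naStock (hS : ∀ t, t ≤ T → Measurable (S t)) (hg : ∀ i, Measurable (g i))
    (hNA : NA Ω₁ (MeasFam Ω₁ Pt T) S g) : NAStock Pt S T := fun H hH h0 => by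
  simpa using hNA.ae hS hg hH 0 (by simpa using h0)

end Semistatic

lemma hedge_uMSet {Ω₁ : Type} [MeasurableSpace Ω₁] {T d e : ℕ}
    {S : (t : ℕ) → (Fin t → Ω₁) → Fin d → ℝ} {g : Fin e → (Fin T → Ω₁) → ℝ}
    (hS : ∀ t, t ≤ T → Measurable (S t)) (hg : ∀ i, Measurable (g i))
    {f : (Fin T → Ω₁) → ℝ} (hf : UMeas f) {H} (hH : Pred Ω₁ d H) (h : Fin e → ℝ) (x : ℝ) :
    UMSet {ω | f ω ≤ x + gain Ω₁ S H T le_rfl ω + ∑ i, h i * g i ω} :=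
  hf.umSet_le (((uMeas_const x).add (uMeas_gain hS hH T le_rfl)).add
    (UMeas.sum fun i => ((hg i).const_mul _).uMeas))

end BN

open BN in
/-- **Weighted Superhedging Theorem** (Theorem 5.1(b)). For a weight function `φ ≥ 1`
dominating the options and the claim, under `NA(𝒫)` the superhedging price of an
upper semianalytic `f` with `|f| ≤ φ` equals `sup_{Q ∈ 𝒬_φ} E_Q[f] ∈ (-∞, ∞]`, and
an optimal semistatic superhedging strategy exists. -/
theorem weighted_superhedging_theorem
    (Ω₁ : Type) [MeasurableSpace Ω₁] [TopologicalSpace Ω₁] [PolishSpace Ω₁]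
    [BorelSpace Ω₁] [Nonempty Ω₁] (T d e : ℕ)
    (Pt : (t : ℕ) → (Fin t → Ω₁) → Set (ProbabilityMeasure Ω₁))
    (hPtne : ∀ t, t < T → ∀ ω, (Pt t ω).Nonempty)
    (hPtconv : ∀ t, t < T → ∀ ω, ConvexPM (Pt t ω))
    (hPtgraph : ∀ t, t < T →
      AnalyticSet {p : (Fin t → Ω₁) × ProbabilityMeasure Ω₁ | p.2 ∈ Pt t p.1})
    (S : (t : ℕ) → (Fin t → Ω₁) → Fin d → ℝ) (hS : ∀ t, t ≤ T → Measurable (S t))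
    (g : Fin e → (Fin T → Ω₁) → ℝ) (hg : ∀ i, Measurable (g i))
    (φ : (Fin T → Ω₁) → ℝ) (hφmeas : @Measurable _ _ (univComp (Fin T → Ω₁)) _ φ)
    (hφ1 : ∀ ω, 1 ≤ φ ω) (hgφ : ∀ i ω, |g i ω| ≤ φ ω)
    (hNA : NA Ω₁ (MeasFam Ω₁ Pt T) S g)
    (f : (Fin T → Ω₁) → ℝ) (hf : UpperSemianalytic f) (hfφ : ∀ ω, |f ω| ≤ φ ω) :
    superPrice Ω₁ (MeasFam Ω₁ Pt T) S g f
        = sSup ((fun Q => expec Q f) ''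
            {Q ∈ QSet Ω₁ (MeasFam Ω₁ Pt T) S g | (∫⁻ ω, ENNReal.ofReal (φ ω) ∂Q) < ⊤}) ∧
    superPrice Ω₁ (MeasFam Ω₁ Pt T) S g f ≠ ⊥ ∧
    ∃ H : (u : ℕ) → (Fin u → Ω₁) → Fin d → ℝ, ∃ h : Fin e → ℝ, Pred Ω₁ d H ∧
      QuasiSure (MeasFam Ω₁ Pt T) (univComp (Fin T → Ω₁)) (fun ω =>
        (f ω : EReal) ≤ superPrice Ω₁ (MeasFam Ω₁ Pt T) S g f
          + ((gain Ω₁ S H T le_rfl ω + ∑ i, h i * g i ω : ℝ) : EReal)) := by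
  have hφ0 : ∀ ω, 0 ≤ φ ω := fun ω => zero_le_one.trans (hφ1 ω)
  have hNAS := hNA.naStock hS hg
  have hgi : ∀ Q ∈ stockMeas Pt S φ, ∀ i, Integrable (g i) Q := fun Q hQ i =>
    integrable_of_abs_le hQ hφ0 (hg i).uMeas (C := 1) fun ω => by simpa using hgφ i ω
  have hfi : ∀ Q ∈ stockMeas Pt S φ, Integrable f Q := fun Q hQ =>
    integrable_of_abs_le hQ hφ0 hf.uMeas (C := 1) fun ω => by simpa using hfφ ω
  have hsum : ∀ Q ∈ stockMeas Pt S φ, ∀ y : Fin e → ℝ,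
      ∫ ω, ∑ i, y i * g i ω ∂Q = ∑ i, y i * ∫ ω, g i ω ∂Q := fun Q hQ y => by
    rw [integral_finsetSum _ fun i _ => (hgi Q hQ i).const_mul _]
    simp only [integral_const_mul]
  have hsumi : ∀ Q ∈ stockMeas Pt S φ, ∀ y : Fin e → ℝ,
      Integrable (fun ω => ∑ i, y i * g i ω) Q := fun Q hQ y =>
    integrable_finsetSum _ fun i _ => (hgi Q hQ i).const_mul _
  have hQ0 : ∀ Q, Q ∈ {Q ∈ QSet Ω₁ (MeasFam Ω₁ Pt T) S g |
      (∫⁻ ω, ENNReal.ofReal (φ ω) ∂Q) < ⊤} ↔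
      Q ∈ stockMeas Pt S φ ∧ ∀ i, ∫ ω, g i ω ∂Q = 0 := by
    intro Q
    constructor
    · rintro ⟨⟨h1, h2, h3, h4⟩, h5⟩
      have hQ : Q ∈ stockMeas Pt S φ := ⟨h1, h2, h3, h5⟩
      refine ⟨hQ, fun i => ?_⟩
      have := h4 i
      rw [expec_eq_integral (hgi Q hQ i)] at this
      exact_mod_cast this
    · rintro ⟨hQ, h4⟩
      refine ⟨⟨hQ.1, hQ.2.1, hQ.2.2.1, fun i => ?_⟩, hQ.2.2.2⟩
      rw [expec_eq_integral (hgi Q hQ i), h4 i]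
      rfl
  -- the set of prices of the options and the claim
  set K : Set ((Fin e → ℝ) × ℝ) := (fun Q : Measure (Fin T → Ω₁) =>
    ((fun i => ∫ ω, g i ω ∂Q), ∫ ω, f ω ∂Q)) '' stockMeas Pt S φ with hKdef
  have hKconv : Convex ℝ K := by
    rintro _ ⟨Q₁, h₁, rfl⟩ _ ⟨Q₂, h₂, rfl⟩ a b ha hb hab
    have hab' : ENNReal.ofReal a + ENNReal.ofReal b = 1 := by
      rw [← ENNReal.ofReal_add ha hb, hab, ENNReal.ofReal_one]
    have hintg : ∀ {k : (Fin T → Ω₁) → ℝ}, Integrable k Q₁ → Integrable k Q₂ →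
        ∫ ω, k ω ∂(ENNReal.ofReal a • Q₁ + ENNReal.ofReal b • Q₂) =
          a * ∫ ω, k ω ∂Q₁ + b * ∫ ω, k ω ∂Q₂ := fun hk₁ hk₂ => by
      rw [integral_add_measure (hk₁.smul_measure ENNReal.ofReal_ne_top)
        (hk₂.smul_measure ENNReal.ofReal_ne_top), integral_smul_measure, integral_smul_measure,
        ENNReal.toReal_ofReal ha, ENNReal.toReal_ofReal hb]
      rfl
    refine ⟨_, stockMeas_convex_comb hPtne hPtconv hPtgraph h₁ h₂ hab', ?_⟩
    refine Prod.ext (funext fun i => ?_) ?_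
    · exact hintg (hgi Q₁ h₁ i) (hgi Q₂ h₂ i)
    · exact hintg (hfi Q₁ h₁) (hfi Q₂ h₂)
  have hKne : K.Nonempty := by
    rw [hKdef, image_nonempty]
    by_contra hemp
    rw [not_nonempty_iff_eq_empty] at hemp
    obtain ⟨H, hH, hHle⟩ := exists_stock_hedge hPtne hPtconv hPtgraph hS hNAS hφmeas hφ0
      (f := fun _ => 0) (upperSemianalytic_of_measurable measurable_const) (C := 0) (by simp)
      (c := -1) (by simp [hemp])
    obtain ⟨P, hP⟩ := measFam_nonempty hPtne hPtconv hPtgraph T le_rfl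
    have := measFam_prob T P hP
    obtain ⟨ω, h1, h2⟩ := ((hHle P hP).and (hNAS H hH (fun P hP => (hHle P hP).mono fun ω hω => by
      linarith) P hP)).exists
    linarith
  have hKNA : ∀ y : Fin e → ℝ, (∀ p ∈ K, 0 ≤ ∑ i, y i * p.1 i) →
      ∀ p ∈ K, ∑ i, y i * p.1 i = 0 := by
    intro y hy
    obtain ⟨H, hH, hHle⟩ := exists_stock_hedge hPtne hPtconv hPtgraph hS hNAS hφmeas hφ0
      (f := fun ω => -∑ i, y i * g i ω)
      (upperSemianalytic_of_measurable (measurable_sum_mul hg y).neg) (C := ∑ i, |y i|)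
      (fun ω => by rw [abs_neg]; exact abs_sum_mul_le hgφ y ω) (c := 0) (fun Q hQ => by
        rw [integral_neg, hsum Q hQ]
        have := hy _ ⟨Q, hQ, rfl⟩
        simpa using this)
    have h0 := hNA.ae hS hg hH y fun P hP => (hHle P hP).mono fun ω hω => by linarith
    rintro _ ⟨Q, hQ, rfl⟩
    refine le_antisymm ?_ (hy _ ⟨Q, hQ, rfl⟩)
    have hQp := hQ.1
    obtain ⟨P, hP, hQP⟩ := hQ.2.1
    rw [← hsum Q hQ y]
    refine integral_le_of_le_gain hS hQ.2.2.1 (fun u ω => -H u ω) (hsumi Q hQ y) ?_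
    have h0Q : ∀ᵐ ω ∂Q, gain Ω₁ S H T le_rfl ω + ∑ i, y i * g i ω = 0 := hQP.ae_le (h0 P hP)
    filter_upwards [h0Q] with ω hω
    rw [gain_neg]
    linarith
  -- weak duality
  have hweak : ∀ Q ∈ stockMeas Pt S φ, (∀ i, ∫ ω, g i ω ∂Q = 0) → ∀ (x : ℝ) H (h : Fin e → ℝ),
      Pred Ω₁ d H → QuasiSure (MeasFam Ω₁ Pt T) (univComp (Fin T → Ω₁))
        (fun ω => f ω ≤ x + gain Ω₁ S H T le_rfl ω + ∑ i, h i * g i ω) → ∫ ω, f ω ∂Q ≤ x := by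
    intro Q hQ hQg x H h hH hle
    rw [quasiSure_iff (hedge_uMSet hS hg hf.uMeas hH h x)] at hle
    have hQp := hQ.1
    obtain ⟨P, hP, hQP⟩ := hQ.2.1
    have hleQ : ∀ᵐ ω ∂Q, f ω ≤ x + gain Ω₁ S H T le_rfl ω + ∑ i, h i * g i ω :=
      hQP.ae_le (hle P hP)
    have := integral_le_of_le_gain hS hQ.2.2.1 H (F := fun ω => f ω - ∑ i, h i * g i ω)
      ((hfi Q hQ).sub (hsumi Q hQ h)) (x := x) (hleQ.mono fun ω hω => by linarith)
    rw [integral_sub (hfi Q hQ) (hsumi Q hQ h), hsum Q hQ] at this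
    simpa [hQg] using this
  set sup := sSup ((fun Q => expec Q f) ''
    {Q ∈ QSet Ω₁ (MeasFam Ω₁ Pt T) S g | (∫⁻ ω, ENNReal.ofReal (φ ω) ∂Q) < ⊤}) with hsupdef
  have hle : sup ≤ superPrice Ω₁ (MeasFam Ω₁ Pt T) S g f := by
    refine sSup_le ?_
    rintro _ ⟨Q, hQ, rfl⟩
    obtain ⟨hQs, hQg⟩ := (hQ0 Q).1 hQ
    refine le_sInf ?_
    rintro _ ⟨x, ⟨H, h, hH, hx⟩, rfl⟩
    simp only
    rw [expec_eq_integral (hfi Q hQs)]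
    exact EReal.coe_le_coe_iff.2 (hweak Q hQs hQg x H h hH hx)
  have hmemle : ∀ Q ∈ stockMeas Pt S φ, (∀ i, ∫ ω, g i ω ∂Q = 0) →
      ((∫ ω, f ω ∂Q : ℝ) : EReal) ≤ sup := fun Q hQ hQg => by
    rw [← expec_eq_integral (hfi Q hQ)]
    exact le_sSup ⟨Q, (hQ0 Q).2 ⟨hQ, hQg⟩, rfl⟩
  have hbot : sup ≠ ⊥ := by
    have hz : (0 : Fin e → ℝ) ∈ Prod.fst '' K :=
      fd_exists_zero (hKconv.linear_image (LinearMap.fst ℝ _ _)) (hKne.image _) (by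
        intro y hy
        rintro _ ⟨p, hp, rfl⟩
        exact hKNA y (fun p hp => hy _ ⟨p, hp, rfl⟩) p hp)
    obtain ⟨_, ⟨Q, hQ, rfl⟩, hQg⟩ := hz
    exact ((EReal.bot_lt_coe _).trans_le (hmemle Q hQ fun i => congrFun hQg i)).ne'
  rcases eq_or_ne sup ⊤ with htop | htop
  · have hp : superPrice Ω₁ (MeasFam Ω₁ Pt T) S g f = ⊤ := top_le_iff.1 (htop ▸ hle)
    rw [hp, htop]
    refine ⟨rfl, top_ne_bot, fun _ _ => 0, 0, pred_zero, ∅,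
      @MeasurableSet.empty _ (univComp _), fun ω hω => hω ?_, by simp⟩
    beta_reduce
    rw [EReal.top_add_coe]
    exact le_top
  · obtain ⟨c, hc⟩ : ∃ c : ℝ, sup = c := ⟨sup.toReal, (EReal.coe_toReal htop hbot).symm⟩
    obtain ⟨y, hy⟩ := fd_duality hKconv hKne hKNA c (by
      rintro _ ⟨Q, hQ, rfl⟩ hQg
      have := hmemle Q hQ fun i => congrFun hQg i
      rw [hc] at this
      exact EReal.coe_le_coe_iff.1 this)
    obtain ⟨H, hH, hHle⟩ := exists_stock_hedge hPtne hPtconv hPtgraph hS hNAS hφmeas hφ0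
      (f := fun ω => f ω - ∑ i, y i * g i ω) (hf.sub_measurable (measurable_sum_mul hg y))
      (C := 1 + ∑ i, |y i|) (fun ω => by
        rw [add_mul, one_mul]
        exact (abs_sub _ _).trans (add_le_add (hfφ ω) (abs_sum_mul_le hgφ y ω))) (c := c)
      (fun Q hQ => by
        rw [integral_sub (hfi Q hQ) (hsumi Q hQ y), hsum Q hQ]
        have := hy _ ⟨Q, hQ, rfl⟩
        simp only at this
        linarith)
    have hqs : QuasiSure (MeasFam Ω₁ Pt T) (univComp (Fin T → Ω₁))
        (fun ω => f ω ≤ c + gain Ω₁ S H T le_rfl ω + ∑ i, y i * g i ω) := by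
      rw [quasiSure_iff (hedge_uMSet hS hg hf.uMeas hH y c)]
      exact fun P hP => (hHle P hP).mono fun ω hω => by linarith
    have heq : superPrice Ω₁ (MeasFam Ω₁ Pt T) S g f = sup := by
      refine le_antisymm ?_ hle
      rw [hc]
      exact sInf_le ⟨c, ⟨H, y, hH, hqs⟩, rfl⟩
    refine ⟨heq, heq ▸ hbot, H, y, hH, ?_⟩
    rw [heq, hc]
    simp only [← EReal.coe_add, EReal.coe_le_coe_iff, ← add_assoc]
    exact hqs
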